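/- (Ornstein–Zernike decay.) Let d ≥ 1 and suppose S satisfies Assumptions Ω and J with constants M, K, ζ. Then for every ε' > 0 there exists R > 0 such that for all x ∈ ℤ^d with ‖x‖₂ ≥ R, |S(x) e^{m_S|x|_S} (2π)^{(d−1)/2} (det Λ_x̂)^{1/2} (x̂·Λ_x̂⁻¹x̂)^{1/2} ‖x‖₂^{(d−1)/2} ‖η_x̂‖₂^{−(d−3)/2} − ĥ^{(μ_x̂)}(0)| ≤ ε'; that is, S(x) = (2π)^{−(d−1)/2}(det Λ_x̂)^{−1/2}(x̂·Λ_x̂⁻¹x̂)^{−1/2} ‖η_x̂‖₂^{(d−3)/2} ‖x‖₂^{−(d−1)/2} e^{−m_S|x|_S}[ĥ^{(μ_x̂)}(0) + o(1)] as ‖x‖₂ → ∞. -/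

import Mathlib

open scoped BigOperators ENNReal Real Topology Pointwise
open MeasureTheory Matrix Filter

noncomputable section

namespace OZpaper

variable {d : ℕ}

/-- Dot product of a real vector with a lattice point. -/
def rdotZ (μ : Fin d → ℝ) (x : Fin d → ℤ) : ℝ := ∑ i, μ i * (x i : ℝ)

/-- Dot product of two real vectors. -/
def rdot (μ x : Fin d → ℝ) : ℝ := ∑ i, μ i * x i

/-- Euclidean norm of a lattice point. -/
def enormZ (x : Fin d → ℤ) : ℝ := Real.sqrt (∑ i, ((x i : ℝ)) ^ 2)

/-- Euclidean norm of a real vector. -/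
def enormR (x : Fin d → ℝ) : ℝ := Real.sqrt (∑ i, (x i) ^ 2)

/-- ℓ¹ norm of a real vector. -/
def l1R (x : Fin d → ℝ) : ℝ := ∑ i, |x i|

/-- ℓ∞ norm of a real vector. -/
def linftyR (x : Fin d → ℝ) : ℝ := ⨆ i, |x i|

/-- The vector `t • e₁`. -/
def e1R (d : ℕ) (t : ℝ) : Fin d → ℝ := fun i => if (i : ℕ) = 0 then t else 0

/-- The lattice point `n • e₁`. -/
def e1Z (d : ℕ) (n : ℤ) : Fin d → ℤ := fun i => if (i : ℕ) = 0 then n else 0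

/-- Cast of a lattice point to a real vector. -/
def toR (x : Fin d → ℤ) : Fin d → ℝ := fun i => (x i : ℝ)

/-- ℤ^d-symmetry: invariance under coordinate permutations and sign flips. -/
def ZdSymmetric (f : (Fin d → ℤ) → ℝ) : Prop :=
  (∀ (σ : Equiv.Perm (Fin d)) (x : Fin d → ℤ), f (fun i => x (σ i)) = f x) ∧
  (∀ (ε : Fin d → Bool) (x : Fin d → ℤ), f (fun i => if ε i then -(x i) else x i) = f x)

/-- Tilted susceptibility `χ^{(μ)}`, valued in `ℝ≥0∞`. -/
def chi (S : (Fin d → ℤ) → ℝ) (μ : Fin d → ℝ) : ℝ≥0∞ :=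
  ∑' x, ENNReal.ofReal (S x * Real.exp (rdotZ μ x))

/-- The set `Ω = {μ : χ^{(μ)} < ∞}`. -/
def Omega (S : (Fin d → ℤ) → ℝ) : Set (Fin d → ℝ) := {μ | chi S μ < ⊤}

/-- The mass `m_S`. -/
def mass (S : (Fin d → ℤ) → ℝ) : ℝ := sSup {t : ℝ | 0 ≤ t ∧ chi S (e1R d t) < ⊤}

/-- Assumption Ω. -/
structure AssumptionOmega (S : (Fin d → ℤ) → ℝ) : Prop where
  nonneg : ∀ x, 0 ≤ S x
  symm : ZdSymmetric S
  open_Omega : IsOpen (Omega S)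
  zero_mem : (0 : Fin d → ℝ) ∈ Omega S
  exists_not_mem : ∃ μ₁ : ℝ, 0 < μ₁ ∧ e1R d μ₁ ∉ Omega S

/-- Fourier transform `Q̂(k) = ∑_y Q(y) e^{-i k·y}`. -/
def fourierZ (Q : (Fin d → ℤ) → ℝ) (k : Fin d → ℝ) : ℂ :=
  ∑' y, (Q y : ℂ) * Complex.exp (-Complex.I * (rdotZ k y : ℂ))

/-- ℓ^p norm of a function on ℤ^d, valued in `ℝ≥0∞`. -/
def lpNorm (f : (Fin d → ℤ) → ℝ) (p : ℝ) : ℝ≥0∞ :=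
  (∑' y, ENNReal.ofReal (|f y| ^ p)) ^ (1 / p)

/-- The exponent `p_d`. -/
def pExp (d : ℕ) (ζ : ℝ) : ℝ := if d = 1 then 2 else (d : ℝ) / ((d : ℝ) - 2 + min ζ 2)

/-- The class 𝒬_{M,K,ζ} without the (d-1)-th moment bounds. -/
structure MemQweak (M K ζ : ℝ) (Q g : (Fin d → ℤ) → ℝ) : Prop where
  Q_l1 : lpNorm Q 1 ≤ ENNReal.ofReal M
  Q_moment : lpNorm (fun y => enormZ y ^ (2 + ζ) * Q y) 1 ≤ ENNReal.ofReal M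
  infrared : ∀ k : Fin d → ℝ, (∀ i, |k i| ≤ π) →
    K * enormR k ^ 2 ≤ (fourierZ Q 0 - fourierZ Q k).re
  g_l1 : lpNorm g 1 ≤ ENNReal.ofReal M
  g_zeta : lpNorm (fun y => enormZ y ^ ζ * g y) 1 ≤ ENNReal.ofReal M
  g_two : lpNorm (fun y => enormZ y ^ (2 : ℝ) * g y) (min (pExp d ζ) 2) ≤ ENNReal.ofReal M

/-- The class 𝒬_{M,K,ζ}. -/
structure MemQ (M K ζ : ℝ) (Q g : (Fin d → ℤ) → ℝ) : Prop where
  Q_l1 : lpNorm Q 1 ≤ ENNReal.ofReal M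
  Q_moment : lpNorm (fun y => enormZ y ^ (2 + ζ) * Q y) 1 ≤ ENNReal.ofReal M
  infrared : ∀ k : Fin d → ℝ, (∀ i, |k i| ≤ π) →
    K * enormR k ^ 2 ≤ (fourierZ Q 0 - fourierZ Q k).re
  g_l1 : lpNorm g 1 ≤ ENNReal.ofReal M
  g_zeta : lpNorm (fun y => enormZ y ^ ζ * g y) 1 ≤ ENNReal.ofReal M
  g_two : lpNorm (fun y => enormZ y ^ (2 : ℝ) * g y) (min (pExp d ζ) 2) ≤ ENNReal.ofReal M
  Q_dm1 : 4 ≤ d →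
    lpNorm (fun y => enormZ y ^ ((d : ℝ) - 1) * Q y) (min ((d : ℝ) / 3) 2) ≤ ENNReal.ofReal M
  g_dm1 : 4 ≤ d →
    lpNorm (fun y => enormZ y ^ ((d : ℝ) - 1) * g y) 2 ≤ ENNReal.ofReal M

/-- Convolution on ℤ^d. -/
def conv (f g : (Fin d → ℤ) → ℝ) (x : Fin d → ℤ) : ℝ := ∑' y, f (x - y) * g y

/-- Exponential tilt `f^{(μ)}`. -/
def tilt (f : (Fin d → ℤ) → ℝ) (μ : Fin d → ℝ) : (Fin d → ℤ) → ℝ :=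
  fun x => f x * Real.exp (rdotZ μ x)

/-- `∑_y f(y) e^{μ·y}`, i.e. `f̂^{(μ)}(0)`. -/
def tiltSum (f : (Fin d → ℤ) → ℝ) (μ : Fin d → ℝ) : ℝ := ∑' y, f y * Real.exp (rdotZ μ y)

/-- Assumption J. -/
structure AssumptionJ (S J h : (Fin d → ℤ) → ℝ) (M K ζ : ℝ) : Prop where
  M_pos : 0 < M
  K_pos : 0 < K
  zeta_pos : 0 < ζ
  J_symm : ZdSymmetric J
  h_symm : ZdSymmetric h
  J_summable : Summable fun x => |J x|
  h_summable : Summable fun x => |h x|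
  OZ_eq : ∀ x, S x = h x + conv J S x
  memQ : ∀ μ ∈ closure (Omega S), MemQ M K ζ (tilt J μ) (tilt h μ)
  hhat_pos : ∀ μ ∈ closure (Omega S), 0 < tiltSum h μ

/-- Assumption J, without the (d-1)-th moment bounds of the class 𝒬. -/
structure AssumptionJweak (S J h : (Fin d → ℤ) → ℝ) (M K ζ : ℝ) : Prop where
  M_pos : 0 < M
  K_pos : 0 < K
  zeta_pos : 0 < ζ
  J_symm : ZdSymmetric J
  h_symm : ZdSymmetric h
  J_summable : Summable fun x => |J x|
  h_summable : Summable fun x => |h x|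
  OZ_eq : ∀ x, S x = h x + conv J S x
  memQ : ∀ μ ∈ closure (Omega S), MemQweak M K ζ (tilt J μ) (tilt h μ)
  hhat_pos : ∀ μ ∈ closure (Omega S), 0 < tiltSum h μ

/-- `μ` is the optimal tilt `μ_x̂` for direction `x`. -/
def IsOptTilt (S : (Fin d → ℤ) → ℝ) (x μ : Fin d → ℝ) : Prop :=
  μ ∈ frontier (Omega S) ∧ ∀ ν ∈ closure (Omega S), rdot ν x ≤ rdot μ x

/-- The norm `|x|_S = (max_{μ ∈ Ω̄} μ·x)/m_S`. -/
def normS (S : (Fin d → ℤ) → ℝ) (x : Fin d → ℝ) : ℝ :=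
  sSup ((fun μ => rdot μ x) '' closure (Omega S)) / mass S

/-- The drift vector `η` of the tilted kernel. -/
def etaOf (J : (Fin d → ℤ) → ℝ) (μ : Fin d → ℝ) : Fin d → ℝ :=
  fun j => ∑' y, (y j : ℝ) * J y * Real.exp (rdotZ μ y)

/-- The covariance matrix `Λ` of the tilted kernel. -/
def LambdaOf (J : (Fin d → ℤ) → ℝ) (μ : Fin d → ℝ) : Matrix (Fin d) (Fin d) ℝ :=
  Matrix.of fun j l => ∑' y, (y j : ℝ) * (y l : ℝ) * J y * Real.exp (rdotZ μ y)

/-- The Brownian heat kernel `ρ_t(x; η, Λ)`. -/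
def heatKer (d : ℕ) (t : ℝ) (x η : Fin d → ℝ) (Λ : Matrix (Fin d) (Fin d) ℝ) : ℝ :=
  (1 / Real.sqrt Λ.det) * (1 / (2 * π * t) ^ ((d : ℝ) / 2)) *
    Real.exp (-(1 / (2 * t)) * rdot (x - t • η) (Λ⁻¹ *ᵥ (x - t • η)))

/-- The Brownian Green function `𝒞(x; η, Λ)`. -/
def greenC (d : ℕ) (x η : Fin d → ℝ) (Λ : Matrix (Fin d) (Fin d) ℝ) : ℝ :=
  ∫ t in Set.Ioi (0 : ℝ), heatKer d t x η Λ

/-- The massive continuum Green function `𝔾_a(x)`. -/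
def massiveG (d : ℕ) (a : ℝ) (x : Fin d → ℝ) : ℝ :=
  ∫ t in Set.Ioi (0 : ℝ),
    (1 / (2 * π * t) ^ ((d : ℝ) / 2)) * Real.exp (-enormR x ^ 2 / (2 * t)) *
      Real.exp (-(t * a ^ 2) / 2)

/-- The constant `A_φ = ∫_{ℝ^d} ‖y‖₂^φ 𝔾₁(y) dy`. -/
def Aconst (d : ℕ) (φ : ℝ) : ℝ := ∫ y : Fin d → ℝ, enormR y ^ φ * massiveG d 1 y

/-- The torus `[-π, π]^d`. -/
def torus (d : ℕ) : Set (Fin d → ℝ) := Set.univ.pi fun _ => Set.Icc (-π) π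

/-- The Fourier integral `I_t(x)`. -/
def It (Q g : (Fin d → ℤ) → ℝ) (t : ℝ) (x : Fin d → ℤ) : ℂ :=
  (((2 * π) ^ d : ℝ) : ℂ)⁻¹ *
    ∫ k in torus d, Complex.exp (Complex.I * (rdotZ k x : ℂ)) * fourierZ g k *
      Complex.exp (-(t : ℂ) * (fourierZ Q 0 - fourierZ Q k))

/-- The quantity `G_Q(x)`. -/
def GQ (Q g : (Fin d → ℤ) → ℝ) (x : Fin d → ℤ) : ℂ :=
  ∫ t in Set.Ioi (0 : ℝ), It Q g t x

/-- The Kronecker delta at the origin. -/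
def deltaZ (d : ℕ) : (Fin d → ℤ) → ℝ := fun x => if x = 0 then 1 else 0

/-- n-fold convolution power. -/
def convPow (D : (Fin d → ℤ) → ℝ) : ℕ → (Fin d → ℤ) → ℝ
  | 0 => deltaZ d
  | n + 1 => conv D (convPow D n)

/-- Random-walk Green function `S_z(x) = ∑_n z^n D^{*n}(x)`. -/
def rwG (D : (Fin d → ℤ) → ℝ) (z : ℝ) (x : Fin d → ℤ) : ℝ :=
  ∑' n : ℕ, z ^ n * convPow D n x

/-- `σ² = ∑_x ‖x‖₂² J(x)`. -/
def sigmaSq (J : (Fin d → ℤ) → ℝ) : ℝ := ∑' x, enormZ x ^ 2 * J x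

/-- Susceptibility `χ = ∑_x S(x)`. -/
def suscept (S : (Fin d → ℤ) → ℝ) : ℝ := ∑' x, S x

/-- `ĥ(0) = ∑_x h(x)`. -/
def h0 (h : (Fin d → ℤ) → ℝ) : ℝ := ∑' x, h x

/-- Correlation length of order φ. -/
def xiPhi (S : (Fin d → ℤ) → ℝ) (φ : ℝ) : ℝ :=
  ((∑' x, enormZ x ^ φ * S x) / suscept S) ^ (1 / φ)

/-- A critical family of OZ systems. -/
structure CriticalFamily (d : ℕ) (δ zc M K ζ : ℝ) (S J h : ℝ → (Fin d → ℤ) → ℝ) : Prop where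
  δ_pos : 0 < δ
  assumOmega : ∀ z ∈ Set.Ico (zc - δ) zc, AssumptionOmega (S z)
  assumJ : ∀ z ∈ Set.Ico (zc - δ) zc, AssumptionJ (S z) (J z) (h z) M K ζ
  mass_tendsto : Tendsto (fun z => mass (S z)) (𝓝[<] zc) (𝓝 0)

/-- Convolution on ℤ. -/
def convZ (f g : ℤ → ℝ) (x : ℤ) : ℝ := ∑' y, f (x - y) * g y

/-- n-fold convolution power on ℤ. -/
def convZPow (f : ℤ → ℝ) : ℕ → ℤ → ℝ
  | 0 => fun x => if x = 0 then 1 else 0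
  | n + 1 => convZ f (convZPow f n)

/-! ### Euclidean norms and dot products -/

lemma enormR_eq_norm (x : Fin d → ℝ) : enormR x = ‖(WithLp.toLp 2 x : EuclideanSpace ℝ (Fin d))‖ := by
  simp [enormR, EuclideanSpace.norm_eq]

lemma rdot_eq_inner (a b : Fin d → ℝ) :
    rdot a b = inner ℝ (WithLp.toLp 2 a : EuclideanSpace ℝ (Fin d)) (WithLp.toLp 2 b) := by
  simp [rdot, PiLp.inner_apply, mul_comm]

lemma enormR_nonneg (x : Fin d → ℝ) : 0 ≤ enormR x := Real.sqrt_nonneg _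

lemma enormZ_nonneg (x : Fin d → ℤ) : 0 ≤ enormZ x := Real.sqrt_nonneg _

lemma enormZ_eq (x : Fin d → ℤ) : enormZ x = enormR (toR x) := rfl

lemma rdotZ_eq (μ : Fin d → ℝ) (x : Fin d → ℤ) : rdotZ μ x = rdot μ (toR x) := rfl

lemma abs_rdot_le (a b : Fin d → ℝ) : |rdot a b| ≤ enormR a * enormR b := by
  rw [rdot_eq_inner, enormR_eq_norm, enormR_eq_norm]
  exact abs_real_inner_le_norm _ _

lemma abs_rdotZ_le (a : Fin d → ℝ) (y : Fin d → ℤ) : |rdotZ a y| ≤ enormR a * enormZ y :=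
  abs_rdot_le a (toR y)

lemma enormR_add_le (a b : Fin d → ℝ) : enormR (a + b) ≤ enormR a + enormR b := by
  simp only [enormR_eq_norm, WithLp.toLp_add]
  exact norm_add_le _ _

lemma enormR_sub_le (a b : Fin d → ℝ) : enormR (a - b) ≤ enormR a + enormR b := by
  simp only [enormR_eq_norm, WithLp.toLp_sub]
  exact norm_sub_le _ _

lemma enormR_smul (c : ℝ) (a : Fin d → ℝ) : enormR (c • a) = |c| * enormR a := by
  simp only [enormR_eq_norm, WithLp.toLp_smul, norm_smul, Real.norm_eq_abs]

lemma enormR_neg (a : Fin d → ℝ) : enormR (-a) = enormR a := by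
  simp [enormR]

lemma le_enormR_sub (a b : Fin d → ℝ) : enormR a - enormR b ≤ enormR (a - b) := by
  have := enormR_add_le (a - b) b
  simp only [sub_add_cancel] at this
  linarith

lemma rdot_self (a : Fin d → ℝ) : rdot a a = enormR a ^ 2 := by
  rw [enormR, Real.sq_sqrt (Finset.sum_nonneg fun i _ => sq_nonneg _)]
  simp [rdot, sq]

lemma enormR_sq (a : Fin d → ℝ) : enormR a ^ 2 = ∑ i, a i ^ 2 := by
  rw [enormR, Real.sq_sqrt (Finset.sum_nonneg fun i _ => sq_nonneg _)]

lemma abs_apply_le_enormR (a : Fin d → ℝ) (i : Fin d) : |a i| ≤ enormR a := by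
  rw [enormR]
  apply Real.abs_le_sqrt
  exact Finset.single_le_sum (f := fun i => a i ^ 2) (fun j _ => sq_nonneg _) (Finset.mem_univ i)

lemma abs_apply_le_enormZ (a : Fin d → ℤ) (i : Fin d) : |(a i : ℝ)| ≤ enormZ a :=
  abs_apply_le_enormR (toR a) i

lemma enormR_eq_zero {a : Fin d → ℝ} : enormR a = 0 ↔ a = 0 := by
  rw [enormR_eq_norm, norm_eq_zero]; simp

lemma enormR_pos {a : Fin d → ℝ} (ha : a ≠ 0) : 0 < enormR a :=
  lt_of_le_of_ne (enormR_nonneg a) (fun h => ha (enormR_eq_zero.1 h.symm))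

@[fun_prop]
lemma continuous_enormR : Continuous (enormR : (Fin d → ℝ) → ℝ) := by
  unfold enormR; fun_prop

lemma enormZ_zero : enormZ (0 : Fin d → ℤ) = 0 := by simp [enormZ]

lemma one_le_enormZ {y : Fin d → ℤ} (hy : y ≠ 0) : 1 ≤ enormZ y := by
  obtain ⟨i, hi⟩ := Function.ne_iff.1 hy
  refine le_trans ?_ (abs_apply_le_enormZ y i)
  have : (1 : ℤ) ≤ |y i| := Int.one_le_abs hi
  exact_mod_cast this

lemma enormZ_rpow_le_rpow (y : Fin d → ℤ) {a b : ℝ} (ha : 0 < a) (hab : a ≤ b) :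
    enormZ y ^ a ≤ enormZ y ^ b := by
  by_cases hy : y = 0
  · subst hy
    rw [enormZ_zero, Real.zero_rpow ha.ne', Real.zero_rpow (by linarith)]
  · exact Real.rpow_le_rpow_of_exponent_le (one_le_enormZ hy) hab

lemma finite_enormZ_le (L : ℝ) : {y : Fin d → ℤ | enormZ y ≤ L}.Finite := by
  refine (Set.finite_Icc (fun _ : Fin d => -⌈L⌉) (fun _ => ⌈L⌉)).subset ?_
  intro y hy
  have : ∀ i, |y i| ≤ ⌈L⌉ := fun i => by
    have h1 : |(y i : ℝ)| ≤ (⌈L⌉ : ℝ) := ((abs_apply_le_enormZ y i).trans hy).trans (Int.le_ceil L)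
    exact_mod_cast h1
  exact ⟨fun i => (abs_le.1 (this i)).1, fun i => (abs_le.1 (this i)).2⟩

lemma toR_sub (x y : Fin d → ℤ) : toR (x - y) = toR x - toR y := by
  ext i; simp [toR]

lemma le_enormZ_sub (x y : Fin d → ℤ) : enormZ x - enormZ y ≤ enormZ (x - y) := by
  simp only [enormZ_eq, toR_sub]; exact le_enormR_sub _ _

lemma rdotZ_sub (μ : Fin d → ℝ) (x y : Fin d → ℤ) : rdotZ μ (x - y) = rdotZ μ x - rdotZ μ y := by
  simp [rdotZ, mul_sub, Finset.sum_sub_distrib]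

lemma rdotZ_add_left (a b : Fin d → ℝ) (y : Fin d → ℤ) : rdotZ (a + b) y = rdotZ a y + rdotZ b y := by
  simp [rdotZ, add_mul, Finset.sum_add_distrib]

lemma rdotZ_sub_left (a b : Fin d → ℝ) (y : Fin d → ℤ) : rdotZ (a - b) y = rdotZ a y - rdotZ b y := by
  simp [rdotZ, sub_mul, Finset.sum_sub_distrib]

lemma rdotZ_smul_left (c : ℝ) (a : Fin d → ℝ) (y : Fin d → ℤ) : rdotZ (c • a) y = c * rdotZ a y := by
  simp [rdotZ, Finset.mul_sum, mul_assoc]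

lemma rdotZ_zero_left (y : Fin d → ℤ) : rdotZ 0 y = 0 := by simp [rdotZ]

lemma rdotZ_zero_right (a : Fin d → ℝ) : rdotZ a (0 : Fin d → ℤ) = 0 := by simp [rdotZ]

lemma rdot_sub_right (a x y : Fin d → ℝ) : rdot a (x - y) = rdot a x - rdot a y := by
  simp [rdot, mul_sub, Finset.sum_sub_distrib]

lemma rdot_sub_left (a b x : Fin d → ℝ) : rdot (a - b) x = rdot a x - rdot b x := by
  simp [rdot, sub_mul, Finset.sum_sub_distrib]

lemma rdot_add_left (a b x : Fin d → ℝ) : rdot (a + b) x = rdot a x + rdot b x := by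
  simp [rdot, add_mul, Finset.sum_add_distrib]

lemma rdot_smul_left (c : ℝ) (a x : Fin d → ℝ) : rdot (c • a) x = c * rdot a x := by
  simp [rdot, Finset.mul_sum, mul_assoc]

lemma rdot_smul_right (c : ℝ) (a x : Fin d → ℝ) : rdot a (c • x) = c * rdot a x := by
  simp only [rdot, Finset.mul_sum, Pi.smul_apply, smul_eq_mul]
  exact Finset.sum_congr rfl fun i _ => by ring

lemma rdot_comm (a x : Fin d → ℝ) : rdot a x = rdot x a := by
  simp [rdot, mul_comm]

@[fun_prop]
lemma continuous_rdotZ (y : Fin d → ℤ) : Continuous fun k : Fin d → ℝ => rdotZ k y := by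
  unfold rdotZ; fun_prop

/-! ### The Fourier transform on the torus -/

lemma norm_fourier_factor (k : Fin d → ℝ) (y : Fin d → ℤ) :
    ‖Complex.exp (-Complex.I * (rdotZ k y : ℂ))‖ = 1 := by
  rw [show -Complex.I * (rdotZ k y : ℂ) = ((-rdotZ k y : ℝ) : ℂ) * Complex.I by push_cast; ring]
  exact Complex.norm_exp_ofReal_mul_I _

lemma norm_fourier_factor' (k : Fin d → ℝ) (y : Fin d → ℤ) :
    ‖Complex.exp (Complex.I * (rdotZ k y : ℂ))‖ = 1 := by
  rw [mul_comm]
  exact Complex.norm_exp_ofReal_mul_I _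

lemma fourier_factor_re (k : Fin d → ℝ) (y : Fin d → ℤ) :
    (Complex.exp (-Complex.I * (rdotZ k y : ℂ))).re = Real.cos (rdotZ k y) := by
  rw [show -Complex.I * (rdotZ k y : ℂ) = ((-rdotZ k y : ℝ) : ℂ) * Complex.I by push_cast; ring,
    Complex.exp_ofReal_mul_I_re, Real.cos_neg]

lemma norm_fourier_term (c : ℝ) (k : Fin d → ℝ) (y : Fin d → ℤ) :
    ‖(c : ℂ) * Complex.exp (-Complex.I * (rdotZ k y : ℂ))‖ = |c| := by
  rw [norm_mul, norm_fourier_factor, mul_one, Complex.norm_real, Real.norm_eq_abs]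

lemma summable_fourier {f : (Fin d → ℤ) → ℝ} (hf : Summable fun y => |f y|) (k : Fin d → ℝ) :
    Summable fun y => (f y : ℂ) * Complex.exp (-Complex.I * (rdotZ k y : ℂ)) := by
  refine Summable.of_norm ?_
  simpa only [norm_fourier_term] using hf

lemma norm_fourierZ_le {f : (Fin d → ℤ) → ℝ} (hf : Summable fun y => |f y|) (k : Fin d → ℝ) :
    ‖fourierZ f k‖ ≤ ∑' y, |f y| := by
  refine (norm_tsum_le_tsum_norm (summable_fourier hf k).norm).trans (le_of_eq ?_)
  simp only [norm_fourier_term]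

lemma continuous_fourierZ {f : (Fin d → ℤ) → ℝ} (hf : Summable fun y => |f y|) :
    Continuous (fourierZ f) := by
  unfold fourierZ
  refine continuous_tsum (fun y => ?_) hf (fun y k => ?_)
  · fun_prop
  · exact (norm_fourier_term _ _ _).le

lemma fourierZ_zero {f : (Fin d → ℤ) → ℝ} : fourierZ f 0 = ((∑' y, f y : ℝ) : ℂ) := by
  simp [fourierZ, rdotZ_zero_left, Complex.ofReal_tsum]

lemma fourierZ_re {f : (Fin d → ℤ) → ℝ} (hf : Summable fun y => |f y|) (k : Fin d → ℝ) :
    (fourierZ f k).re = ∑' y, f y * Real.cos (rdotZ k y) := by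
  rw [fourierZ, Complex.re_tsum (summable_fourier hf k)]
  simp only [Complex.re_ofReal_mul, fourier_factor_re]

lemma isCompact_torus : IsCompact (torus d) := isCompact_univ_pi fun _ => isCompact_Icc

lemma measurableSet_torus : MeasurableSet (torus d) := isCompact_torus.measurableSet

lemma measureReal_torus : (volume : Measure (Fin d → ℝ)).real (torus d) = (2 * π) ^ d := by
  rw [Measure.real, torus, volume_pi_pi]
  simp only [Real.volume_Icc, Finset.prod_const, Finset.card_univ, Fintype.card_fin]
  rw [ENNReal.toReal_pow, ENNReal.toReal_ofReal (by linarith [Real.pi_pos])]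
  ring

lemma integrableOn_torus {F : (Fin d → ℝ) → ℂ} (hF : Continuous F) :
    IntegrableOn F (torus d) := hF.continuousOn.integrableOn_compact isCompact_torus

lemma integral_torus_exp (z : Fin d → ℤ) :
    ∫ k in torus d, Complex.exp (Complex.I * (rdotZ k z : ℂ)) = if z = 0 then ((2 * π) ^ d : ℂ) else 0 := by
  have h1 : ∀ n : ℤ, ∫ t in Set.Icc (-π) π, Complex.exp (Complex.I * (t * n)) =
      if n = 0 then (2 * π : ℂ) else 0 := by
    intro n
    rw [integral_Icc_eq_integral_Ioc, ← intervalIntegral.integral_of_le (by linarith [Real.pi_pos])]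
    split_ifs with hn
    · subst hn
      simp; ring
    · have hc : (Complex.I * n : ℂ) ≠ 0 := by simp [hn]
      have : ∀ t : ℝ, Complex.exp (Complex.I * (t * n)) = Complex.exp ((Complex.I * n) * t) := by
        intro t; ring_nf
      simp_rw [this]
      rw [integral_exp_mul_complex hc]
      rw [div_eq_zero_iff]; left
      rw [sub_eq_zero, Complex.exp_eq_exp_iff_exists_int]
      exact ⟨n, by push_cast; ring⟩
  have h2 : (volume : Measure (Fin d → ℝ)).restrict (torus d) =
      Measure.pi fun _ : Fin d => (volume : Measure ℝ).restrict (Set.Icc (-π) π) := by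
    rw [torus, ← Measure.restrict_pi_pi]; rfl
  rw [h2]
  have h3 : ∀ k : Fin d → ℝ, Complex.exp (Complex.I * (rdotZ k z : ℂ)) =
      ∏ i, Complex.exp (Complex.I * (k i * z i)) := by
    intro k
    rw [← Complex.exp_sum, rdotZ]
    push_cast
    rw [Finset.mul_sum]
  simp_rw [h3]
  rw [integral_fintype_prod_eq_prod (fun i (t : ℝ) => Complex.exp (Complex.I * (t * z i)))]
  simp_rw [h1]
  split_ifs with hz
  · subst hz; simp
  · obtain ⟨i, hi⟩ := Function.ne_iff.1 hz
    exact Finset.prod_eq_zero (Finset.mem_univ i) (by simpa using hi)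

lemma integral_fourierZ_mul {f : (Fin d → ℤ) → ℝ} (hf : Summable fun y => |f y|)
    {F : (Fin d → ℝ) → ℂ} (hF : ContinuousOn F (torus d)) :
    HasSum (fun y => (f y : ℂ) * ∫ k in torus d, Complex.exp (-Complex.I * (rdotZ k y : ℂ)) * F k)
      (∫ k in torus d, fourierZ f k * F k) := by
  obtain ⟨C, hC⟩ := isCompact_torus.exists_bound_of_continuousOn hF
  have key := hasSum_integral_of_summable_integral_norm
    (μ := (volume : Measure (Fin d → ℝ)).restrict (torus d))
    (F := fun (y : Fin d → ℤ) (k : Fin d → ℝ) =>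
      (f y : ℂ) * (Complex.exp (-Complex.I * (rdotZ k y : ℂ)) * F k)) ?_ ?_
  · simp only [integral_const_mul] at key
    have e : (fun k => fourierZ f k * F k) = fun k => ∑' y, (f y : ℂ) *
        (Complex.exp (-Complex.I * (rdotZ k y : ℂ)) * F k) := by
      ext k
      simp only [fourierZ]
      rw [← tsum_mul_right]
      simp only [mul_assoc]
    rw [e]
    exact key
  · intro y
    refine ContinuousOn.integrableOn_compact isCompact_torus ?_
    exact continuousOn_const.mul ((Continuous.continuousOn (by fun_prop)).mul hF)
  · refine Summable.of_nonneg_of_le (fun y => integral_nonneg fun k => norm_nonneg _) (fun y => ?_)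
      (hf.mul_right (C * (volume : Measure (Fin d → ℝ)).real (torus d)))
    have : ∀ k : Fin d → ℝ, ‖(f y : ℂ) * (Complex.exp (-Complex.I * (rdotZ k y : ℂ)) * F k)‖ =
        |f y| * ‖F k‖ := by
      intro k; rw [norm_mul, norm_mul, norm_fourier_factor, one_mul, Complex.norm_real]; rfl
    simp_rw [this]
    rw [integral_const_mul]
    refine mul_le_mul_of_nonneg_left ?_ (abs_nonneg _)
    have h4 := norm_setIntegral_le_of_norm_le_const (μ := (volume : Measure (Fin d → ℝ)))
      (f := fun k => ‖F k‖) (C := C) isCompact_torus.measure_lt_top (fun k hk => by simpa using hC k hk)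
    exact (le_abs_self _).trans h4

lemma continuous_exp_rdotZ (z : Fin d → ℤ) :
    Continuous fun k : Fin d → ℝ => Complex.exp (Complex.I * (rdotZ k z : ℂ)) := by fun_prop

lemma exp_rdotZ_sub (k : Fin d → ℝ) (x y : Fin d → ℤ) :
    Complex.exp (-Complex.I * (rdotZ k y : ℂ)) * Complex.exp (Complex.I * (rdotZ k x : ℂ)) =
      Complex.exp (Complex.I * (rdotZ k (x - y) : ℂ)) := by
  rw [← Complex.exp_add, rdotZ_sub]; push_cast; ring_nf

lemma fourier_inversion {f : (Fin d → ℤ) → ℝ} (hf : Summable fun y => |f y|) (x : Fin d → ℤ) :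
    ∫ k in torus d, fourierZ f k * Complex.exp (Complex.I * (rdotZ k x : ℂ)) =
      (2 * π) ^ d * (f x : ℂ) := by
  rw [← (integral_fourierZ_mul hf (continuous_exp_rdotZ x).continuousOn).tsum_eq]
  simp_rw [exp_rdotZ_sub, integral_torus_exp]
  rw [tsum_eq_single x]
  · simp [mul_comm]
  · intro y hy
    rw [if_neg (by rw [sub_eq_zero]; exact fun h => hy h.symm), mul_zero]

lemma parseval {f : (Fin d → ℤ) → ℝ} (hf : Summable fun y => |f y|) :
    ∫ k in torus d, ‖fourierZ f k‖ ^ 2 = (2 * π) ^ d * ∑' y, f y ^ 2 := by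
  have hc := continuous_fourierZ hf
  have h1 := integral_fourierZ_mul hf (F := fun k => (starRingEnd ℂ) (fourierZ f k))
    (Continuous.continuousOn (by fun_prop))
  have h2 : ∀ y, ∫ k in torus d, Complex.exp (-Complex.I * (rdotZ k y : ℂ)) *
      (starRingEnd ℂ) (fourierZ f k) = (2 * π) ^ d * (f y : ℂ) := by
    intro y
    have h3 := congrArg (starRingEnd ℂ) (fourier_inversion hf y)
    rw [← integral_conj] at h3
    rw [show (starRingEnd ℂ) ((2 * π) ^ d * (f y : ℂ)) = (2 * π) ^ d * (f y : ℂ) by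
      rw [show ((2 * π) ^ d * (f y : ℂ) : ℂ) = (((2 * π) ^ d * f y : ℝ) : ℂ) by push_cast; ring,
        Complex.conj_ofReal]] at h3
    rw [← h3]
    refine integral_congr_ae (Eventually.of_forall fun k => ?_)
    simp only [map_mul, ← Complex.exp_conj, Complex.conj_I, Complex.conj_ofReal]
    ring
  simp_rw [h2] at h1
  have h4 : ∀ k, fourierZ f k * (starRingEnd ℂ) (fourierZ f k) = ((‖fourierZ f k‖ ^ 2 : ℝ) : ℂ) := by
    intro k; rw [Complex.mul_conj, Complex.normSq_eq_norm_sq]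
  simp_rw [h4] at h1
  rw [integral_complex_ofReal] at h1
  have h5 : (((2 * π) ^ d * ∑' y, f y ^ 2 : ℝ) : ℂ) =
      ∑' y, (f y : ℂ) * ((2 * π) ^ d * (f y : ℂ)) := by
    rw [← tsum_mul_left, Complex.ofReal_tsum]
    congr 1; ext y; push_cast; ring
  rw [h1.tsum_eq] at h5
  exact_mod_cast h5.symm

/-! ### Exponential tilts of the heat kernel -/

/-- Fourier coefficient of the `n`-th power of `f̂`, without the factor `(2π)^{-d}`. -/
def powCoeff (f : (Fin d → ℤ) → ℝ) (n : ℕ) (z : Fin d → ℤ) : ℂ :=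
  ∫ k in torus d, fourierZ f k ^ n * Complex.exp (Complex.I * (rdotZ k z : ℂ))

/-- The heat kernel `e^{-t(1 - f)}`, without the factor `(2π)^{-d}`. -/
def heat (f : (Fin d → ℤ) → ℝ) (t : ℝ) (z : Fin d → ℤ) : ℂ :=
  ∫ k in torus d, Complex.exp (-(t : ℂ) * (1 - fourierZ f k)) * Complex.exp (Complex.I * (rdotZ k z : ℂ))

lemma powCoeff_succ {f : (Fin d → ℤ) → ℝ} (hf : Summable fun y => |f y|) (n : ℕ) (z : Fin d → ℤ) :
    powCoeff f (n + 1) z = ∑' y, (f y : ℂ) * powCoeff f n (z - y) := by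
  have hc := continuous_fourierZ hf
  have h := integral_fourierZ_mul hf
    (F := fun k => fourierZ f k ^ n * Complex.exp (Complex.I * (rdotZ k z : ℂ)))
    (Continuous.continuousOn (by fun_prop))
  have e : ∀ y, (f y : ℂ) * powCoeff f n (z - y) = (f y : ℂ) * ∫ k in torus d,
      Complex.exp (-Complex.I * (rdotZ k y : ℂ)) *
        (fourierZ f k ^ n * Complex.exp (Complex.I * (rdotZ k z : ℂ))) := by
    intro y
    unfold powCoeff
    simp_rw [← exp_rdotZ_sub]
    congr 2; ext k; ring
  simp_rw [e]
  rw [h.tsum_eq, powCoeff]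
  congr 1; ext k; ring

lemma powCoeff_tilt {f : (Fin d → ℤ) → ℝ} {ν : Fin d → ℝ} (hf : Summable fun y => |f y|)
    (hν : Summable fun y => |tilt f ν y|) (n : ℕ) (z : Fin d → ℤ) :
    powCoeff (tilt f ν) n z = (Real.exp (rdotZ ν z) : ℂ) * powCoeff f n z := by
  induction n generalizing z with
  | zero =>
    simp only [powCoeff, pow_zero, one_mul, integral_torus_exp]
    split_ifs with hz
    · subst hz; simp [rdotZ_zero_right]
    · simp
  | succ n ih =>
    rw [powCoeff_succ hf, powCoeff_succ hν, ← tsum_mul_left]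
    congr 1; ext y
    rw [ih, tilt, rdotZ_sub, Real.exp_sub]
    have : (Real.exp (rdotZ ν y) : ℂ) ≠ 0 := by exact_mod_cast (Real.exp_pos _).ne'
    push_cast at this ⊢
    field_simp

lemma heat_hasSum {f : (Fin d → ℤ) → ℝ} (hf : Summable fun y => |f y|) (t : ℝ) (z : Fin d → ℤ) :
    HasSum (fun n : ℕ => Complex.exp (-t) * ((t : ℂ) ^ n / n.factorial * powCoeff f n z))
      (heat f t z) := by
  have hc := continuous_fourierZ hf
  set A := ∑' y, |f y|
  have key := hasSum_integral_of_summable_integral_norm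
    (μ := (volume : Measure (Fin d → ℝ)).restrict (torus d))
    (F := fun (n : ℕ) (k : Fin d → ℝ) => Complex.exp (-t) * ((t : ℂ) ^ n / n.factorial *
      (fourierZ f k ^ n * Complex.exp (Complex.I * (rdotZ k z : ℂ))))) ?_ ?_
  · simp only [integral_const_mul] at key
    have e : (fun k => Complex.exp (-(t : ℂ) * (1 - fourierZ f k)) *
        Complex.exp (Complex.I * (rdotZ k z : ℂ))) = fun k => ∑' n : ℕ,
        Complex.exp (-t) * ((t : ℂ) ^ n / n.factorial *
          (fourierZ f k ^ n * Complex.exp (Complex.I * (rdotZ k z : ℂ)))) := by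
      ext k
      have h1 := (NormedSpace.expSeries_div_hasSum_exp ((t : ℂ) * fourierZ f k))
      rw [← Complex.exp_eq_exp_ℂ] at h1
      have h2 := (h1.mul_right (Complex.exp (Complex.I * (rdotZ k z : ℂ)))).mul_left (Complex.exp (-t))
      rw [show -(t : ℂ) * (1 - fourierZ f k) = -t + t * fourierZ f k by ring, Complex.exp_add, mul_assoc,
        ← h2.tsum_eq]
      congr 1; ext n
      rw [mul_pow]; ring
    unfold heat
    rw [e]
    exact key
  · intro n
    exact integrableOn_torus (by fun_prop)
  · have hs : Summable fun n : ℕ => (|t| * A) ^ n / n.factorial := Real.summable_pow_div_factorial _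
    refine Summable.of_nonneg_of_le (fun y => integral_nonneg fun k => norm_nonneg _) (fun n => ?_)
      (hs.mul_left (‖Complex.exp (-(t : ℂ))‖ * (volume : Measure (Fin d → ℝ)).real (torus d)))
    have h4 := norm_setIntegral_le_of_norm_le_const (μ := (volume : Measure (Fin d → ℝ)))
      (f := fun k => ‖Complex.exp (-t) * ((t : ℂ) ^ n / n.factorial *
      (fourierZ f k ^ n * Complex.exp (Complex.I * (rdotZ k z : ℂ))))‖)
      (C := ‖Complex.exp (-(t : ℂ))‖ * ((|t| * A) ^ n / n.factorial)) (s := torus d)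
      isCompact_torus.measure_lt_top (fun k hk => ?_)
    · refine (le_abs_self _).trans (h4.trans (le_of_eq (by ring)))
    · rw [norm_norm, norm_mul, norm_mul, norm_mul, norm_fourier_factor', mul_one, norm_pow, norm_div,
        norm_pow, Complex.norm_real, Complex.norm_natCast, mul_pow, Real.norm_eq_abs]
      have := norm_fourierZ_le hf k
      rw [div_mul_eq_mul_div]
      gcongr

lemma heat_tilt {f : (Fin d → ℤ) → ℝ} {ν : Fin d → ℝ} (hf : Summable fun y => |f y|)
    (hν : Summable fun y => |tilt f ν y|) (t : ℝ) (z : Fin d → ℤ) :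
    heat (tilt f ν) t z = (Real.exp (rdotZ ν z) : ℂ) * heat f t z := by
  rw [← (heat_hasSum hf t z).tsum_eq, ← (heat_hasSum hν t z).tsum_eq, ← tsum_mul_left]
  congr 1; ext n
  rw [powCoeff_tilt hf hν]; ring

/-! ### The Green function -/

lemma tsum_conv_mul {f g : (Fin d → ℤ) → ℝ} {e : (Fin d → ℤ) → ℂ} (he : ∀ x y, e (x + y) = e x * e y)
    (hf : Summable fun y => ‖(f y : ℂ) * e y‖) (hg : Summable fun y => ‖(g y : ℂ) * e y‖) :
    ∑' x, (conv f g x : ℂ) * e x = (∑' y, (f y : ℂ) * e y) * ∑' y, (g y : ℂ) * e y := by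
  have hF : Summable fun p : (Fin d → ℤ) × (Fin d → ℤ) =>
      ((f p.1 : ℂ) * e p.1) * ((g p.2 : ℂ) * e p.2) :=
    summable_mul_of_summable_norm (f := fun y => (f y : ℂ) * e y) (g := fun y => (g y : ℂ) * e y) hf hg
  let φ : (Fin d → ℤ) × (Fin d → ℤ) ≃ (Fin d → ℤ) × (Fin d → ℤ) :=
    { toFun := fun p => (p.1 - p.2, p.2)
      invFun := fun p => (p.1 + p.2, p.2)
      left_inv := fun p => by simp
      right_inv := fun p => by simp }
  have hF' : Summable fun p : (Fin d → ℤ) × (Fin d → ℤ) =>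
      ((f (p.1 - p.2) : ℂ) * e (p.1 - p.2)) * ((g p.2 : ℂ) * e p.2) :=
    (φ.summable_iff (f := fun p : (Fin d → ℤ) × (Fin d → ℤ) =>
      ((f p.1 : ℂ) * e p.1) * ((g p.2 : ℂ) * e p.2))).2 hF
  have h2 : ∑' p : (Fin d → ℤ) × (Fin d → ℤ),
      ((f (p.1 - p.2) : ℂ) * e (p.1 - p.2)) * ((g p.2 : ℂ) * e p.2) =
      ∑' p : (Fin d → ℤ) × (Fin d → ℤ), ((f p.1 : ℂ) * e p.1) * ((g p.2 : ℂ) * e p.2) :=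
    φ.tsum_eq fun p : (Fin d → ℤ) × (Fin d → ℤ) => ((f p.1 : ℂ) * e p.1) * ((g p.2 : ℂ) * e p.2)
  rw [tsum_mul_tsum_of_summable_norm hf hg, ← h2, hF'.tsum_prod]
  refine tsum_congr fun x => ?_
  rw [conv, Complex.ofReal_tsum, ← tsum_mul_right]
  refine tsum_congr fun y => ?_
  have : e x = e (x - y) * e y := by rw [← he, sub_add_cancel]
  rw [this]; push_cast; ring

lemma continuous_heat {f : (Fin d → ℤ) → ℝ} (hf : Summable fun y => |f y|) (z : Fin d → ℤ) :
    Continuous fun t => heat f t z := by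
  have hc := continuous_fourierZ hf
  unfold heat
  exact continuous_parametric_integral_of_continuous (by fun_prop) isCompact_torus

lemma integral_heat {f : (Fin d → ℤ) → ℝ} (hf : Summable fun y => |f y|) {ε : ℝ} (hε : 0 < ε)
    (hre : ∀ k ∈ torus d, ε ≤ (1 - fourierZ f k).re) (z : Fin d → ℤ) :
    ∫ t in Set.Ioi (0 : ℝ), heat f t z =
      ∫ k in torus d, Complex.exp (Complex.I * (rdotZ k z : ℂ)) / (1 - fourierZ f k) := by
  have hc := continuous_fourierZ hf
  unfold heat
  rw [integral_integral_swap]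
  · refine setIntegral_congr_fun measurableSet_torus (fun k hk => ?_)
    have h1 : 0 < (1 - fourierZ f k).re := lt_of_lt_of_le hε (hre k hk)
    rw [integral_mul_const]
    have h2 := integral_exp_mul_complex_Ioi (a := -(1 - fourierZ f k)) (by simpa using h1) 0
    have h3 : ∀ t : ℝ, -(t : ℂ) * (1 - fourierZ f k) = -(1 - fourierZ f k) * t := fun t => by ring
    simp_rw [h3]
    rw [h2, neg_div_neg_eq]
    simp [div_eq_inv_mul]
  · have hI : Integrable (fun p : ℝ × (Fin d → ℝ) => Real.exp (-ε * p.1) * (1 : ℝ))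
        ((volume.restrict (Set.Ioi 0)).prod (volume.restrict (torus d))) := by
      refine Integrable.mul_prod (f := fun t : ℝ => Real.exp (-ε * t)) (g := fun _ => (1 : ℝ)) ?_ ?_
      · exact integrableOn_exp_mul_Ioi (by linarith) 0
      · exact continuousOn_const.integrableOn_compact isCompact_torus
    refine hI.mono' (Continuous.aestronglyMeasurable (by fun_prop)) ?_
    rw [Measure.prod_restrict]
    refine (ae_restrict_iff' (measurableSet_Ioi.prod measurableSet_torus)).2
      (Eventually.of_forall fun p hp => ?_)
    simp only [Function.uncurry]
    rw [norm_mul, norm_fourier_factor', mul_one, Complex.norm_exp, mul_one]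
    apply Real.exp_le_exp.2
    have h1 := hre p.2 hp.2
    have h2 : 0 < p.1 := hp.1
    rw [← Complex.ofReal_neg, Complex.re_ofReal_mul]
    nlinarith

lemma green_representation {S J h : (Fin d → ℤ) → ℝ} (hJ : Summable fun y => |J y|)
    (hh : Summable fun y => |h y|) (hS : Summable fun y => |S y|) (hOZ : ∀ x, S x = h x + conv J S x)
    {ε : ℝ} (hε : 0 < ε) (hre : ∀ k ∈ torus d, ε ≤ (1 - fourierZ J k).re) (x : Fin d → ℤ) :
    (2 * π) ^ d * (S x : ℂ) =
      ∑' y, (h y : ℂ) * ∫ t in Set.Ioi (0 : ℝ), heat J t (x - y) := by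
  have hc := continuous_fourierZ hJ
  have hne : ∀ k ∈ torus d, 1 - fourierZ J k ≠ 0 := by
    intro k hk h0
    have := hre k hk
    rw [h0] at this
    simp at this; linarith
  have hmul : ∀ k ∈ torus d, fourierZ S k = fourierZ h k / (1 - fourierZ J k) := by
    intro k hk
    rw [eq_div_iff (hne k hk)]
    have he : ∀ x y : Fin d → ℤ, Complex.exp (-Complex.I * (rdotZ k (x + y) : ℂ)) =
        Complex.exp (-Complex.I * (rdotZ k x : ℂ)) * Complex.exp (-Complex.I * (rdotZ k y : ℂ)) := by
      intro x y
      rw [← Complex.exp_add]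
      congr 1
      simp only [rdotZ, Pi.add_apply]
      push_cast
      simp only [mul_add, Finset.sum_add_distrib]
    have h1 := tsum_conv_mul (f := J) (g := S)
      (e := fun y => Complex.exp (-Complex.I * (rdotZ k y : ℂ))) he (by simpa only [norm_fourier_term] using hJ)
      (by simpa only [norm_fourier_term] using hS)
    have h2 : fourierZ S k = fourierZ h k + ∑' x, (conv J S x : ℂ) *
        Complex.exp (-Complex.I * (rdotZ k x : ℂ)) := by
      have h3 : ∀ x, (conv J S x : ℂ) * Complex.exp (-Complex.I * (rdotZ k x : ℂ)) =
          S x * Complex.exp (-Complex.I * (rdotZ k x : ℂ)) -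
            h x * Complex.exp (-Complex.I * (rdotZ k x : ℂ)) := by
        intro x; rw [hOZ x]; push_cast; ring
      simp_rw [h3]
      rw [(summable_fourier hS k).tsum_sub (summable_fourier hh k)]
      simp [fourierZ]
    rw [h1] at h2
    change fourierZ S k = fourierZ h k + fourierZ J k * fourierZ S k at h2
    linear_combination h2
  have h4 := integral_fourierZ_mul hh
    (F := fun k => Complex.exp (Complex.I * (rdotZ k x : ℂ)) / (1 - fourierZ J k))
    (ContinuousOn.div (Continuous.continuousOn (by fun_prop)) (Continuous.continuousOn (by fun_prop)) hne)
  have e : ∀ y, ∫ t in Set.Ioi (0 : ℝ), heat J t (x - y) =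
      ∫ k in torus d, Complex.exp (-Complex.I * (rdotZ k y : ℂ)) *
        (Complex.exp (Complex.I * (rdotZ k x : ℂ)) / (1 - fourierZ J k)) := by
    intro y
    rw [integral_heat hJ hε hre]
    simp_rw [← exp_rdotZ_sub, mul_div_assoc]
  simp_rw [e]
  rw [h4.tsum_eq, ← fourier_inversion hS]
  refine setIntegral_congr_fun measurableSet_torus (fun k hk => ?_)
  simp only [hmul k hk]
  ring

/-! ### Kernels -/

/-- A unit-mass kernel satisfying the moment, infrared and decay bounds with given constants. -/
structure Ker (M K ζ : ℝ) (f : (Fin d → ℤ) → ℝ) : Prop where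
  K_pos : 0 < K
  zeta_pos : 0 < ζ
  zeta_le : ζ ≤ 1
  summ : Summable fun y => |f y|
  l1 : ∑' y, |f y| ≤ M
  mom_summ : Summable fun y => enormZ y ^ (2 + ζ) * |f y|
  mom : ∑' y, enormZ y ^ (2 + ζ) * |f y| ≤ M
  one : ∑' y, f y = 1
  infra : ∀ k ∈ torus d, K * enormR k ^ 2 ≤ 1 - (fourierZ f k).re
  dec : 4 ≤ d → ∀ y, enormZ y ^ ((d : ℝ) - 1) * |f y| ≤ M

/-- The mean of a kernel. -/
def mean (f : (Fin d → ℤ) → ℝ) : Fin d → ℝ := fun j => ∑' y, (y j : ℝ) * f y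

/-- The second moment matrix of a kernel. -/
def cov (f : (Fin d → ℤ) → ℝ) : Matrix (Fin d) (Fin d) ℝ :=
  Matrix.of fun j l => ∑' y, (y j : ℝ) * (y l : ℝ) * f y

lemma enormZ_pow_le (y : Fin d → ℤ) {ζ : ℝ} (hζ : 0 < ζ) {m : ℕ} (hm : 1 ≤ m) (hm2 : m ≤ 2) :
    enormZ y ^ m ≤ enormZ y ^ (2 + ζ) := by
  have h := enormZ_rpow_le_rpow y (a := m) (b := 2 + ζ) (by exact_mod_cast hm)
    (by have : (m : ℝ) ≤ 2 := by exact_mod_cast hm2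
        linarith)
  rwa [Real.rpow_natCast] at h

namespace Ker

variable {M K ζ : ℝ} {f : (Fin d → ℤ) → ℝ}

lemma weight_summable (hf : Ker M K ζ f) {w : (Fin d → ℤ) → ℝ} {C : ℝ}
    (hw : ∀ y, |w y| ≤ C * enormZ y ^ (2 + ζ)) : Summable fun y => |w y * f y| := by
  refine Summable.of_nonneg_of_le (fun y => abs_nonneg _) (fun y => ?_) (hf.mom_summ.mul_left C)
  rw [abs_mul, ← mul_assoc]
  exact mul_le_mul_of_nonneg_right (hw y) (abs_nonneg _)

lemma weight_le (hf : Ker M K ζ f) {w : (Fin d → ℤ) → ℝ} {C : ℝ} (hC : 0 ≤ C)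
    (hw : ∀ y, |w y| ≤ C * enormZ y ^ (2 + ζ)) : ∑' y, |w y * f y| ≤ C * M := by
  calc ∑' y, |w y * f y| ≤ ∑' y, C * (enormZ y ^ (2 + ζ) * |f y|) := by
        refine (hf.weight_summable hw).tsum_le_tsum (fun y => ?_) (hf.mom_summ.mul_left C)
        rw [abs_mul, ← mul_assoc]
        exact mul_le_mul_of_nonneg_right (hw y) (abs_nonneg _)
    _ = C * ∑' y, enormZ y ^ (2 + ζ) * |f y| := tsum_mul_left
    _ ≤ C * M := mul_le_mul_of_nonneg_left hf.mom hC

lemma weight_abs_tsum_le (hf : Ker M K ζ f) {w : (Fin d → ℤ) → ℝ} {C : ℝ} (hC : 0 ≤ C)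
    (hw : ∀ y, |w y| ≤ C * enormZ y ^ (2 + ζ)) : |∑' y, w y * f y| ≤ C * M := by
  have h := norm_tsum_le_tsum_norm (f := fun y => w y * f y) (hf.weight_summable hw)
  exact le_trans h (hf.weight_le hC hw)

lemma one_le (hf : Ker M K ζ f) : 1 ≤ M := by
  have h := norm_tsum_le_tsum_norm (f := f) hf.summ
  rw [hf.one] at h
  simp only [norm_one, Real.norm_eq_abs] at h
  exact h.trans hf.l1

lemma M_pos (hf : Ker M K ζ f) : 0 < M := lt_of_lt_of_le one_pos hf.one_le

lemma rdotZ_weight (hf : Ker M K ζ f) (ν : Fin d → ℝ) (y : Fin d → ℤ) :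
    |rdotZ ν y| ≤ enormR ν * enormZ y ^ (2 + ζ) := by
  refine (abs_rdotZ_le ν y).trans (mul_le_mul_of_nonneg_left ?_ (enormR_nonneg _))
  simpa using enormZ_pow_le y hf.zeta_pos le_rfl one_le_two

lemma rdotZ_sq_weight (hf : Ker M K ζ f) (ν : Fin d → ℝ) (y : Fin d → ℤ) :
    |rdotZ ν y ^ 2| ≤ enormR ν ^ 2 * enormZ y ^ (2 + ζ) := by
  rw [abs_pow]
  calc |rdotZ ν y| ^ 2 ≤ (enormR ν * enormZ y) ^ 2 := by
        gcongr; exact abs_rdotZ_le ν y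
    _ = enormR ν ^ 2 * enormZ y ^ 2 := mul_pow _ _ _
    _ ≤ _ := mul_le_mul_of_nonneg_left (enormZ_pow_le y hf.zeta_pos one_le_two le_rfl) (by positivity)

lemma coord_weight (hf : Ker M K ζ f) (j : Fin d) (y : Fin d → ℤ) :
    |(y j : ℝ)| ≤ 1 * enormZ y ^ (2 + ζ) := by
  rw [one_mul]
  refine (abs_apply_le_enormZ y j).trans ?_
  simpa using enormZ_pow_le y hf.zeta_pos le_rfl one_le_two

lemma coord_mul_weight (hf : Ker M K ζ f) (j l : Fin d) (y : Fin d → ℤ) :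
    |(y j : ℝ) * (y l : ℝ)| ≤ 1 * enormZ y ^ (2 + ζ) := by
  rw [one_mul, abs_mul]
  refine le_trans ?_ (enormZ_pow_le y hf.zeta_pos one_le_two le_rfl)
  rw [sq]
  exact mul_le_mul (abs_apply_le_enormZ y j) (abs_apply_le_enormZ y l) (abs_nonneg _) (enormZ_nonneg _)

lemma rdot_mean (hf : Ker M K ζ f) (ν : Fin d → ℝ) : rdot ν (mean f) = ∑' y, rdotZ ν y * f y := by
  have h : ∀ j ∈ Finset.univ, Summable fun y : Fin d → ℤ => ν j * ((y j : ℝ) * f y) := fun j _ =>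
    (Summable.of_abs (hf.weight_summable (hf.coord_weight j))).mul_left _
  simp only [rdot, mean, ← tsum_mul_left]
  rw [← Summable.tsum_finsetSum h]
  refine tsum_congr fun y => ?_
  rw [rdotZ, Finset.sum_mul]
  exact Finset.sum_congr rfl fun j _ => by ring

lemma rdot_cov (hf : Ker M K ζ f) (ν : Fin d → ℝ) :
    rdot ν (cov f *ᵥ ν) = ∑' y, rdotZ ν y ^ 2 * f y := by
  have h : ∀ j l, Summable fun y : Fin d → ℤ => ν j * ν l * ((y j : ℝ) * (y l : ℝ) * f y) := fun j l =>
    (Summable.of_abs (hf.weight_summable (hf.coord_mul_weight j l))).mul_left _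
  have e : rdot ν (cov f *ᵥ ν) = ∑ j, ∑ l, ∑' y : Fin d → ℤ, ν j * ν l * ((y j : ℝ) * (y l : ℝ) * f y) := by
    simp only [rdot, Matrix.mulVec, dotProduct, cov, Matrix.of_apply, Finset.mul_sum, tsum_mul_left]
    exact Finset.sum_congr rfl fun j _ => Finset.sum_congr rfl fun l _ => by ring
  rw [e]
  have e2 : ∀ j ∈ Finset.univ, ∑ l, ∑' y : Fin d → ℤ, ν j * ν l * ((y j : ℝ) * (y l : ℝ) * f y) =
      ∑' y : Fin d → ℤ, ∑ l, ν j * ν l * ((y j : ℝ) * (y l : ℝ) * f y) := fun j _ =>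
    (Summable.tsum_finsetSum fun l _ => h j l).symm
  rw [Finset.sum_congr rfl e2, ← Summable.tsum_finsetSum fun j _ => summable_sum fun l _ => h j l]
  refine tsum_congr fun y => ?_
  rw [rdotZ, sq, Finset.sum_mul_sum, Finset.sum_mul]
  refine Finset.sum_congr rfl fun j _ => ?_
  rw [Finset.sum_mul]
  exact Finset.sum_congr rfl fun l _ => by ring

lemma enormR_mean_le (hf : Ker M K ζ f) : enormR (mean f) ≤ M := by
  have h1 : enormR (mean f) ^ 2 ≤ enormR (mean f) * M := by
    rw [← rdot_self, hf.rdot_mean]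
    exact (le_abs_self _).trans (hf.weight_abs_tsum_le (enormR_nonneg _) (hf.rdotZ_weight _))
  by_contra hlt
  push Not at hlt
  have := hf.M_pos
  nlinarith

lemma fourier_re_le (hf : Ker M K ζ f) {k : Fin d → ℝ} (hk : k ∈ torus d) :
    K * enormR k ^ 2 ≤ ∑' y, f y * (1 - Real.cos (rdotZ k y)) := by
  have h1 : Summable fun y => f y := hf.summ.of_abs
  have h2 : Summable fun y => f y * Real.cos (rdotZ k y) := by
    refine Summable.of_norm_bounded hf.summ fun y => ?_
    rw [norm_mul]
    exact mul_le_of_le_one_right (norm_nonneg _) (Real.abs_cos_le_one _)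
  simp only [mul_sub, mul_one]
  rw [h1.tsum_sub h2, hf.one, ← fourierZ_re hf.summ]
  exact hf.infra k hk

end Ker

/-! ### Gaussian integrals over the torus -/

/-- The Gaussian integral over the torus. -/
def gaussTorus (d : ℕ) (s : ℝ) : ℝ := ∫ k in torus d, Real.exp (-(s * enormR k ^ 2))

lemma continuous_gauss (s : ℝ) : Continuous fun k : Fin d → ℝ => Real.exp (-(s * enormR k ^ 2)) := by
  have := continuous_enormR (d := d)
  fun_prop

lemma gaussTorus_nonneg (s : ℝ) : 0 ≤ gaussTorus d s := integral_nonneg fun _ => (Real.exp_pos _).le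

lemma integrableOn_torus_real {F : (Fin d → ℝ) → ℝ} (hF : Continuous F) :
    IntegrableOn F (torus d) := hF.continuousOn.integrableOn_compact isCompact_torus

lemma gaussTorus_le_const {s : ℝ} (hs : 0 ≤ s) : gaussTorus d s ≤ (2 * π) ^ d := by
  rw [← measureReal_torus (d := d)]
  have h := setIntegral_mono_on (integrableOn_torus_real (continuous_gauss (d := d) s))
    (integrableOn_torus_real (continuous_const (y := (1 : ℝ)))) measurableSet_torus
    (fun k _ => Real.exp_le_one_iff.2 (neg_nonpos.2 (by positivity)))
  simpa [gaussTorus, Measure.real] using h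

lemma exp_neg_enormR_sq (s : ℝ) (k : Fin d → ℝ) :
    Real.exp (-(s * enormR k ^ 2)) = ∏ i, Real.exp (-s * k i ^ 2) := by
  rw [← Real.exp_sum, enormR_sq, Finset.mul_sum, ← Finset.sum_neg_distrib]
  congr 1
  exact Finset.sum_congr rfl fun i _ => by ring

lemma integrable_gauss {s : ℝ} (hs : 0 < s) :
    Integrable fun k : Fin d → ℝ => Real.exp (-(s * enormR k ^ 2)) := by
  simp only [exp_neg_enormR_sq]
  exact Integrable.fintype_prod (f := fun _ x => Real.exp (-s * x ^ 2))
    fun _ => integrable_exp_neg_mul_sq hs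

lemma integral_gauss (s : ℝ) :
    ∫ k : Fin d → ℝ, Real.exp (-(s * enormR k ^ 2)) = √(π / s) ^ d := by
  simp only [exp_neg_enormR_sq]
  rw [integral_fintype_prod_volume_eq_pow (fun x : ℝ => Real.exp (-s * x ^ 2)), integral_gaussian]
  simp

lemma gaussTorus_le {s : ℝ} (hs : 0 < s) : gaussTorus d s ≤ √(π / s) ^ d := by
  rw [← integral_gauss]
  exact setIntegral_le_integral (integrable_gauss hs) (Eventually.of_forall fun _ => (Real.exp_pos _).le)

/-! ### Truncation -/

/-- The restriction of a kernel to the ball of radius `L`. -/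
def lowPart (L : ℝ) (f : (Fin d → ℤ) → ℝ) : (Fin d → ℤ) → ℝ := fun y => if enormZ y ≤ L then f y else 0

/-- The restriction of a kernel to the complement of the ball of radius `L`. -/
def highPart (L : ℝ) (f : (Fin d → ℤ) → ℝ) : (Fin d → ℤ) → ℝ := fun y => if enormZ y ≤ L then 0 else f y

lemma norm_heat_le {f : (Fin d → ℤ) → ℝ} (hf : Summable fun y => |f y|) {t b c : ℝ} (ht : 0 ≤ t)
    (h : ∀ k ∈ torus d, -b + c * enormR k ^ 2 ≤ 1 - (fourierZ f k).re) (z : Fin d → ℤ) :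
    ‖heat f t z‖ ≤ Real.exp (t * b) * gaussTorus d (t * c) := by
  have hc := continuous_fourierZ hf
  unfold heat gaussTorus
  rw [← integral_const_mul]
  refine (norm_integral_le_integral_norm _).trans ?_
  refine setIntegral_mono_on (integrableOn_torus_real (by fun_prop))
    (integrableOn_torus_real ((continuous_gauss _).const_mul _)) measurableSet_torus fun k hk => ?_
  rw [norm_mul, norm_fourier_factor', mul_one, Complex.norm_exp, ← Real.exp_add]
  apply Real.exp_le_exp.2
  have h1 := mul_le_mul_of_nonneg_left (h k hk) ht
  rw [← Complex.ofReal_neg, Complex.re_ofReal_mul, Complex.sub_re, Complex.one_re]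
  nlinarith

namespace Ker

variable {M K ζ : ℝ} {f : (Fin d → ℤ) → ℝ}

lemma norm_heat_le_gauss (hf : Ker M K ζ f) {t : ℝ} (ht : 0 ≤ t) (z : Fin d → ℤ) :
    ‖heat f t z‖ ≤ gaussTorus d (t * K) := by
  simpa using norm_heat_le hf.summ ht (b := 0) (c := K) (by simpa using hf.infra) z

lemma summable_lowPart (hf : Ker M K ζ f) (L : ℝ) : Summable fun y => |lowPart L f y| := by
  refine Summable.of_nonneg_of_le (fun y => abs_nonneg _) (fun y => ?_) hf.summ
  unfold lowPart; split_ifs <;> simp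

lemma summable_highPart (hf : Ker M K ζ f) (L : ℝ) : Summable fun y => |highPart L f y| := by
  refine Summable.of_nonneg_of_le (fun y => abs_nonneg _) (fun y => ?_) hf.summ
  unfold highPart; split_ifs <;> simp

lemma summable_tilt_lowPart (hf : Ker M K ζ f) (L : ℝ) (ν : Fin d → ℝ) :
    Summable fun y => |tilt (lowPart L f) ν y| := by
  refine Summable.of_nonneg_of_le (fun y => abs_nonneg _) (fun y => ?_)
    (hf.summ.mul_left (Real.exp (enormR ν * L)))
  simp only [lowPart, tilt]; split_ifs with h
  · rw [abs_mul, Real.abs_exp, mul_comm]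
    refine mul_le_mul_of_nonneg_right (Real.exp_le_exp.2 ?_) (abs_nonneg _)
    exact (le_abs_self _).trans ((abs_rdotZ_le ν y).trans (mul_le_mul_of_nonneg_left h (enormR_nonneg _)))
  · simp only [zero_mul, abs_zero]; positivity

lemma fourierZ_split (hf : Ker M K ζ f) (L : ℝ) (k : Fin d → ℝ) :
    fourierZ f k = fourierZ (lowPart L f) k + fourierZ (highPart L f) k := by
  have h1 := summable_fourier (hf.summable_lowPart L) k
  have h2 := summable_fourier (hf.summable_highPart L) k
  unfold fourierZ
  rw [← h1.tsum_add h2]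
  refine tsum_congr fun y => ?_
  unfold lowPart highPart; split_ifs <;> simp

lemma tsum_highPart_le (hf : Ker M K ζ f) {L : ℝ} (hL : 0 < L) :
    ∑' y, |highPart L f y| ≤ M * L ^ (-(2 + ζ)) := by
  have h := hf.weight_le (w := fun y => if enormZ y ≤ L then 0 else 1) (C := L ^ (-(2 + ζ))) (by positivity)
    (fun y => by
      have := Real.rpow_nonneg (enormZ_nonneg y) (2 + ζ)
      split_ifs with h
      · rw [abs_zero]; positivity
      · push Not at h
        rw [abs_one, Real.rpow_neg hL.le, inv_mul_eq_div, one_le_div (by positivity)]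
        exact Real.rpow_le_rpow hL.le h.le (by linarith [hf.zeta_pos]))
  rw [mul_comm]
  convert h using 4 with y
  unfold highPart; split_ifs <;> simp

lemma norm_fourierZ_highPart_le (hf : Ker M K ζ f) {L : ℝ} (hL : 0 < L) (k : Fin d → ℝ) :
    ‖fourierZ (highPart L f) k‖ ≤ M * L ^ (-(2 + ζ)) :=
  (norm_fourierZ_le (hf.summable_highPart L) k).trans (hf.tsum_highPart_le hL)

lemma lowPart_tilt_lower (hf : Ker M K ζ f) {L : ℝ} (hL : 0 < L) (hL0 : 2 * M * L ^ (-ζ) ≤ K)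
    {ν : Fin d → ℝ} (hν : enormR ν * L ≤ 1) {k : Fin d → ℝ} (hk : k ∈ torus d) :
    -(rdot ν (mean f) + M * enormR ν ^ 2 + 2 * M * L ^ (-(2 + ζ))) + K / 2 * enormR k ^ 2 ≤
      1 - (fourierZ (tilt (lowPart L f) ν) k).re := by
  have hζ := hf.zeta_pos
  have hM := hf.M_pos
  let a : (Fin d → ℤ) → ℝ := fun y => (if enormZ y ≤ L then Real.exp (rdotZ ν y) else 0) - 1 - rdotZ ν y
  let b : (Fin d → ℤ) → ℝ := fun y =>
    ((if enormZ y ≤ L then Real.exp (rdotZ ν y) else 0) - 1) * (1 - Real.cos (rdotZ k y))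
  have hab : ∀ y, |rdotZ ν y| ≤ enormZ y / L := fun y => by
    refine (abs_rdotZ_le ν y).trans ?_
    rw [le_div_iff₀ hL]
    nlinarith [enormZ_nonneg y]
  have hbig : ∀ y : Fin d → ℤ, L < enormZ y →
      L ^ (-(2 + ζ)) * enormZ y ^ (2 + ζ) = (enormZ y / L) ^ (2 + ζ) := fun y hy => by
    rw [Real.div_rpow (enormZ_nonneg y) hL.le, Real.rpow_neg hL.le]; ring
  have ha : ∀ y, |a y| ≤ (enormR ν ^ 2 + 2 * L ^ (-(2 + ζ))) * enormZ y ^ (2 + ζ) := by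
    intro y
    have hE := Real.rpow_nonneg (enormZ_nonneg y) (2 + ζ)
    have hLp : 0 < L ^ (-(2 + ζ)) := by positivity
    simp only [a]
    split_ifs with h
    · have h1 : |rdotZ ν y| ≤ 1 := (hab y).trans ((div_le_one hL).2 h)
      have h2 := Real.abs_exp_sub_one_sub_id_le h1
      have h3 := hf.rdotZ_sq_weight ν y
      rw [abs_of_nonneg (sq_nonneg _)] at h3
      have : 0 ≤ 2 * L ^ (-(2 + ζ)) * enormZ y ^ (2 + ζ) := by positivity
      linarith
    · push Not at h
      have h1 : 1 ≤ enormZ y / L := (one_le_div hL).2 h.le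
      have h2 : enormZ y / L ≤ (enormZ y / L) ^ (2 + ζ) := by
        conv_lhs => rw [← Real.rpow_one (enormZ y / L)]
        exact Real.rpow_le_rpow_of_exponent_le h1 (by linarith)
      have h3 := hab y
      have h4 : |0 - 1 - rdotZ ν y| ≤ 1 + |rdotZ ν y| := by
        rw [show (0 : ℝ) - 1 - rdotZ ν y = -(1 + rdotZ ν y) by ring, abs_neg]
        exact (abs_add_le _ _).trans (by rw [abs_one])
      have : 0 ≤ enormR ν ^ 2 * enormZ y ^ (2 + ζ) := by positivity
      rw [add_mul, mul_assoc 2, hbig y h]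
      have h5 : 1 + |rdotZ ν y| ≤ 2 * (enormZ y / L) ^ (2 + ζ) := by linarith
      exact h4.trans (h5.trans (le_add_of_nonneg_left this))
  have hcos : ∀ y, |1 - Real.cos (rdotZ k y)| ≤ enormR k ^ 2 * enormZ y ^ 2 / 2 := fun y => by
    rw [abs_of_nonneg (by linarith [Real.cos_le_one (rdotZ k y)])]
    have h1 := Real.one_sub_sq_div_two_le_cos (x := rdotZ k y)
    have h2 : rdotZ k y ^ 2 ≤ (enormR k * enormZ y) ^ 2 := sq_le_sq.2 (by
      rw [abs_of_nonneg (mul_nonneg (enormR_nonneg k) (enormZ_nonneg y))]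
      exact abs_rdotZ_le k y)
    rw [mul_pow] at h2
    linarith
  have hprod : ∀ y : Fin d → ℤ, enormZ y ≠ 0 → L ^ (-ζ) * enormZ y ^ (2 + ζ) =
      (enormZ y / L) ^ ζ * enormZ y ^ 2 := fun y hy => by
    have : 0 < enormZ y := lt_of_le_of_ne (enormZ_nonneg y) (Ne.symm hy)
    rw [Real.div_rpow this.le hL.le, Real.rpow_neg hL.le, Real.rpow_add this, Real.rpow_two]; ring
  have hb : ∀ y, |b y| ≤ enormR k ^ 2 * L ^ (-ζ) * enormZ y ^ (2 + ζ) := by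
    intro y
    simp only [b]
    rw [abs_mul]
    rcases eq_or_ne (enormZ y) 0 with h0 | h0
    · have := hcos y
      rw [h0] at this ⊢
      have h5 : |1 - Real.cos (rdotZ k y)| = 0 := le_antisymm (by simpa using this) (abs_nonneg _)
      rw [h5, mul_zero]; positivity
    have hpos : 0 < enormZ y := lt_of_le_of_ne (enormZ_nonneg y) (Ne.symm h0)
    have hq : |(if enormZ y ≤ L then Real.exp (rdotZ ν y) else 0) - 1| ≤ 2 * (enormZ y / L) ^ ζ := by
      split_ifs with h
      · have h6 : enormZ y / L ≤ 1 := (div_le_one hL).2 h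
        have h1 : |rdotZ ν y| ≤ 1 := (hab y).trans h6
        have h2 : |Real.exp (rdotZ ν y) - 1| ≤ 2 * |rdotZ ν y| := Real.abs_exp_sub_one_le h1
        have h7 : enormZ y / L ≤ (enormZ y / L) ^ ζ := by
          conv_lhs => rw [← Real.rpow_one (enormZ y / L)]
          exact Real.rpow_le_rpow_of_exponent_ge (by positivity) h6 hf.zeta_le
        linarith [hab y]
      · push Not at h
        have h1 : 1 ≤ (enormZ y / L) ^ ζ := Real.one_le_rpow ((one_le_div hL).2 h.le) hζ.le
        rw [zero_sub, abs_neg, abs_one]; linarith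
    calc _ ≤ 2 * (enormZ y / L) ^ ζ * (enormR k ^ 2 * enormZ y ^ 2 / 2) :=
          mul_le_mul hq (hcos y) (abs_nonneg _) (by positivity)
      _ = enormR k ^ 2 * ((enormZ y / L) ^ ζ * enormZ y ^ 2) := by ring
      _ = _ := by rw [← hprod y h0]; ring
  have hcosw : ∀ y, |1 - Real.cos (rdotZ k y)| ≤ enormR k ^ 2 / 2 * enormZ y ^ (2 + ζ) := fun y =>
    (hcos y).trans (by
      have := mul_le_mul_of_nonneg_left (enormZ_pow_le y hζ one_le_two le_rfl) (sq_nonneg (enormR k))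
      linarith)
  have sa := hf.weight_abs_tsum_le (by positivity) ha
  have sb := hf.weight_abs_tsum_le (by positivity) hb
  have e : 1 - (fourierZ (tilt (lowPart L f) ν) k).re = -rdot ν (mean f) - ∑' y, a y * f y +
      ∑' y, (1 - Real.cos (rdotZ k y)) * f y + ∑' y, b y * f y := by
    rw [hf.rdot_mean]
    conv_lhs => rw [fourierZ_re (hf.summable_tilt_lowPart L ν), ← hf.one]
    have s1 := (hf.weight_summable (hf.rdotZ_weight ν)).of_abs
    have s2 := (hf.weight_summable ha).of_abs
    have s3 := (hf.weight_summable hcosw).of_abs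
    have s4 := (hf.weight_summable hb).of_abs
    have s5 : Summable fun y => tilt (lowPart L f) ν y * Real.cos (rdotZ k y) := by
      refine Summable.of_norm_bounded (hf.summable_tilt_lowPart L ν) fun y => ?_
      rw [norm_mul]
      exact mul_le_of_le_one_right (norm_nonneg _) (Real.abs_cos_le_one _)
    rw [← hf.summ.of_abs.tsum_sub s5, ← tsum_neg, ← s1.neg.tsum_sub s2, ← (s1.neg.sub s2).tsum_add s3,
      ← ((s1.neg.sub s2).add s3).tsum_add s4]
    refine tsum_congr fun y => ?_
    simp only [a, b, tilt, lowPart]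
    split_ifs <;> ring
  have hcosl := hf.fourier_re_le hk
  simp only [mul_comm (f _)] at hcosl
  rw [e]
  have h1 := (abs_le.1 sa).2
  have h2 := (abs_le.1 sb).1
  have h3 : enormR k ^ 2 * L ^ (-ζ) * M ≤ K / 2 * enormR k ^ 2 := by nlinarith [sq_nonneg (enormR k)]
  linarith

lemma norm_heat_le_truncated (hf : Ker M K ζ f) {L t : ℝ} (hL : 0 < L) (hL0 : 2 * M * L ^ (-ζ) ≤ K)
    (ht : 0 ≤ t) (htL : M * t * L ^ (-(2 + ζ)) ≤ 1) {ν : Fin d → ℝ} (hν : enormR ν * L ≤ 1)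
    (z : Fin d → ℤ) :
    ‖heat f t z‖ ≤ Real.exp 2 * (gaussTorus d (t * (K / 2)) *
        Real.exp (-rdot ν (toR z - t • mean f) + M * t * enormR ν ^ 2)) +
      Real.exp 2 * (2 * t * ∫ k in torus d,
        Real.exp (-(t * (K / 2) * enormR k ^ 2)) * ‖fourierZ (highPart L f) k‖) := by
  have hc := continuous_fourierZ hf.summ
  have hc1 := continuous_fourierZ (hf.summable_lowPart L)
  have hc2 := continuous_fourierZ (hf.summable_highPart L)
  have hν' := hf.summable_tilt_lowPart L ν
  have h1 : ‖heat (lowPart L f) t z‖ ≤ Real.exp 2 * (gaussTorus d (t * (K / 2)) *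
        Real.exp (-rdot ν (toR z - t • mean f) + M * t * enormR ν ^ 2)) := by
    have h2 := norm_heat_le hν' ht (fun k hk => hf.lowPart_tilt_lower hL hL0 hν hk) z
    rw [heat_tilt (hf.summable_lowPart L) hν', norm_mul, Complex.norm_real, Real.norm_eq_abs,
      Real.abs_exp] at h2
    have h3 : ‖heat (lowPart L f) t z‖ = Real.exp (-rdotZ ν z) *
        (Real.exp (rdotZ ν z) * ‖heat (lowPart L f) t z‖) := by
      rw [← mul_assoc, ← Real.exp_add]; simp
    rw [h3]
    refine (mul_le_mul_of_nonneg_left h2 (Real.exp_pos _).le).trans ?_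
    have hg := gaussTorus_nonneg (d := d) (t * (K / 2))
    rw [← mul_assoc, ← Real.exp_add, mul_comm (gaussTorus d _), ← mul_assoc, ← Real.exp_add]
    refine mul_le_mul_of_nonneg_right (Real.exp_le_exp.2 ?_) hg
    rw [rdot_sub_right, rdot_smul_right, ← rdotZ_eq]
    nlinarith
  have h2 : ‖heat f t z - heat (lowPart L f) t z‖ ≤ Real.exp 2 * (2 * t * ∫ k in torus d,
        Real.exp (-(t * (K / 2) * enormR k ^ 2)) * ‖fourierZ (highPart L f) k‖) := by
    unfold heat
    rw [← integral_sub (integrableOn_torus (by fun_prop)) (integrableOn_torus (by fun_prop)),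
      ← mul_assoc, ← integral_const_mul]
    refine (norm_integral_le_integral_norm _).trans ?_
    refine setIntegral_mono_on (integrableOn_torus_real (by fun_prop))
      (integrableOn_torus_real (((continuous_gauss _).mul hc2.norm).const_mul _))
      measurableSet_torus fun k hk => ?_
    have e : Complex.exp (-(t : ℂ) * (1 - fourierZ f k)) * Complex.exp (Complex.I * (rdotZ k z : ℂ)) -
        Complex.exp (-(t : ℂ) * (1 - fourierZ (lowPart L f) k)) * Complex.exp (Complex.I * (rdotZ k z : ℂ)) =
        Complex.exp (-(t : ℂ) * (1 - fourierZ (lowPart L f) k)) *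
          (Complex.exp ((t : ℂ) * fourierZ (highPart L f) k) - 1) *
          Complex.exp (Complex.I * (rdotZ k z : ℂ)) := by
      rw [hf.fourierZ_split L k, show -(t : ℂ) * (1 - (fourierZ (lowPart L f) k + fourierZ (highPart L f) k)) =
        -(t : ℂ) * (1 - fourierZ (lowPart L f) k) + t * fourierZ (highPart L f) k by ring, Complex.exp_add]
      ring
    have h5 := hf.norm_fourierZ_highPart_le hL k
    have h6 : ‖(t : ℂ) * fourierZ (highPart L f) k‖ ≤ 1 := by
      rw [norm_mul, Complex.norm_real, Real.norm_eq_abs, abs_of_nonneg ht]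
      refine (mul_le_mul_of_nonneg_left h5 ht).trans (le_of_eq_of_le (by ring) htL)
    have h7 := Complex.norm_exp_sub_one_le h6
    rw [norm_mul, Complex.norm_real, Real.norm_eq_abs, abs_of_nonneg ht] at h7
    have h8 := hf.lowPart_tilt_lower hL hL0 (ν := 0) (by simp [enormR]) hk
    have htz : tilt (lowPart L f) 0 = lowPart L f := by
      ext y; simp [tilt, rdotZ_zero_left]
    have hr0 : rdot 0 (mean f) = 0 := by simp [rdot]
    have hn0 : enormR (0 : Fin d → ℝ) = 0 := enormR_eq_zero.2 rfl
    rw [htz, hr0, hn0] at h8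
    have h9 : ‖Complex.exp (-(t : ℂ) * (1 - fourierZ (lowPart L f) k))‖ ≤
        Real.exp 2 * Real.exp (-(t * (K / 2) * enormR k ^ 2)) := by
      rw [Complex.norm_exp, ← Real.exp_add]
      apply Real.exp_le_exp.2
      rw [← Complex.ofReal_neg, Complex.re_ofReal_mul, Complex.sub_re, Complex.one_re]
      have := mul_le_mul_of_nonneg_left h8 ht
      nlinarith
    rw [e, norm_mul, norm_mul, norm_fourier_factor', mul_one]
    calc _ ≤ (Real.exp 2 * Real.exp (-(t * (K / 2) * enormR k ^ 2))) *
          (2 * (t * ‖fourierZ (highPart L f) k‖)) := mul_le_mul h9 h7 (norm_nonneg _) (by positivity)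
      _ = _ := by ring
  calc ‖heat f t z‖ = ‖heat (lowPart L f) t z + (heat f t z - heat (lowPart L f) t z)‖ := by congr 1; ring
    _ ≤ _ := (norm_add_le _ _).trans (add_le_add h1 h2)

end Ker

/-! ### Uniform heat kernel bounds -/

lemma gaussTorus_le_rpow {t c : ℝ} (ht : 0 < t) (hc : 0 < c) :
    gaussTorus d (t * c) ≤ √(π / c) ^ d * t ^ (-((d : ℝ) / 2)) := by
  refine (gaussTorus_le (by positivity)).trans (le_of_eq ?_)
  have h1 : √t ^ d = t ^ ((d : ℝ) / 2) := by
    rw [Real.sqrt_eq_rpow, ← Real.rpow_natCast, ← Real.rpow_mul ht.le]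
    congr 1; ring
  rw [mul_comm t c, ← div_div, Real.sqrt_div (by positivity), div_pow, h1, Real.rpow_neg ht.le]
  rfl

lemma cauchy_schwarz_torus {F G : (Fin d → ℝ) → ℝ} (hF : Continuous F) (hG : Continuous G)
    (hF0 : ∀ k, 0 ≤ F k) (hG0 : ∀ k, 0 ≤ G k) :
    ∫ k in torus d, F k * G k ≤ √(∫ k in torus d, F k ^ 2) * √(∫ k in torus d, G k ^ 2) := by
  have hmem : ∀ {H : (Fin d → ℝ) → ℝ}, Continuous H →
      MemLp H (ENNReal.ofReal 2) (volume.restrict (torus d)) := fun {H} hH => by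
    rw [show ENNReal.ofReal 2 = 2 by norm_num, memLp_two_iff_integrable_sq hH.aestronglyMeasurable]
    exact integrableOn_torus_real (by fun_prop)
  have h := integral_mul_le_Lp_mul_Lq_of_nonneg (μ := (volume : Measure (Fin d → ℝ)).restrict (torus d))
    Real.HolderConjugate.two_two (Eventually.of_forall hF0) (Eventually.of_forall hG0)
    (hmem hF) (hmem hG)
  simpa only [Real.rpow_two, ← Real.sqrt_eq_rpow] using h

namespace Ker

variable {M K ζ : ℝ} {f : (Fin d → ℤ) → ℝ}

lemma highPart_integral_le (hf : Ker M K ζ f) {L : ℝ} (hL : 0 < L) (s : ℝ) :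
    ∫ k in torus d, Real.exp (-(s * enormR k ^ 2)) * ‖fourierZ (highPart L f) k‖ ≤
      M * L ^ (-(2 + ζ)) * gaussTorus d s := by
  have hc2 := continuous_fourierZ (hf.summable_highPart L)
  rw [gaussTorus, ← integral_const_mul]
  refine setIntegral_mono_on (integrableOn_torus_real ((continuous_gauss _).mul hc2.norm))
    (integrableOn_torus_real ((continuous_gauss _).const_mul _)) measurableSet_torus fun k _ => ?_
  rw [mul_comm]
  exact mul_le_mul_of_nonneg_right (hf.norm_fourierZ_highPart_le hL k) (Real.exp_pos _).le

lemma tsum_highPart_sq_le (hf : Ker M K ζ f) (hd : 4 ≤ d) {L : ℝ} (hL : 0 < L) :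
    ∑' y, highPart L f y ^ 2 ≤ (M * L ^ (-(((d : ℝ) + 1 + ζ) / 2))) ^ 2 := by
  have hM := hf.M_pos
  have hd' : (4 : ℝ) ≤ d := by exact_mod_cast hd
  have hb : ∀ y, |highPart L f y| ≤ M * L ^ (-((d : ℝ) - 1)) := fun y => by
    unfold highPart
    split_ifs with h
    · rw [abs_zero]; positivity
    · push Not at h
      have h1 := hf.dec hd y
      have h2 : L ^ ((d : ℝ) - 1) ≤ enormZ y ^ ((d : ℝ) - 1) :=
        Real.rpow_le_rpow hL.le h.le (by linarith)
      rw [Real.rpow_neg hL.le, ← div_eq_mul_inv, le_div_iff₀ (by positivity)]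
      nlinarith [abs_nonneg (f y)]
  have hs := hf.summable_highPart L
  have hle : ∀ y, highPart L f y ^ 2 ≤ M * L ^ (-((d : ℝ) - 1)) * |highPart L f y| := fun y => by
    rw [← sq_abs, sq]
    exact mul_le_mul_of_nonneg_right (hb y) (abs_nonneg _)
  have hs2 : Summable fun y => highPart L f y ^ 2 :=
    Summable.of_nonneg_of_le (fun y => sq_nonneg _) hle (hs.mul_left _)
  calc _ ≤ ∑' y, M * L ^ (-((d : ℝ) - 1)) * |highPart L f y| := hs2.tsum_le_tsum hle (hs.mul_left _)
    _ = M * L ^ (-((d : ℝ) - 1)) * ∑' y, |highPart L f y| := tsum_mul_left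
    _ ≤ M * L ^ (-((d : ℝ) - 1)) * (M * L ^ (-(2 + ζ))) :=
        mul_le_mul_of_nonneg_left (hf.tsum_highPart_le hL) (by positivity)
    _ = _ := by
        rw [mul_pow, sq (L ^ _), ← Real.rpow_add hL]
        rw [show -(((d : ℝ) + 1 + ζ) / 2) + -(((d : ℝ) + 1 + ζ) / 2) = -((d : ℝ) - 1) + -(2 + ζ) by ring,
          Real.rpow_add hL]
        ring

lemma highPart_integral_le_sqrt (hf : Ker M K ζ f) (hd : 4 ≤ d) {L : ℝ} (hL : 0 < L) (s : ℝ) :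
    ∫ k in torus d, Real.exp (-(s * enormR k ^ 2)) * ‖fourierZ (highPart L f) k‖ ≤
      √(gaussTorus d (2 * s)) * (√((2 * π) ^ d) * (M * L ^ (-(((d : ℝ) + 1 + ζ) / 2)))) := by
  have hM := hf.M_pos
  have hc2 := continuous_fourierZ (hf.summable_highPart L)
  refine (cauchy_schwarz_torus (continuous_gauss s) hc2.norm (fun _ => (Real.exp_pos _).le)
    (fun _ => norm_nonneg _)).trans ?_
  have e : ∀ k : Fin d → ℝ, Real.exp (-(s * enormR k ^ 2)) ^ 2 = Real.exp (-(2 * s * enormR k ^ 2)) :=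
    fun k => by rw [sq, ← Real.exp_add]; congr 1; ring
  simp_rw [e]
  rw [parseval (hf.summable_highPart L), ← gaussTorus]
  refine mul_le_mul_of_nonneg_left ?_ (Real.sqrt_nonneg _)
  rw [Real.sqrt_mul (by positivity)]
  refine mul_le_mul_of_nonneg_left ?_ (Real.sqrt_nonneg _)
  exact Real.sqrt_le_iff.2 ⟨by positivity, hf.tsum_highPart_sq_le hd hL⟩

end Ker

lemma exists_heat_diffusive (d : ℕ) {M K ζ : ℝ} (hM : 0 < M) (hK : 0 < K) (hζ : 0 < ζ) :
    ∃ C t₁ : ℝ, 0 < C ∧ 1 ≤ t₁ ∧ ∀ f : (Fin d → ℤ) → ℝ, Ker M K ζ f → ∀ t, t₁ ≤ t → ∀ z,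
      ‖heat f t z‖ ≤ C * t ^ (-((d : ℝ) / 2)) *
        (1 + enormR (toR z - t • mean f) / √t) ^ (-(1 + ζ / 2)) := by
  have hlim : Tendsto (fun t : ℝ => √t ^ (-ζ)) atTop (𝓝 0) :=
    (tendsto_rpow_neg_atTop hζ).comp Real.tendsto_sqrt_atTop
  have hev := (hlim.eventually (gt_mem_nhds (show (0 : ℝ) < min (1 / M) (K / (2 * M)) by positivity)))
  obtain ⟨t₀, ht₀⟩ := eventually_atTop.1 hev
  refine ⟨4 * (√(π / K) ^ d + √(π / (K / 2)) ^ d * (Real.exp 2 * (6 * Real.exp M + 2 * M))), max t₀ 1,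
    by positivity, le_max_right _ _, fun f hf t ht z => ?_⟩
  have ht1 : 1 ≤ t := (le_max_right _ _).trans ht
  have htpos : 0 < t := by linarith
  have hsm := ht₀ t ((le_max_left _ _).trans ht)
  set r := √t with hr
  have hrpos : 0 < r := Real.sqrt_pos.2 htpos
  have hr1 : 1 ≤ r := Real.one_le_sqrt.2 ht1
  have hrt : r ^ 2 = t := Real.sq_sqrt htpos.le
  have hsm1 : M * r ^ (-ζ) ≤ 1 := by
    have := (hsm.le.trans (min_le_left _ _))
    rwa [le_div_iff₀ hM, mul_comm] at this
  have hsm2 : 2 * M * r ^ (-ζ) ≤ K := by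
    have := (hsm.le.trans (min_le_right _ _))
    rwa [le_div_iff₀ (by positivity), mul_comm] at this
  set D := enormR (toR z - t • mean f) with hD
  have hD0 : 0 ≤ D := enormR_nonneg _
  set T := t ^ (-((d : ℝ) / 2)) with hT
  have hTpos : 0 < T := by positivity
  have hζ1 := hf.zeta_le
  set A := Real.exp 2 * (6 * Real.exp M + 2 * M) with hA
  have hApos : 0 < A := by positivity
  have hpow2 : ∀ x : ℝ, 1 ≤ x → (2 * x) ^ (-(1 + ζ / 2)) ≥ 1 / 4 * x ^ (-(1 + ζ / 2)) := fun x hx => by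
    rw [Real.mul_rpow (by norm_num) (by linarith)]
    have h1 : (2 : ℝ) ^ (-2 : ℝ) ≤ 2 ^ (-(1 + ζ / 2)) :=
      Real.rpow_le_rpow_of_exponent_le (by norm_num) (by linarith)
    have h2 : (2 : ℝ) ^ (-2 : ℝ) = 1 / 4 := by
      rw [Real.rpow_neg (by norm_num), Real.rpow_two]; norm_num
    rw [h2] at h1
    exact mul_le_mul_of_nonneg_right h1 (Real.rpow_nonneg (by linarith) _)
  rcases le_or_gt D r with hDr | hDr
  · have h1 : 1 + D / r ≤ 2 * 1 := by
      have := (div_le_one hrpos).2 hDr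
      linarith
    have h2 : (2 * 1) ^ (-(1 + ζ / 2)) ≤ (1 + D / r) ^ (-(1 + ζ / 2)) :=
      Real.rpow_le_rpow_of_nonpos (by positivity) h1 (by linarith)
    have h3 := (hpow2 1 le_rfl).le.trans h2
    rw [Real.one_rpow, mul_one] at h3
    calc ‖heat f t z‖ ≤ √(π / K) ^ d * T :=
          (hf.norm_heat_le_gauss htpos.le z).trans (gaussTorus_le_rpow htpos hK)
      _ ≤ (√(π / K) ^ d + √(π / (K / 2)) ^ d * A) * T := by
          refine mul_le_mul_of_nonneg_right ?_ hTpos.le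
          exact le_add_of_nonneg_right (by positivity)
      _ = 4 * (√(π / K) ^ d + √(π / (K / 2)) ^ d * A) * T * (1 / 4) := by ring
      _ ≤ _ := mul_le_mul_of_nonneg_left h3 (by positivity)
  · have hDpos : 0 < D := hrpos.trans hDr
    set s := D / r with hs
    have hs1 : 1 ≤ s := (one_le_div hrpos).2 hDr.le
    have hspos : 0 < s := by linarith
    set w := √s with hw
    have hw1 : 1 ≤ w := Real.one_le_sqrt.2 hs1
    have hwpos : 0 < w := by linarith
    have hws : w ^ 2 = s := Real.sq_sqrt hspos.le
    set L := r * w with hL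
    have hLpos : 0 < L := by positivity
    have hrL : r ≤ L := le_mul_of_one_le_right hrpos.le hw1
    have hL0 : 2 * M * L ^ (-ζ) ≤ K := by
      refine le_trans ?_ hsm2
      exact mul_le_mul_of_nonneg_left (Real.rpow_le_rpow_of_nonpos hrpos hrL (by linarith)) (by positivity)
    have hwpow : w ^ (-(2 + ζ)) = s ^ (-(1 + ζ / 2)) := by
      rw [← hws, ← Real.rpow_natCast, ← Real.rpow_mul hwpos.le]
      congr 1; push_cast; ring
    have htLeq : t * L ^ (-(2 + ζ)) = r ^ (-ζ) * w ^ (-(2 + ζ)) := by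
      rw [hL, Real.mul_rpow hrpos.le hwpos.le, ← hrt, ← mul_assoc, ← Real.rpow_natCast,
        ← Real.rpow_add hrpos]
      congr 2; push_cast; ring
    have hw_le : w ^ (-(2 + ζ)) ≤ 1 := Real.rpow_le_one_of_one_le_of_nonpos hw1 (by linarith)
    have hr_le : r ^ (-ζ) ≤ 1 := Real.rpow_le_one_of_one_le_of_nonpos hr1 (by linarith)
    have hwp : 0 < w ^ (-(2 + ζ)) := by positivity
    have hrp : 0 < r ^ (-ζ) := by positivity
    have htL : M * t * L ^ (-(2 + ζ)) ≤ 1 := by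
      rw [mul_assoc, htLeq, ← mul_assoc]
      nlinarith
    have hν : enormR ((1 / (D * L)) • (toR z - t • mean f)) = 1 / L := by
      rw [enormR_smul, abs_of_pos (by positivity), ← hD]
      field_simp
    have key := hf.norm_heat_le_truncated hLpos hL0 htpos.le htL
      (ν := (1 / (D * L)) • (toR z - t • mean f)) (by rw [hν, one_div_mul_cancel hLpos.ne']) z
    rw [hν, rdot_smul_left, rdot_self, ← hD] at key
    have hDw : 1 / (D * L) * D ^ 2 = w := by
      have : D = w ^ 2 * r := by rw [hws, hs]; field_simp
      rw [hL]
      rw [this]; field_simp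
    have hMt : M * t * (1 / L) ^ 2 ≤ M := by
      have : t * (1 / L) ^ 2 = 1 / w ^ 2 := by rw [hL, ← hrt]; field_simp
      rw [mul_assoc, this]
      refine mul_le_of_le_one_right hM.le ?_
      rw [div_le_one (by positivity)]
      exact one_le_pow₀ hw1
    have hexp : Real.exp (-w + M * t * (1 / L) ^ 2) ≤ 6 * Real.exp M * w ^ (-(2 + ζ)) := by
      have h1 : Real.exp (-w + M * t * (1 / L) ^ 2) ≤ Real.exp M * Real.exp (-w) := by
        rw [← Real.exp_add]; exact Real.exp_le_exp.2 (by linarith)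
      have h2 : w ^ (3 : ℕ) / Nat.factorial 3 ≤ Real.exp w := Real.pow_div_factorial_le_exp w hwpos.le 3
      have h3 : w ^ (2 + ζ) ≤ w ^ (3 : ℕ) := by
        rw [← Real.rpow_natCast]
        exact Real.rpow_le_rpow_of_exponent_le hw1 (by push_cast; linarith)
      have h4 : Real.exp (-w) ≤ 6 * w ^ (-(2 + ζ)) := by
        rw [Real.exp_neg, Real.rpow_neg hwpos.le, ← div_eq_mul_inv, inv_eq_one_div,
          div_le_div_iff₀ (Real.exp_pos _) (by positivity)]
        simp only [Nat.factorial] at h2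
        norm_num at h2
        linarith
      calc _ ≤ Real.exp M * Real.exp (-w) := h1
        _ ≤ Real.exp M * (6 * w ^ (-(2 + ζ))) := mul_le_mul_of_nonneg_left h4 (Real.exp_pos _).le
        _ = _ := by ring
    have hG := gaussTorus_le_rpow (d := d) htpos (half_pos hK)
    have hG0 := gaussTorus_nonneg (d := d) (t * (K / 2))
    have hI := hf.highPart_integral_le hLpos (t * (K / 2))
    set G := gaussTorus d (t * (K / 2))
    have h5 : ‖heat f t z‖ ≤ G * A * w ^ (-(2 + ζ)) := by
      rw [hDw] at key
      refine key.trans ?_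
      have e1 := mul_le_mul_of_nonneg_left hexp hG0
      have e2 : 2 * t * ∫ k in torus d, Real.exp (-(t * (K / 2) * enormR k ^ 2)) *
          ‖fourierZ (highPart L f) k‖ ≤ G * (2 * M * w ^ (-(2 + ζ))) := by
        refine (mul_le_mul_of_nonneg_left hI (by positivity)).trans ?_
        have : 2 * t * (M * L ^ (-(2 + ζ)) * G) = G * (2 * M) * (t * L ^ (-(2 + ζ))) := by ring
        rw [this, htLeq, ← mul_assoc G (2 * M)]
        refine mul_le_mul_of_nonneg_left ?_ (by positivity)
        exact mul_le_of_le_one_left hwp.le hr_le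
      have e3 := mul_le_mul_of_nonneg_left e1 (Real.exp_pos 2).le
      have e4 := mul_le_mul_of_nonneg_left e2 (Real.exp_pos 2).le
      refine (add_le_add e3 e4).trans (le_of_eq ?_)
      rw [hA]; ring
    have h6 : 1 / 4 * w ^ (-(2 + ζ)) ≤ (1 + s) ^ (-(1 + ζ / 2)) := by
      rw [hwpow]
      refine (hpow2 s hs1).le.trans ?_
      exact Real.rpow_le_rpow_of_nonpos (by linarith) (by linarith) (by linarith)
    calc ‖heat f t z‖ ≤ G * A * w ^ (-(2 + ζ)) := h5
      _ ≤ √(π / (K / 2)) ^ d * T * A * w ^ (-(2 + ζ)) := by gcongr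
      _ ≤ (√(π / K) ^ d + √(π / (K / 2)) ^ d * A) * T * w ^ (-(2 + ζ)) := by
          refine mul_le_mul_of_nonneg_right ?_ hwp.le
          have : 0 ≤ √(π / K) ^ d * T := by positivity
          linarith
      _ = 4 * (√(π / K) ^ d + √(π / (K / 2)) ^ d * A) * T * (1 / 4 * w ^ (-(2 + ζ))) := by ring
      _ ≤ _ := mul_le_mul_of_nonneg_left h6 (by positivity)

lemma mul_gaussTorus_le (d : ℕ) {c : ℝ} (hc : 0 < c) (hd3 : d ≤ 3) : ∃ C : ℝ, 0 < C ∧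
    ∀ ρ t : ℝ, 1 ≤ ρ → 0 ≤ t → t ≤ ρ → t * gaussTorus d (t * c) ≤ C * ρ ^ ((3 - (d : ℝ)) / 2) := by
  have hd3' : (d : ℝ) ≤ 3 := by exact_mod_cast hd3
  refine ⟨(2 * π) ^ d + √(π / c) ^ d, by positivity, fun ρ t hρ ht htρ => ?_⟩
  have hp : 0 ≤ (3 - (d : ℝ)) / 2 := by linarith
  have h1 : 1 ≤ ρ ^ ((3 - (d : ℝ)) / 2) := Real.one_le_rpow hρ hp
  have hP : 0 ≤ √(π / c) ^ d := by positivity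
  have hQ : 0 ≤ (2 * π) ^ d := by positivity
  rcases le_or_gt t 1 with h | h
  · have h2 := gaussTorus_le_const (d := d) (s := t * c) (by positivity)
    have h3 := gaussTorus_nonneg (d := d) (t * c)
    nlinarith
  · have h2 := gaussTorus_le_rpow (d := d) (t := t) (by linarith) hc
    have h3 : t * t ^ (-((d : ℝ) / 2)) ≤ ρ ^ ((3 - (d : ℝ)) / 2) := by
      have ht0 : 0 < t := by linarith
      have e : t * t ^ (-((d : ℝ) / 2)) = t ^ (1 - (d : ℝ) / 2) := by
        rw [sub_eq_add_neg, Real.rpow_add ht0, Real.rpow_one]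
      rw [e]
      exact (Real.rpow_le_rpow_of_exponent_le h.le (by linarith)).trans (Real.rpow_le_rpow ht htρ hp)
    calc t * gaussTorus d (t * c) ≤ t * (√(π / c) ^ d * t ^ (-((d : ℝ) / 2))) :=
          mul_le_mul_of_nonneg_left h2 ht
      _ = √(π / c) ^ d * (t * t ^ (-((d : ℝ) / 2))) := by ring
      _ ≤ √(π / c) ^ d * ρ ^ ((3 - (d : ℝ)) / 2) := mul_le_mul_of_nonneg_left h3 hP
      _ ≤ _ := mul_le_mul_of_nonneg_right (le_add_of_nonneg_left hQ) (by positivity)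

lemma mul_sqrt_gaussTorus_le (d : ℕ) {c : ℝ} (hc : 0 < c) (hd4 : 4 ≤ d) : ∃ C : ℝ, 0 < C ∧
    ∀ t : ℝ, 0 ≤ t → t * √(gaussTorus d (t * c)) ≤ C := by
  have hd4' : (4 : ℝ) ≤ d := by exact_mod_cast hd4
  refine ⟨√((2 * π) ^ d) + √(√(π / c) ^ d), by positivity, fun t ht => ?_⟩
  have hP : 0 ≤ √(√(π / c) ^ d) := by positivity
  have hQ : 0 ≤ √((2 * π) ^ d) := by positivity
  rcases le_or_gt t 1 with h | h
  · have h2 := Real.sqrt_le_sqrt (gaussTorus_le_const (d := d) (s := t * c) (by positivity))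
    have h3 := Real.sqrt_nonneg (gaussTorus d (t * c))
    nlinarith
  · have ht0 : 0 < t := by linarith
    have h2 := gaussTorus_le_rpow (d := d) ht0 hc
    have h3 : t ^ (-((d : ℝ) / 2)) ≤ (t⁻¹) ^ 2 := by
      rw [inv_pow, ← Real.rpow_natCast t 2, ← Real.rpow_neg ht]
      exact Real.rpow_le_rpow_of_exponent_le h.le (by push_cast; linarith)
    have h4 : √(gaussTorus d (t * c)) ≤ √(√(π / c) ^ d) * t⁻¹ := by
      rw [← Real.sqrt_sq (inv_pos.2 ht0).le, ← Real.sqrt_mul (by positivity)]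
      exact Real.sqrt_le_sqrt (h2.trans (mul_le_mul_of_nonneg_left h3 (by positivity)))
    calc t * √(gaussTorus d (t * c)) ≤ t * (√(√(π / c) ^ d) * t⁻¹) := mul_le_mul_of_nonneg_left h4 ht
      _ = √(√(π / c) ^ d) := by field_simp
      _ ≤ _ := le_add_of_nonneg_left hQ

/-- The decay gain of the heat kernel at short times. -/
def gain (d : ℕ) (ζ : ℝ) : ℝ := ζ / (2 * (d + 2 + ζ))

lemma gain_pos (d : ℕ) {ζ : ℝ} (hζ : 0 < ζ) : 0 < gain d ζ := by unfold gain; positivity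

lemma exists_heat_short_time (d : ℕ) (hd : 1 ≤ d) {M K ζ : ℝ} (hM : 0 < M) (hK : 0 < K) (hζ : 0 < ζ) :
    ∃ C R : ℝ, 0 < C ∧ 1 ≤ R ∧ ∀ f : (Fin d → ℤ) → ℝ, Ker M K ζ f → ∀ z, R ≤ enormZ z →
      ∀ t, 0 ≤ t → t ≤ enormZ z / (2 * M) →
      ‖heat f t z‖ ≤ C * enormZ z ^ (-(((d : ℝ) + 1) / 2 + gain d ζ)) := by
  have hd1 : (1 : ℝ) ≤ d := by exact_mod_cast hd
  set p := ((d : ℝ) + 1) / 2 + gain d ζ with hp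
  set a : ℝ := (d + 2) / (d + 2 + ζ) with ha
  have hden : 0 < (d : ℝ) + 2 + ζ := by positivity
  have ha0 : 0 < a := by positivity
  have ha1 : a < 1 := by rw [ha, div_lt_one hden]; linarith
  have hlim1 : Tendsto (fun ρ : ℝ => (ρ ^ a) ^ (-ζ)) atTop (𝓝 0) :=
    (tendsto_rpow_neg_atTop hζ).comp (tendsto_rpow_atTop ha0)
  have hlim2 : Tendsto (fun ρ : ℝ => (ρ ^ (1 - a)) ^ (p / (1 - a)) * Real.exp (-(1 / 2) * ρ ^ (1 - a)))
      atTop (𝓝 0) :=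
    (tendsto_rpow_mul_exp_neg_mul_atTop_nhds_zero (p / (1 - a)) (1 / 2) (by norm_num)).comp
      (tendsto_rpow_atTop (by linarith))
  obtain ⟨R₀, hR₀⟩ := eventually_atTop.1
    ((hlim1.eventually (gt_mem_nhds (show (0 : ℝ) < K / (2 * M) by positivity))).and
      (hlim2.eventually (gt_mem_nhds one_pos)))
  obtain ⟨C₁, hC₁, hcorr⟩ : ∃ C₁ : ℝ, 0 < C₁ ∧ ∀ f : (Fin d → ℤ) → ℝ, Ker M K ζ f → ∀ ρ t : ℝ, 1 ≤ ρ →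
      0 ≤ t → t ≤ ρ → t * ∫ k in torus d, Real.exp (-(t * (K / 2) * enormR k ^ 2)) *
        ‖fourierZ (highPart (ρ ^ a) f) k‖ ≤ C₁ * ρ ^ (-p) := by
    rcases le_or_gt d 3 with h3 | h4
    · obtain ⟨C, hC, hCb⟩ := mul_gaussTorus_le d (half_pos hK) h3
      refine ⟨M * C, by positivity, fun f hf ρ t hρ ht htρ => ?_⟩
      have hρ0 : 0 < ρ := by linarith
      have h1 := mul_le_mul_of_nonneg_left (hf.highPart_integral_le (L := ρ ^ a) (by positivity) (t * (K / 2))) ht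
      have h2 := hCb ρ t hρ ht htρ
      have h5 : (ρ ^ a) ^ (-(2 + ζ)) * ρ ^ ((3 - (d : ℝ)) / 2) ≤ ρ ^ (-p) := by
        rw [← Real.rpow_mul hρ0.le, ← Real.rpow_add hρ0]
        refine Real.rpow_le_rpow_of_exponent_le hρ ?_
        have e : p + (a * -(2 + ζ) + (3 - (d : ℝ)) / 2) = (ζ / 2 - d * ζ) / (d + 2 + ζ) := by
          rw [hp, ha, gain]; field_simp; ring
        have : (ζ / 2 - d * ζ) / (d + 2 + ζ) ≤ 0 := by
          apply div_nonpos_of_nonpos_of_nonneg _ hden.le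
          nlinarith
        linarith
      calc _ ≤ t * (M * (ρ ^ a) ^ (-(2 + ζ)) * gaussTorus d (t * (K / 2))) := h1
        _ = M * (ρ ^ a) ^ (-(2 + ζ)) * (t * gaussTorus d (t * (K / 2))) := by ring
        _ ≤ M * (ρ ^ a) ^ (-(2 + ζ)) * (C * ρ ^ ((3 - (d : ℝ)) / 2)) :=
            mul_le_mul_of_nonneg_left h2 (by positivity)
        _ = M * C * ((ρ ^ a) ^ (-(2 + ζ)) * ρ ^ ((3 - (d : ℝ)) / 2)) := by ring
        _ ≤ _ := mul_le_mul_of_nonneg_left h5 (by positivity)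
    · obtain ⟨C, hC, hCb⟩ := mul_sqrt_gaussTorus_le d hK h4
      refine ⟨C * (√((2 * π) ^ d) * M), by positivity, fun f hf ρ t hρ ht htρ => ?_⟩
      have hρ0 : 0 < ρ := by linarith
      have h1 := mul_le_mul_of_nonneg_left
        (hf.highPart_integral_le_sqrt h4 (L := ρ ^ a) (by positivity) (t * (K / 2))) ht
      rw [show 2 * (t * (K / 2)) = t * K by ring] at h1
      have h2 := hCb t ht
      have h5 : (ρ ^ a) ^ (-(((d : ℝ) + 1 + ζ) / 2)) = ρ ^ (-p) := by
        rw [← Real.rpow_mul hρ0.le]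
        congr 1
        rw [hp, ha, gain]; field_simp; ring
      rw [h5] at h1
      calc _ ≤ t * (√(gaussTorus d (t * K)) * (√((2 * π) ^ d) * (M * ρ ^ (-p)))) := h1
        _ = (t * √(gaussTorus d (t * K))) * (√((2 * π) ^ d) * M * ρ ^ (-p)) := by ring
        _ ≤ C * (√((2 * π) ^ d) * M * ρ ^ (-p)) := mul_le_mul_of_nonneg_right h2 (by positivity)
        _ = _ := by ring
  refine ⟨Real.exp 2 * ((2 * π) ^ d * Real.exp 1) + Real.exp 2 * (2 * C₁), max R₀ 1, by positivity,
    le_max_right _ _, fun f hf z hz t ht htz => ?_⟩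
  set ρ := enormZ z with hρ
  have hρ1 : 1 ≤ ρ := (le_max_right _ _).trans hz
  have hρ0 : 0 < ρ := by linarith
  obtain ⟨hR1, hR2⟩ := hR₀ ρ ((le_max_left _ _).trans hz)
  have hM1 := hf.one_le
  have hMt : M * t ≤ ρ / 2 := by
    rw [le_div_iff₀ (by positivity)] at htz; linarith
  have htρ : t ≤ ρ := by nlinarith
  have hL0 : 2 * M * (ρ ^ a) ^ (-ζ) ≤ K := by
    have := hR1.le
    rwa [le_div_iff₀ (by positivity), mul_comm] at this
  have hLpos : 0 < ρ ^ a := by positivity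
  have htL : M * t * (ρ ^ a) ^ (-(2 + ζ)) ≤ 1 := by
    have h1 : ρ * (ρ ^ a) ^ (-(2 + ζ)) ≤ 1 := by
      have e0 : ρ * (ρ ^ a) ^ (-(2 + ζ)) = ρ ^ (1 + a * -(2 + ζ)) := by
        rw [← Real.rpow_mul hρ0.le, Real.rpow_add hρ0, Real.rpow_one]
      rw [e0]
      refine Real.rpow_le_one_of_one_le_of_nonpos hρ1 ?_
      have e : 1 + a * -(2 + ζ) = -((d + 1) * ζ + d + 2) / (d + 2 + ζ) := by
        rw [ha]; field_simp; ring
      rw [e]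
      exact div_nonpos_of_nonpos_of_nonneg (by nlinarith) hden.le
    have h2 : 0 ≤ (ρ ^ a) ^ (-(2 + ζ)) := by positivity
    nlinarith
  set L := ρ ^ a with hL
  have hzρ : enormR (toR z) = ρ := rfl
  have hν : enormR ((1 / (ρ * L)) • toR z) = 1 / L := by
    rw [enormR_smul, abs_of_pos (by positivity), hzρ]
    field_simp
  have key := hf.norm_heat_le_truncated hLpos hL0 ht htL
    (ν := (1 / (ρ * L)) • toR z) (by rw [hν, one_div_mul_cancel hLpos.ne']) z
  rw [hν] at key
  have hdiv : ρ / L = ρ ^ (1 - a) := by rw [Real.rpow_sub hρ0, Real.rpow_one]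
  have hdot : 1 / 2 * ρ ^ (1 - a) ≤ rdot ((1 / (ρ * L)) • toR z) (toR z - t • mean f) := by
    rw [rdot_smul_left, rdot_sub_right, rdot_self, rdot_smul_right, hzρ, ← hdiv]
    have h1 : rdot (toR z) (mean f) ≤ ρ * M := (le_abs_self _).trans ((abs_rdot_le _ _).trans
      (by rw [hzρ]; exact mul_le_mul_of_nonneg_left hf.enormR_mean_le hρ0.le))
    have h2 : ρ ^ 2 / 2 ≤ ρ ^ 2 - t * rdot (toR z) (mean f) := by
      have := mul_le_mul_of_nonneg_left h1 ht
      nlinarith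
    calc 1 / 2 * (ρ / L) = 1 / (ρ * L) * (ρ ^ 2 / 2) := by field_simp
      _ ≤ _ := mul_le_mul_of_nonneg_left h2 (by positivity)
  have hsq : M * t * (1 / L) ^ 2 ≤ 1 := by
    have h1 : ρ ≤ L ^ 2 := by
      rw [hL, ← Real.rpow_natCast, ← Real.rpow_mul hρ0.le]
      conv_lhs => rw [← Real.rpow_one ρ]
      refine Real.rpow_le_rpow_of_exponent_le hρ1 ?_
      rw [ha, div_mul_eq_mul_div, one_le_div hden]
      push_cast
      linarith [hf.zeta_le]
    rw [div_pow, one_pow, mul_one_div, div_le_one (by positivity)]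
    linarith
  have hexp : Real.exp (-rdot ((1 / (ρ * L)) • toR z) (toR z - t • mean f) + M * t * (1 / L) ^ 2) ≤
      Real.exp 1 * ρ ^ (-p) := by
    have h1 : Real.exp (-(1 / 2) * ρ ^ (1 - a)) ≤ ρ ^ (-p) := by
      have h2 : (ρ ^ (1 - a)) ^ (p / (1 - a)) = ρ ^ p := by
        rw [← Real.rpow_mul hρ0.le]
        congr 1
        field_simp [show 1 - a ≠ 0 by linarith]
      rw [h2] at hR2
      rw [Real.rpow_neg hρ0.le, inv_eq_one_div, le_div_iff₀ (by positivity), mul_comm]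
      exact hR2.le
    calc _ ≤ Real.exp (1 + -(1 / 2) * ρ ^ (1 - a)) := Real.exp_le_exp.2 (by linarith)
      _ = Real.exp 1 * Real.exp (-(1 / 2) * ρ ^ (1 - a)) := Real.exp_add _ _
      _ ≤ _ := mul_le_mul_of_nonneg_left h1 (Real.exp_pos _).le
  have hG := gaussTorus_le_const (d := d) (s := t * (K / 2)) (by positivity)
  have e1 := mul_le_mul hG hexp (Real.exp_pos _).le (by positivity)
  have e2 := mul_le_mul_of_nonneg_left e1 (Real.exp_pos 2).le
  have e3 := mul_le_mul_of_nonneg_left (hcorr f hf ρ t hρ1 ht htρ)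
    (show 0 ≤ Real.exp 2 * 2 by positivity)
  refine key.trans ?_
  rw [mul_assoc 2 t]
  nlinarith

lemma exists_heat_tail (d : ℕ) (hd : 1 ≤ d) {M K ζ e₀ : ℝ} (hM : 0 < M) (hK : 0 < K) (hζ : 0 < ζ)
    (he : 0 < e₀) :
    ∃ C t₁ : ℝ, 0 < C ∧ 1 ≤ t₁ ∧ ∀ f : (Fin d → ℤ) → ℝ, Ker M K ζ f → e₀ ≤ enormR (mean f) → ∀ z τ,
      t₁ ≤ τ → 2 / e₀ * enormZ z ≤ τ → IntegrableOn (fun t => heat f t z) (Set.Ioi τ) ∧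
      ∫ t in Set.Ioi τ, ‖heat f t z‖ ≤ C * τ ^ (-(((d : ℝ) - 1) / 2 + ζ / 4)) := by
  have hd1 : (1 : ℝ) ≤ d := by exact_mod_cast hd
  obtain ⟨C, t₁, hC, ht₁, hb⟩ := exists_heat_diffusive d hM hK hζ
  set q := ((d : ℝ) - 1) / 2 + ζ / 4 with hq
  have hqpos : 0 < q := by rw [hq]; linarith
  refine ⟨C * (e₀ / 2) ^ (-(1 + ζ / 2)) / q, t₁, by positivity, ht₁, fun f hf hη z τ hτ hz => ?_⟩
  have hτ0 : 0 < τ := by linarith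
  have hpt : ∀ t ∈ Set.Ioi τ, ‖heat f t z‖ ≤ C * (e₀ / 2) ^ (-(1 + ζ / 2)) * t ^ (-(q + 1)) := by
    intro t ht
    have htτ : τ < t := ht
    have ht0 : 0 < t := by linarith
    refine (hb f hf t (by linarith) z).trans ?_
    have h1 : e₀ / 2 * t ≤ enormR (toR z - t • mean f) := by
      have h2 := le_enormR_sub (t • mean f) (toR z)
      rw [← enormR_neg (t • mean f - toR z), neg_sub, enormR_smul, abs_of_pos ht0, ← enormZ_eq] at h2
      have h3 : enormZ z ≤ e₀ / 2 * t := by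
        have : 2 / e₀ * enormZ z ≤ t := by linarith
        rw [div_mul_eq_mul_div, div_le_iff₀ he] at this
        linarith
      have h4 := mul_le_mul_of_nonneg_left hη ht0.le
      linarith
    have hsq : √t * √t = t := Real.mul_self_sqrt ht0.le
    have hs0 : 0 < √t := Real.sqrt_pos.2 ht0
    have h2 : e₀ / 2 * √t ≤ 1 + enormR (toR z - t • mean f) / √t := by
      have : e₀ / 2 * √t ≤ enormR (toR z - t • mean f) / √t := by
        rw [le_div_iff₀ hs0, mul_assoc, hsq]; exact h1
      linarith
    have h3 : (1 + enormR (toR z - t • mean f) / √t) ^ (-(1 + ζ / 2)) ≤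
        (e₀ / 2) ^ (-(1 + ζ / 2)) * t ^ (-(1 / 2 + ζ / 4)) := by
      refine (Real.rpow_le_rpow_of_nonpos (by positivity) h2 (by linarith)).trans (le_of_eq ?_)
      rw [Real.mul_rpow (by positivity) hs0.le, Real.sqrt_eq_rpow, ← Real.rpow_mul ht0.le]
      congr 2; ring
    calc _ ≤ C * t ^ (-((d : ℝ) / 2)) * ((e₀ / 2) ^ (-(1 + ζ / 2)) * t ^ (-(1 / 2 + ζ / 4))) :=
          mul_le_mul_of_nonneg_left h3 (by positivity)
      _ = C * (e₀ / 2) ^ (-(1 + ζ / 2)) * (t ^ (-((d : ℝ) / 2)) * t ^ (-(1 / 2 + ζ / 4))) := by ring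
      _ = _ := by
          rw [← Real.rpow_add ht0]
          congr 2; rw [hq]; ring
  have hint : IntegrableOn (fun t : ℝ => C * (e₀ / 2) ^ (-(1 + ζ / 2)) * t ^ (-(q + 1))) (Set.Ioi τ) :=
    (integrableOn_Ioi_rpow_of_lt (by linarith) hτ0).const_mul _
  have hcont := continuous_heat hf.summ z
  have hI : IntegrableOn (fun t => heat f t z) (Set.Ioi τ) :=
    hint.mono' hcont.aestronglyMeasurable
      ((ae_restrict_iff' measurableSet_Ioi).2 (Eventually.of_forall hpt))
  refine ⟨hI, (setIntegral_mono_on hI.norm hint measurableSet_Ioi hpt).trans (le_of_eq ?_)⟩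
  rw [integral_const_mul, integral_Ioi_rpow_of_lt (by linarith) hτ0]
  rw [show -(q + 1) + 1 = -q by ring, neg_div_neg_eq]
  ring

lemma exists_heat_head (d : ℕ) (hd : 1 ≤ d) {M K ζ : ℝ} (hM : 0 < M) (hK : 0 < K) (hζ : 0 < ζ) :
    ∃ C R : ℝ, 0 < C ∧ 1 ≤ R ∧ ∀ f : (Fin d → ℤ) → ℝ, Ker M K ζ f → ∀ z, R ≤ enormZ z →
      ∫ t in Set.Ioc 0 (enormZ z / (2 * M)), ‖heat f t z‖ ≤
        C * enormZ z ^ (-(((d : ℝ) - 1) / 2 + gain d ζ)) := by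
  obtain ⟨C, R, hC, hR, hb⟩ := exists_heat_short_time d hd hM hK hζ
  refine ⟨C / (2 * M), R, by positivity, hR, fun f hf z hz => ?_⟩
  have hρ : 0 < enormZ z := by linarith
  have hcont := continuous_heat hf.summ z
  have h := setIntegral_mono_on (μ := volume)
    (hcont.norm.integrableOn_Ioc (a := 0) (b := enormZ z / (2 * M)))
    (continuous_const (y := C * enormZ z ^ (-(((d : ℝ) + 1) / 2 + gain d ζ)))).integrableOn_Ioc
    measurableSet_Ioc (fun t ht => hb f hf z hz t ht.1.le ht.2)
  refine h.trans (le_of_eq ?_)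
  rw [setIntegral_const, Real.volume_real_Ioc_of_le (by positivity), smul_eq_mul, sub_zero]
  have e : enormZ z ^ (-(((d : ℝ) - 1) / 2 + gain d ζ)) =
      enormZ z * enormZ z ^ (-(((d : ℝ) + 1) / 2 + gain d ζ)) := by
    conv_rhs => rw [← Real.rpow_one (enormZ z), ← Real.rpow_mul hρ.le, one_mul, ← Real.rpow_add hρ]
    congr 1; ring
  rw [e]; ring

lemma integrable_one_add_mul_abs {b p : ℝ} (hb : 0 < b) (hp : 1 < p) (T : ℝ) :
    Integrable fun t : ℝ => (1 + b * |t - T|) ^ (-p) := by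
  have h := integrable_one_add_norm (E := ℝ) (μ := volume) (r := p) (by simpa using hp)
  have h2 := (h.comp_mul_left' hb.ne').comp_sub_right T
  simpa [abs_mul, abs_of_pos hb] using h2

lemma integral_one_add_mul_abs {b p : ℝ} (hb : 0 < b) (T : ℝ) :
    ∫ t : ℝ, (1 + b * |t - T|) ^ (-p) = b⁻¹ * ∫ t : ℝ, (1 + |t|) ^ (-p) := by
  rw [integral_sub_right_eq_self (fun t => (1 + b * |t|) ^ (-p)) T]
  have h := Measure.integral_comp_mul_left (fun t : ℝ => (1 + |t|) ^ (-p)) b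
  simpa [abs_mul, abs_of_pos hb] using h

lemma exists_heat_middle (d : ℕ) {M K ζ e₀ : ℝ} (hM : 0 < M) (hK : 0 < K) (hζ : 0 < ζ)
    (he : 0 < e₀) :
    ∃ C R : ℝ, 0 < C ∧ 1 ≤ R ∧ ∀ f : (Fin d → ℤ) → ℝ, Ker M K ζ f → e₀ ≤ enormR (mean f) → ∀ z,
      R ≤ enormZ z → ∫ t in Set.Ioc (enormZ z / (2 * M)) (2 / e₀ * enormZ z), ‖heat f t z‖ ≤
        C * enormZ z ^ (-(((d : ℝ) - 1) / 2)) := by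
  obtain ⟨C, t₁, hC, ht₁, hb⟩ := exists_heat_diffusive d hM hK hζ
  set I := ∫ t : ℝ, (1 + |t|) ^ (-(1 + ζ / 2)) with hI
  have hI0 : 0 ≤ I := integral_nonneg fun t => by positivity
  refine ⟨C * (2 * M) ^ ((d : ℝ) / 2) * (√(2 / e₀) / e₀ * I) + 1, max 1 (2 * M * t₁), by positivity,
    le_max_left _ _, fun f hf hη z hz => ?_⟩
  set ρ := enormZ z with hρd
  have hρ1 : 1 ≤ ρ := (le_max_left _ _).trans hz
  have hρ : 0 < ρ := by linarith
  have hρt : t₁ ≤ ρ / (2 * M) := by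
    rw [le_div_iff₀ (by positivity), mul_comm]; exact (le_max_right _ _).trans hz
  have hηp : 0 < enormR (mean f) := by linarith
  set T := rdot (toR z) (mean f) / enormR (mean f) ^ 2 with hT
  set b := e₀ / √(2 / e₀ * ρ) with hbdef
  have hbpos : 0 < b := by positivity
  have hpt : ∀ t ∈ Set.Ioc (ρ / (2 * M)) (2 / e₀ * ρ), ‖heat f t z‖ ≤
      C * (ρ / (2 * M)) ^ (-((d : ℝ) / 2)) * (1 + b * |t - T|) ^ (-(1 + ζ / 2)) := by
    intro t ht
    have ht0 : 0 < t := lt_trans (by positivity) ht.1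
    refine (hb f hf t (hρt.trans ht.1.le) z).trans ?_
    have h1 : t ^ (-((d : ℝ) / 2)) ≤ (ρ / (2 * M)) ^ (-((d : ℝ) / 2)) :=
      Real.rpow_le_rpow_of_nonpos (by positivity) ht.1.le (by have : (0 : ℝ) ≤ d := by positivity
                                                              linarith)
    have h2 : enormR (mean f) * |t - T| ≤ enormR (toR z - t • mean f) := by
      have h3 := abs_rdot_le (toR z - t • mean f) (mean f)
      have h4 : rdot (toR z - t • mean f) (mean f) = -(enormR (mean f) ^ 2 * (t - T)) := by
        rw [rdot_sub_left, rdot_smul_left, rdot_self, hT]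
        field_simp; ring
      rw [h4, abs_neg, abs_mul, abs_of_nonneg (sq_nonneg _)] at h3
      have h5 : enormR (mean f) * (enormR (mean f) * |t - T|) ≤
          enormR (mean f) * enormR (toR z - t • mean f) := by linarith
      exact le_of_mul_le_mul_left h5 hηp
    have h6 : b * |t - T| ≤ enormR (toR z - t • mean f) / √t := by
      rw [hbdef, div_mul_eq_mul_div]
      refine div_le_div₀ (enormR_nonneg _) ?_ (Real.sqrt_pos.2 ht0) (Real.sqrt_le_sqrt ht.2)
      exact (mul_le_mul_of_nonneg_right hη (abs_nonneg _)).trans h2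
    have h7 : (1 + enormR (toR z - t • mean f) / √t) ^ (-(1 + ζ / 2)) ≤
        (1 + b * |t - T|) ^ (-(1 + ζ / 2)) :=
      Real.rpow_le_rpow_of_nonpos (by positivity) (by linarith) (by linarith)
    have : 0 ≤ 1 + enormR (toR z - t • mean f) / √t := by
      have := enormR_nonneg (toR z - t • mean f); positivity
    exact mul_le_mul (mul_le_mul_of_nonneg_left h1 hC.le) h7 (by positivity) (by positivity)
  have hcont := continuous_heat hf.summ z
  have hint := (integrable_one_add_mul_abs hbpos (show 1 < 1 + ζ / 2 by linarith) T).const_mul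
    (C * (ρ / (2 * M)) ^ (-((d : ℝ) / 2)))
  have hle := setIntegral_mono_on hcont.norm.integrableOn_Ioc hint.integrableOn measurableSet_Ioc hpt
  have hle2 := setIntegral_le_integral (s := Set.Ioc (ρ / (2 * M)) (2 / e₀ * ρ)) hint
    (Eventually.of_forall fun t => by positivity)
  refine (hle.trans hle2).trans ?_
  rw [integral_const_mul, integral_one_add_mul_abs hbpos, ← hI]
  have e1 : (ρ / (2 * M)) ^ (-((d : ℝ) / 2)) = (2 * M) ^ ((d : ℝ) / 2) * ρ ^ (-((d : ℝ) / 2)) := by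
    rw [Real.div_rpow hρ.le (by positivity), Real.rpow_neg (by positivity : (0 : ℝ) ≤ 2 * M)]
    field_simp
  have e2 : b⁻¹ = √(2 / e₀) / e₀ * ρ ^ (1 / 2 : ℝ) := by
    rw [hbdef, inv_div, Real.sqrt_mul (by positivity), ← Real.sqrt_eq_rpow]; ring
  have e3 : ρ ^ (-(((d : ℝ) - 1) / 2)) = ρ ^ (-((d : ℝ) / 2)) * ρ ^ (1 / 2 : ℝ) := by
    rw [← Real.rpow_add hρ]; congr 1; ring
  rw [e1, e2, e3, add_mul]
  have : 0 ≤ 1 * (ρ ^ (-((d : ℝ) / 2)) * ρ ^ (1 / 2 : ℝ)) := by positivity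
  refine le_trans (le_of_eq ?_) (le_add_of_nonneg_right this)
  ring

lemma exists_green_bound (d : ℕ) (hd : 1 ≤ d) {M K ζ e₀ : ℝ} (hM : 0 < M) (hK : 0 < K) (hζ : 0 < ζ)
    (he : 0 < e₀) :
    ∃ C : ℝ, 0 < C ∧ ∀ f : (Fin d → ℤ) → ℝ, Ker M K ζ f → e₀ ≤ enormR (mean f) → ∀ z,
      ‖∫ t in Set.Ioi (0 : ℝ), heat f t z‖ ≤ C * (1 + enormZ z) ^ (-(((d : ℝ) - 1) / 2)) := by
  have hd1 : (1 : ℝ) ≤ d := by exact_mod_cast hd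
  obtain ⟨C₁, R₁, hC₁, hR₁, h₁⟩ := exists_heat_head d hd hM hK hζ
  obtain ⟨C₂, R₂, hC₂, hR₂, h₂⟩ := exists_heat_middle d hM hK hζ he
  obtain ⟨C₃, t₁, hC₃, ht₁, h₃⟩ := exists_heat_tail d hd hM hK hζ he
  set R := max (max R₁ R₂) (e₀ / 2 * t₁) with hR
  set τ := max t₁ (2 / e₀ * R) with hτ
  set q := ((d : ℝ) - 1) / 2 with hq
  have hq0 : 0 ≤ q := by rw [hq]; linarith
  have hRpos : 0 < R := lt_of_lt_of_le (by linarith) ((le_max_left R₁ R₂).trans (le_max_left _ _))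
  have hτpos : 0 < τ := lt_of_lt_of_le (by linarith) (le_max_left _ _)
  set A := τ * (2 * π) ^ d + C₃ * τ ^ (-(q + ζ / 4)) with hA
  have hApos : 0 < A := by positivity
  have hgain := gain_pos d hζ
  have hC₃' : 0 < C₃ * (2 / e₀) ^ (-(q + ζ / 4)) := by positivity
  refine ⟨A * (1 + R) ^ q + (C₁ + C₂ + C₃ * (2 / e₀) ^ (-(q + ζ / 4))) * 2 ^ q, by positivity,
    fun f hf hη z => ?_⟩
  have hcont := continuous_heat hf.summ z
  have hρ0 := enormZ_nonneg z
  have hsplit : ∀ a : ℝ, 0 ≤ a → IntegrableOn (fun t => heat f t z) (Set.Ioi a) →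
      ‖∫ t in Set.Ioi (0 : ℝ), heat f t z‖ ≤
        (∫ t in Set.Ioc 0 a, ‖heat f t z‖) + ∫ t in Set.Ioi a, ‖heat f t z‖ := by
    intro a ha hI
    rw [← Set.Ioc_union_Ioi_eq_Ioi ha, setIntegral_union (Set.Ioc_disjoint_Ioi le_rfl)
      measurableSet_Ioi hcont.integrableOn_Ioc hI]
    refine (norm_add_le _ _).trans ?_
    exact add_le_add (norm_integral_le_integral_norm _) (norm_integral_le_integral_norm _)
  rcases le_or_gt R (enormZ z) with hz | hz
  · set ρ := enormZ z with hρ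
    have hρpos : 0 < ρ := by linarith
    have hρ1 : 1 ≤ ρ := by
      have := (le_max_left R₁ R₂).trans (le_max_left _ (e₀ / 2 * t₁)); linarith
    have h1 := h₁ f hf z (((le_max_left R₁ R₂).trans (le_max_left _ _)).trans hz)
    have h2 := h₂ f hf hη z (((le_max_right R₁ R₂).trans (le_max_left _ _)).trans hz)
    have ht : t₁ ≤ 2 / e₀ * ρ := by
      have : e₀ / 2 * t₁ ≤ ρ := (le_max_right _ _).trans hz
      calc t₁ = 2 / e₀ * (e₀ / 2 * t₁) := by field_simp
        _ ≤ _ := by gcongr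
    have h3 := h₃ f hf hη z (2 / e₀ * ρ) ht le_rfl
    have hab : ρ / (2 * M) ≤ 2 / e₀ * ρ := by
      have h5 : e₀ ≤ M := hη.trans hf.enormR_mean_le
      have h6 : 1 / (2 * M) ≤ 2 / e₀ := by
        rw [div_le_div_iff₀ (by positivity) he]; linarith
      calc ρ / (2 * M) = 1 / (2 * M) * ρ := by ring
        _ ≤ _ := by gcongr
    have h4 := hsplit (2 / e₀ * ρ) (by positivity) h3.1
    have hun : ∫ t in Set.Ioc 0 (2 / e₀ * ρ), ‖heat f t z‖ =
        (∫ t in Set.Ioc 0 (ρ / (2 * M)), ‖heat f t z‖) +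
          ∫ t in Set.Ioc (ρ / (2 * M)) (2 / e₀ * ρ), ‖heat f t z‖ := by
      rw [← Set.Ioc_union_Ioc_eq_Ioc (by positivity) hab, setIntegral_union
        (Set.Ioc_disjoint_Ioc_of_le le_rfl) measurableSet_Ioc hcont.norm.integrableOn_Ioc
        hcont.norm.integrableOn_Ioc]
    have e1 : ρ ^ (-(q + gain d ζ)) ≤ ρ ^ (-q) :=
      Real.rpow_le_rpow_of_exponent_le hρ1 (by linarith)
    have e2 : (2 / e₀ * ρ) ^ (-(q + ζ / 4)) ≤ (2 / e₀) ^ (-(q + ζ / 4)) * ρ ^ (-q) := by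
      rw [Real.mul_rpow (by positivity) hρpos.le]
      exact mul_le_mul_of_nonneg_left (Real.rpow_le_rpow_of_exponent_le hρ1 (by linarith))
        (by positivity)
    have e3 : ρ ^ (-q) ≤ 2 ^ q * (1 + ρ) ^ (-q) := by
      have : (2 * ρ) ^ (-q) ≤ (1 + ρ) ^ (-q) :=
        Real.rpow_le_rpow_of_nonpos (by positivity) (by linarith) (by linarith)
      rw [Real.mul_rpow (by norm_num) hρpos.le, Real.rpow_neg (by norm_num)] at this
      have h2q : (0 : ℝ) < 2 ^ q := by positivity
      calc ρ ^ (-q) = 2 ^ q * ((2 ^ q)⁻¹ * ρ ^ (-q)) := by field_simp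
        _ ≤ _ := by gcongr
    have hAR : 0 ≤ A * (1 + R) ^ q * (1 + ρ) ^ (-q) := by positivity
    calc _ ≤ C₁ * ρ ^ (-(q + gain d ζ)) + C₂ * ρ ^ (-q) + C₃ * (2 / e₀ * ρ) ^ (-(q + ζ / 4)) := by
          linarith [h3.2]
      _ ≤ C₁ * ρ ^ (-q) + C₂ * ρ ^ (-q) + C₃ * ((2 / e₀) ^ (-(q + ζ / 4)) * ρ ^ (-q)) := by gcongr
      _ = (C₁ + C₂ + C₃ * (2 / e₀) ^ (-(q + ζ / 4))) * ρ ^ (-q) := by ring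
      _ ≤ (C₁ + C₂ + C₃ * (2 / e₀) ^ (-(q + ζ / 4))) * (2 ^ q * (1 + ρ) ^ (-q)) := by gcongr
      _ ≤ _ := by rw [add_mul]; linarith
  · have h4 := h₃ f hf hη z τ (le_max_left _ _)
      ((mul_le_mul_of_nonneg_left hz.le (by positivity)).trans (le_max_right _ _))
    have h5 := hsplit τ hτpos.le h4.1
    have h6 : ∫ t in Set.Ioc 0 τ, ‖heat f t z‖ ≤ τ * (2 * π) ^ d := by
      have h := setIntegral_mono_on (μ := volume) (hcont.norm.integrableOn_Ioc (a := 0) (b := τ))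
        (continuous_const (y := (2 * π) ^ d)).integrableOn_Ioc measurableSet_Ioc
        (fun t ht => (hf.norm_heat_le_gauss ht.1.le z).trans
          (gaussTorus_le_const (by have := ht.1; positivity)))
      refine h.trans (le_of_eq ?_)
      rw [setIntegral_const, Real.volume_real_Ioc_of_le hτpos.le, smul_eq_mul, sub_zero]
    have h7 : ‖∫ t in Set.Ioi (0 : ℝ), heat f t z‖ ≤ A := by rw [hA]; linarith [h4.2]
    have h8 : 1 ≤ (1 + R) ^ q * (1 + enormZ z) ^ (-q) := by
      rw [Real.rpow_neg (by positivity), ← div_eq_mul_inv, one_le_div (by positivity)]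
      exact Real.rpow_le_rpow (by positivity) (by linarith) hq0
    have h9 : 0 ≤ (C₁ + C₂ + C₃ * (2 / e₀) ^ (-(q + ζ / 4))) * 2 ^ q * (1 + enormZ z) ^ (-q) := by
      positivity
    have h10 := mul_le_mul_of_nonneg_left h8 hApos.le
    rw [add_mul]
    linarith

/-! ### Local central limit theorem -/

lemma norm_exp_sub_taylor_le {ζ : ℝ} (hζ : 0 < ζ) (hζ1 : ζ ≤ 1) (u : ℝ) :
    ‖Complex.exp (-Complex.I * (u : ℂ)) - (1 - Complex.I * u - (u : ℂ) ^ 2 / 2)‖ ≤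
      4 * |u| ^ (2 + ζ) := by
  have hn : ‖-Complex.I * (u : ℂ)‖ = |u| := by simp
  have e : (1 - Complex.I * u - (u : ℂ) ^ 2 / 2) =
      ∑ m ∈ Finset.range 3, (-Complex.I * (u : ℂ)) ^ m / m.factorial := by
    simp [Finset.sum_range_succ, mul_pow, Nat.factorial]
    ring
  rcases le_or_gt |u| 1 with h | h
  · rw [e]
    refine (Complex.exp_bound (by rw [hn]; exact h) (by norm_num)).trans ?_
    rw [hn]
    have h1 : |u| ^ 3 ≤ |u| ^ (2 + ζ) := by
      rcases eq_or_lt_of_le (abs_nonneg u) with h0 | h0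
      · rw [← h0, Real.zero_rpow (by linarith)]; norm_num
      · rw [← Real.rpow_natCast]
        exact Real.rpow_le_rpow_of_exponent_ge h0 h (by push_cast; linarith)
    have h2 : 0 ≤ |u| ^ 3 := by positivity
    norm_num [Nat.factorial]
    linarith
  · have h1 : |u| ^ 2 ≤ |u| ^ (2 + ζ) := by
      rw [← Real.rpow_natCast]
      exact Real.rpow_le_rpow_of_exponent_le h.le (by push_cast; linarith)
    have hx : ‖Complex.exp (-Complex.I * (u : ℂ))‖ = 1 := by
      rw [show -Complex.I * (u : ℂ) = ((-u : ℝ) : ℂ) * Complex.I by push_cast; ring]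
      exact Complex.norm_exp_ofReal_mul_I _
    have h2 : ‖(1 - Complex.I * u - (u : ℂ) ^ 2 / 2)‖ ≤ 1 + |u| + |u| ^ 2 / 2 := by
      refine (norm_sub_le _ _).trans (add_le_add ((norm_sub_le _ _).trans ?_) ?_)
      · simp
      · simp
    refine (norm_sub_le _ _).trans ?_
    rw [hx]
    nlinarith [sq_abs u]

namespace Ker

variable {M K ζ : ℝ} {f : (Fin d → ℤ) → ℝ}

lemma fourier_taylor (hf : Ker M K ζ f) (k : Fin d → ℝ) :
    ‖1 - fourierZ f k - (Complex.I * (rdot k (mean f) : ℂ) + (rdot k (cov f *ᵥ k) : ℂ) / 2)‖ ≤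
      4 * M * enormR k ^ (2 + ζ) := by
  have hζ := hf.zeta_pos
  have s0 : HasSum (fun y => (f y : ℂ)) 1 := by
    have := (Summable.of_abs hf.summ).hasSum
    rw [hf.one] at this
    simpa using Complex.hasSum_ofReal.2 this
  have s1 : HasSum (fun y => ((rdotZ k y * f y : ℝ) : ℂ)) (rdot k (mean f) : ℂ) := by
    rw [hf.rdot_mean]
    exact Complex.hasSum_ofReal.2 (Summable.of_abs (hf.weight_summable (hf.rdotZ_weight k))).hasSum
  have s2 : HasSum (fun y => ((rdotZ k y ^ 2 * f y : ℝ) : ℂ)) (rdot k (cov f *ᵥ k) : ℂ) := by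
    rw [hf.rdot_cov]
    exact Complex.hasSum_ofReal.2 (Summable.of_abs (hf.weight_summable (hf.rdotZ_sq_weight k))).hasSum
  have s3 := (summable_fourier hf.summ k).hasSum
  have s := ((s0.sub s3).sub ((s1.mul_left Complex.I).add (s2.div_const 2)))
  have e : (fun y => (f y : ℂ) - (f y : ℂ) * Complex.exp (-Complex.I * (rdotZ k y : ℂ)) -
      (Complex.I * ((rdotZ k y * f y : ℝ) : ℂ) + ((rdotZ k y ^ 2 * f y : ℝ) : ℂ) / 2)) = fun y =>
      -((f y : ℂ) * (Complex.exp (-Complex.I * (rdotZ k y : ℂ)) -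
        (1 - Complex.I * (rdotZ k y : ℂ) - (rdotZ k y : ℂ) ^ 2 / 2))) := by
    ext y; push_cast; ring
  rw [e] at s
  change HasSum _ (1 - fourierZ f k - _) at s
  rw [← s.tsum_eq]
  have hb : ∀ y, ‖-((f y : ℂ) * (Complex.exp (-Complex.I * (rdotZ k y : ℂ)) -
        (1 - Complex.I * (rdotZ k y : ℂ) - (rdotZ k y : ℂ) ^ 2 / 2)))‖ ≤
      4 * enormR k ^ (2 + ζ) * (enormZ y ^ (2 + ζ) * |f y|) := by
    intro y
    rw [norm_neg, norm_mul, Complex.norm_real, Real.norm_eq_abs]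
    have h1 := norm_exp_sub_taylor_le hζ hf.zeta_le (rdotZ k y)
    have h2 : |rdotZ k y| ^ (2 + ζ) ≤ (enormR k * enormZ y) ^ (2 + ζ) :=
      Real.rpow_le_rpow (abs_nonneg _) (abs_rdotZ_le k y) (by linarith)
    rw [Real.mul_rpow (enormR_nonneg _) (enormZ_nonneg _)] at h2
    have h3 := h1.trans (mul_le_mul_of_nonneg_left h2 (by norm_num : (0 : ℝ) ≤ 4))
    calc _ ≤ |f y| * (4 * (enormR k ^ (2 + ζ) * enormZ y ^ (2 + ζ))) :=
          mul_le_mul_of_nonneg_left h3 (abs_nonneg _)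
      _ = _ := by ring
  have hk : 0 ≤ enormR k ^ (2 + ζ) := Real.rpow_nonneg (enormR_nonneg _) _
  refine (tsum_of_norm_bounded (hf.mom_summ.hasSum.mul_left (4 * enormR k ^ (2 + ζ))) hb).trans ?_
  calc _ ≤ 4 * enormR k ^ (2 + ζ) * M := mul_le_mul_of_nonneg_left hf.mom (by positivity)
    _ = _ := by ring

lemma tendsto_enormR_smul_rpow {ι : Type*} {l : Filter ι} {r : ι → ℝ} (hr : Tendsto r l (𝓝[>] 0))
    {a : ℝ} (ha : 0 < a) : Tendsto (fun n => r n ^ a) l (𝓝 0) := by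
  have h := (Real.continuousAt_rpow_const 0 a (Or.inr ha.le)).tendsto
  rw [Real.zero_rpow ha.ne'] at h
  exact h.comp (hr.mono_right nhdsWithin_le_nhds)

end Ker

lemma eventually_smul_mem_torus {ι : Type*} {l : Filter ι} {r : ι → ℝ} (hr : Tendsto r l (𝓝 0))
    (k : Fin d → ℝ) : ∀ᶠ n in l, r n • k ∈ torus d := by
  have h1 : torus d ∈ 𝓝 (0 : Fin d → ℝ) :=
    set_pi_mem_nhds Set.finite_univ fun i _ => Icc_mem_nhds (by simpa using Real.pi_pos) (by simpa using Real.pi_pos)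
  have h2 : Tendsto (fun n => r n • k) l (𝓝 0) := by simpa using hr.smul_const k
  exact h2 h1

lemma mulVec_smul_rdot (A : Matrix (Fin d) (Fin d) ℝ) (c : ℝ) (k : Fin d → ℝ) :
    rdot (c • k) (A *ᵥ (c • k)) = c ^ 2 * rdot k (A *ᵥ k) := by
  rw [Matrix.mulVec_smul, rdot_smul_left, rdot_smul_right]; ring

namespace Ker

variable {M K ζ : ℝ} {f : (Fin d → ℤ) → ℝ}

lemma cov_lower (hf : Ker M K ζ f) (k : Fin d → ℝ) :
    2 * K * enormR k ^ 2 ≤ rdot k (cov f *ᵥ k) := by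
  have hζ := hf.zeta_pos
  have hr : Tendsto (fun ε : ℝ => ε) (𝓝[>] 0) (𝓝[>] 0) := tendsto_id
  have hmem := eventually_smul_mem_torus (hr.mono_right nhdsWithin_le_nhds) k
  have h1 : ∀ᶠ ε : ℝ in 𝓝[>] 0, K * enormR k ^ 2 ≤
      rdot k (cov f *ᵥ k) / 2 + 4 * M * enormR k ^ (2 + ζ) * ε ^ ζ := by
    filter_upwards [hmem, self_mem_nhdsWithin] with ε hε hε0
    have hε0 : 0 < ε := hε0
    have h2 := hf.infra _ hε
    have h3 := (Complex.abs_re_le_norm _).trans (hf.fourier_taylor (ε • k))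
    rw [mulVec_smul_rdot] at h3
    rw [enormR_smul, abs_of_pos hε0] at h2 h3
    rw [Real.mul_rpow hε0.le (enormR_nonneg _), Real.rpow_add hε0, Real.rpow_two] at h3
    have h4 := (abs_le.1 h3).2
    rw [Complex.sub_re, Complex.sub_re, Complex.add_re, Complex.one_re, Complex.I_mul_re,
      Complex.ofReal_im, neg_zero, zero_add] at h4
    have h5 : (((ε ^ 2 * rdot k (cov f *ᵥ k) : ℝ) : ℂ) / 2).re = ε ^ 2 * rdot k (cov f *ᵥ k) / 2 := by
      rw [show (((ε ^ 2 * rdot k (cov f *ᵥ k) : ℝ) : ℂ) / 2) =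
        ((ε ^ 2 * rdot k (cov f *ᵥ k) / 2 : ℝ) : ℂ) by push_cast; ring, Complex.ofReal_re]
    rw [h5] at h4
    have h6 : ε ^ 2 * (K * enormR k ^ 2) ≤
        ε ^ 2 * (rdot k (cov f *ᵥ k) / 2 + 4 * M * enormR k ^ (2 + ζ) * ε ^ ζ) := by
      nlinarith
    exact le_of_mul_le_mul_left h6 (by positivity)
  have h2 : Tendsto (fun ε : ℝ => rdot k (cov f *ᵥ k) / 2 + 4 * M * enormR k ^ (2 + ζ) * ε ^ ζ)
      (𝓝[>] 0) (𝓝 (rdot k (cov f *ᵥ k) / 2 + 4 * M * enormR k ^ (2 + ζ) * 0)) :=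
    ((tendsto_enormR_smul_rpow hr hζ).const_mul _).const_add _
  have := ge_of_tendsto h2 h1
  linarith

lemma cov_isHermitian (f : (Fin d → ℤ) → ℝ) : (cov f).IsHermitian := by
  ext i j
  simp only [Matrix.conjTranspose_apply, cov, Matrix.of_apply, star_trivial]
  congr 1; ext y; ring

lemma mul_heat_eq (f : (Fin d → ℤ) → ℝ) {t : ℝ} (ht : 0 < t) (z : Fin d → ℤ) :
    ((t ^ ((d : ℝ) / 2) : ℝ) : ℂ) * heat f t z = ∫ k, (torus d).indicator (fun k =>
      Complex.exp (-(t : ℂ) * (1 - fourierZ f k)) * Complex.exp (Complex.I * (rdotZ k z : ℂ)))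
        ((√t)⁻¹ • k) := by
  rw [Measure.integral_comp_smul, integral_indicator measurableSet_torus, heat, Module.finrank_fin_fun]
  have : |(((√t)⁻¹ ^ d)⁻¹)| = t ^ ((d : ℝ) / 2) := by
    rw [abs_of_nonneg (by positivity), inv_pow, inv_inv, Real.sqrt_eq_rpow, ← Real.rpow_natCast,
      ← Real.rpow_mul ht.le]
    congr 1; ring
  rw [this, Complex.real_smul]

end Ker

/-- The Fourier integral of the Gaussian with quadratic form `A`. -/
def gaussInt (A : Matrix (Fin d) (Fin d) ℝ) (v : Fin d → ℝ) : ℂ :=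
  ∫ k : Fin d → ℝ, Complex.exp (-((rdot k (A *ᵥ k) : ℂ) / 2)) * Complex.exp (Complex.I * (rdot k v : ℂ))

lemma tendsto_rdot_mulVec {A : ℕ → Matrix (Fin d) (Fin d) ℝ} {B : Matrix (Fin d) (Fin d) ℝ}
    (h : Tendsto A atTop (𝓝 B)) (k : Fin d → ℝ) :
    Tendsto (fun n => rdot k (A n *ᵥ k)) atTop (𝓝 (rdot k (B *ᵥ k))) := by
  have : Continuous fun A : Matrix (Fin d) (Fin d) ℝ => rdot k (A *ᵥ k) := by
    unfold rdot Matrix.mulVec dotProduct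
    fun_prop
  exact (this.tendsto B).comp h

lemma heat_local_clt {M K ζ : ℝ} {f : ℕ → (Fin d → ℤ) → ℝ} {t : ℕ → ℝ} {z : ℕ → Fin d → ℤ}
    {v : Fin d → ℝ} {A : Matrix (Fin d) (Fin d) ℝ} (hf : ∀ n, Ker M K ζ (f n))
    (ht : Tendsto t atTop atTop)
    (hv : Tendsto (fun n => (√(t n))⁻¹ • (toR (z n) - t n • mean (f n))) atTop (𝓝 v))
    (hA : Tendsto (fun n => cov (f n)) atTop (𝓝 A)) :
    Tendsto (fun n => ((t n ^ ((d : ℝ) / 2) : ℝ) : ℂ) * heat (f n) (t n) (z n)) atTop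
      (𝓝 (gaussInt A v)) := by
  have hK := (hf 0).K_pos
  have hζ := (hf 0).zeta_pos
  have hpos : ∀ᶠ n in atTop, 0 < t n := ht.eventually_gt_atTop 0
  set g : ℕ → (Fin d → ℝ) → ℂ := fun n k => (torus d).indicator (fun k =>
      Complex.exp (-(t n : ℂ) * (1 - fourierZ (f n) k)) *
        Complex.exp (Complex.I * (rdotZ k (z n) : ℂ))) ((√(t n))⁻¹ • k) with hg
  have hr0 : Tendsto (fun n => (√(t n))⁻¹) atTop (𝓝 0) :=
    (Real.tendsto_sqrt_atTop.comp ht).inv_tendsto_atTop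
  have hr : Tendsto (fun n => (√(t n))⁻¹) atTop (𝓝[>] 0) :=
    tendsto_nhdsWithin_iff.2 ⟨hr0, by
      filter_upwards [hpos] with n hn
      exact inv_pos.2 (Real.sqrt_pos.2 hn)⟩
  have hlim : Tendsto (fun n => ∫ k, g n k) atTop (𝓝 (gaussInt A v)) := by
    refine tendsto_integral_filter_of_dominated_convergence
      (fun k => Real.exp (-(K * enormR k ^ 2))) ?_ ?_ (integrable_gauss hK) ?_
    · refine Eventually.of_forall fun n => ?_
      have hc := continuous_fourierZ (hf n).summ
      have hm : Measurable fun k : Fin d → ℝ => (√(t n))⁻¹ • k := measurable_const_smul _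
      exact ((Measurable.indicator (Continuous.measurable (by fun_prop)) measurableSet_torus).comp
        hm).aestronglyMeasurable
    · filter_upwards [hpos] with n hn
      refine Eventually.of_forall fun k => ?_
      simp only [hg, Set.indicator]
      split_ifs with hk
      · rw [norm_mul, norm_fourier_factor', mul_one, Complex.norm_exp, ← Complex.ofReal_neg,
          Complex.re_ofReal_mul, Complex.sub_re, Complex.one_re]
        refine Real.exp_le_exp.2 ?_
        have h1 := (hf n).infra _ hk
        have hs : 0 < √(t n) := Real.sqrt_pos.2 hn
        rw [enormR_smul, abs_of_pos (inv_pos.2 hs), mul_pow, inv_pow, Real.sq_sqrt hn.le] at h1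
        have h2 := mul_le_mul_of_nonneg_left h1 hn.le
        have h3 : t n * (K * ((t n)⁻¹ * enormR k ^ 2)) = K * enormR k ^ 2 := by field_simp
        linarith
      · simpa using (Real.exp_pos _).le
    · refine Eventually.of_forall fun k => ?_
      have herr : Tendsto (fun n => (t n : ℂ) * (1 - fourierZ (f n) ((√(t n))⁻¹ • k) -
          (Complex.I * (rdot ((√(t n))⁻¹ • k) (mean (f n)) : ℂ) +
            (rdot ((√(t n))⁻¹ • k) (cov (f n) *ᵥ ((√(t n))⁻¹ • k)) : ℂ) / 2))) atTop (𝓝 0) := by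
        have hb := (Ker.tendsto_enormR_smul_rpow hr hζ).const_mul (4 * M * enormR k ^ (2 + ζ))
        rw [mul_zero] at hb
        refine squeeze_zero_norm' ?_ hb
        filter_upwards [hpos] with n hn
        have hs : 0 < (√(t n))⁻¹ := inv_pos.2 (Real.sqrt_pos.2 hn)
        rw [norm_mul, Complex.norm_real, Real.norm_eq_abs, abs_of_pos hn]
        refine (mul_le_mul_of_nonneg_left ((hf n).fourier_taylor _) hn.le).trans (le_of_eq ?_)
        rw [enormR_smul, abs_of_pos hs, Real.mul_rpow hs.le (enormR_nonneg _), Real.rpow_add hs,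
          Real.rpow_two]
        have : (√(t n))⁻¹ ^ 2 = (t n)⁻¹ := by rw [inv_pow, Real.sq_sqrt hn.le]
        rw [this]; field_simp
      have hquad := (Complex.continuous_ofReal.tendsto _).comp (tendsto_rdot_mulVec hA k)
      have hlin : Tendsto (fun n => rdot k ((√(t n))⁻¹ • (toR (z n) - t n • mean (f n)))) atTop
          (𝓝 (rdot k v)) := by
        have : Continuous fun w : Fin d → ℝ => rdot k w := by
          unfold rdot; fun_prop
        exact (this.tendsto v).comp hv
      have hlin' := (Complex.continuous_ofReal.tendsto _).comp hlin
      have hexp := (Complex.continuous_exp.tendsto _).comp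
        (((hquad.div_const 2).neg.add (hlin'.const_mul Complex.I)).sub herr)
      rw [sub_zero, Complex.exp_add] at hexp
      refine hexp.congr' ?_
      filter_upwards [hpos, eventually_smul_mem_torus hr0 k] with n hn hk
      simp only [hg, Set.indicator_of_mem hk, Function.comp_apply]
      rw [← Complex.exp_add]
      congr 1
      rw [mulVec_smul_rdot, rdot_smul_right, rdot_sub_right, rdot_smul_right, rdot_smul_left,
        rdotZ_smul_left, rdotZ_eq, inv_pow, Real.sq_sqrt hn.le]
      have : (t n : ℂ) ≠ 0 := by exact_mod_cast hn.ne'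
      push_cast
      field_simp
      ring
  refine hlim.congr' ?_
  filter_upwards [hpos] with n hn
  rw [Ker.mul_heat_eq _ hn]

lemma rdot_eq_dotProduct (a b : Fin d → ℝ) : rdot a b = a ⬝ᵥ b := rfl

open scoped MatrixOrder in
lemma exists_transpose_mul_self {A : Matrix (Fin d) (Fin d) ℝ} (hA : A.PosDef) :
    ∃ B : Matrix (Fin d) (Fin d) ℝ, A = Bᵀ * B := by
  obtain ⟨B, hB⟩ := CStarAlgebra.nonneg_iff_eq_star_mul_self.mp hA.posSemidef.nonneg
  exact ⟨B, by rw [hB, Matrix.star_eq_conjTranspose, Matrix.conjTranspose_eq_transpose_of_trivial]⟩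

lemma gaussInt_eq {A : Matrix (Fin d) (Fin d) ℝ} (hA : A.PosDef) (v : Fin d → ℝ) :
    gaussInt A v = (((2 * π) ^ ((d : ℝ) / 2) / √A.det *
      Real.exp (-(rdot v (A⁻¹ *ᵥ v)) / 2) : ℝ) : ℂ) := by
  obtain ⟨B, hB⟩ := exists_transpose_mul_self hA
  have hdet : A.det = B.det ^ 2 := by rw [hB, Matrix.det_mul, Matrix.det_transpose, sq]
  have hdA := hA.det_pos
  have hdB : B.det ≠ 0 := by
    intro h
    rw [hdet, h] at hdA
    norm_num at hdA
  have hBu : IsUnit B.det := isUnit_iff_ne_zero.2 hdB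
  set u : Fin d → ℝ := v ᵥ* B⁻¹ with hu
  set F : (Fin d → ℝ) → ℂ := fun w => Complex.exp (-(1 / 2 : ℂ) * ∑ i, (w i : ℂ) ^ 2 +
    ∑ i, (Complex.I * (u i : ℂ)) * (w i : ℂ)) with hF
  have hFc : Continuous F := by fun_prop
  have hquad : ∀ k, rdot k (A *ᵥ k) = ∑ i, ((B *ᵥ k) i) ^ 2 := by
    intro k
    rw [rdot_eq_dotProduct, hB, ← Matrix.mulVec_mulVec, Matrix.dotProduct_mulVec,
      Matrix.vecMul_transpose]
    simp [dotProduct, sq]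
  have hlin : ∀ k, rdot k v = ∑ i, u i * (B *ᵥ k) i := by
    intro k
    have h1 : u ⬝ᵥ (B *ᵥ k) = k ⬝ᵥ v := by
      rw [hu, Matrix.dotProduct_mulVec, Matrix.vecMul_vecMul, Matrix.nonsing_inv_mul _ hBu,
        Matrix.vecMul_one, dotProduct_comm]
    rw [rdot_eq_dotProduct, ← h1]; rfl
  have h1 : gaussInt A v = ∫ k, F (B *ᵥ k) := by
    unfold gaussInt
    congr 1; ext k
    rw [← Complex.exp_add, hquad, hlin, hF]
    congr 1
    push_cast
    rw [Finset.mul_sum]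
    congr 1
    · ring
    · exact Finset.sum_congr rfl fun i _ => by ring
  have h2 : ∫ k, F (B *ᵥ k) = ((|(B.det)⁻¹| : ℝ) : ℂ) * ∫ w, F w := by
    have h3 := Real.map_matrix_volume_pi_eq_smul_volume_pi hdB
    have h4 : ∫ w, F w ∂(Measure.map (Matrix.toLin' B) volume) = ∫ k, F (Matrix.toLin' B k) :=
      integral_map_of_stronglyMeasurable (LinearMap.continuous_of_finiteDimensional _).measurable
        hFc.stronglyMeasurable
    rw [h3, integral_smul_measure, ENNReal.toReal_ofReal (abs_nonneg _)] at h4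
    simp only [Matrix.toLin'_apply] at h4
    rw [← h4, Complex.real_smul]
  have h5 := GaussianFourier.integral_cexp_neg_mul_sum_add (b := (1 / 2 : ℂ)) (by norm_num)
    (fun i => Complex.I * (u i : ℂ))
  have h6 : rdot v (A⁻¹ *ᵥ v) = ∑ i, u i ^ 2 := by
    rw [rdot_eq_dotProduct, hB, Matrix.mul_inv_rev, ← Matrix.mulVec_mulVec, Matrix.dotProduct_mulVec,
      ← Matrix.transpose_nonsing_inv, Matrix.mulVec_transpose, ← hu]
    simp [dotProduct, sq]
  have h7 : |(B.det)⁻¹| = 1 / √A.det := by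
    rw [hdet, Real.sqrt_sq_eq_abs, abs_inv, one_div]
  have h8 : ((π : ℂ) / (1 / 2)) ^ ((Fintype.card (Fin d) : ℂ) / 2) =
      (((2 * π) ^ ((d : ℝ) / 2) : ℝ) : ℂ) := by
    rw [Complex.ofReal_cpow (by positivity), Fintype.card_fin]
    push_cast
    congr 1; ring
  rw [h1, h2, hF, h5, h8, h6, h7]
  have h9 : ((∑ i, (Complex.I * (u i : ℂ)) ^ 2) / (4 * (1 / 2 : ℂ))) =
      ((-(∑ i, u i ^ 2) / 2 : ℝ) : ℂ) := by
    simp only [mul_pow, Complex.I_sq]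
    push_cast
    rw [← Finset.mul_sum]; ring
  rw [h9, ← Complex.ofReal_exp]
  push_cast
  ring

lemma integral_gaussInt_line {A : Matrix (Fin d) (Fin d) ℝ} (hA : A.PosDef) (η : Fin d → ℝ)
    : ∫ s : ℝ, gaussInt A (-(s • η)) =
      (((2 * π) ^ ((d : ℝ) / 2) / √A.det * √(2 * π / rdot η (A⁻¹ *ᵥ η)) : ℝ) : ℂ) := by
  have h1 : ∀ s : ℝ, gaussInt A (-(s • η)) = (((2 * π) ^ ((d : ℝ) / 2) / √A.det *
      Real.exp (-(rdot η (A⁻¹ *ᵥ η) / 2) * s ^ 2) : ℝ) : ℂ) := by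
    intro s
    rw [gaussInt_eq hA, ← neg_smul, mulVec_smul_rdot]
    congr 3; ring
  simp_rw [h1]
  rw [integral_complex_ofReal, integral_const_mul, integral_gaussian]
  congr 3
  field_simp

lemma posDef_of_lower {A : Matrix (Fin d) (Fin d) ℝ} (hA : A.IsHermitian) {c : ℝ} (hc : 0 < c)
    (h : ∀ k, c * enormR k ^ 2 ≤ rdot k (A *ᵥ k)) : A.PosDef := by
  refine Matrix.PosDef.of_dotProduct_mulVec_pos hA fun x hx => ?_
  have h1 := enormR_pos hx
  exact lt_of_lt_of_le (by positivity) (h x)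

lemma Ker.cov_posDef {M K ζ : ℝ} {f : (Fin d → ℤ) → ℝ} (hf : Ker M K ζ f) : (cov f).PosDef :=
  posDef_of_lower (Ker.cov_isHermitian f) (by have := hf.K_pos; positivity) hf.cov_lower

/-! ### Asymptotics of the tilted Green function -/

lemma tendsto_const_mul_rpow_neg {T : ℕ → ℝ} (hT : Tendsto T atTop atTop) (C : ℝ) {a : ℝ}
    (ha : 0 < a) : Tendsto (fun n => C * T n ^ (-a)) atTop (𝓝 0) := by
  simpa using ((tendsto_rpow_neg_atTop ha).comp hT).const_mul C

lemma rpow_mul_le {q g c T ρ X C : ℝ} (hq : 0 ≤ q) (hg : 0 ≤ g) (hc : 0 < c) (hT : 0 < T) (hC : 0 ≤ C)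
    (hρ : c * T ≤ ρ) (hX : X ≤ C * ρ ^ (-(q + g))) :
    T ^ q * X ≤ C * c ^ (-(q + g)) * T ^ (-g) := by
  have h1 : ρ ^ (-(q + g)) ≤ (c * T) ^ (-(q + g)) :=
    Real.rpow_le_rpow_of_nonpos (by positivity) hρ (by linarith)
  rw [Real.mul_rpow hc.le hT.le] at h1
  have h2 : T ^ (-g) = T ^ q * T ^ (-(q + g)) := by
    rw [← Real.rpow_add hT]; congr 1; ring
  calc T ^ q * X ≤ T ^ q * (C * (c ^ (-(q + g)) * T ^ (-(q + g)))) := by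
        gcongr; exact hX.trans (by gcongr)
    _ = _ := by rw [h2]; ring

lemma integral_comp_add_mul {T : ℝ} (hT : 0 < T) (G : ℝ → ℂ) :
    ∫ t, G t = ((√T : ℝ) : ℂ) * ∫ s, G (T + √T * s) := by
  have hs : 0 < √T := Real.sqrt_pos.2 hT
  have h1 := Measure.integral_comp_mul_left (fun s => G (T + s)) (√T)
  rw [integral_add_left_eq_self (fun t => G t) T, abs_of_pos (inv_pos.2 hs), Complex.real_smul] at h1
  rw [h1, ← mul_assoc, ← Complex.ofReal_mul, mul_inv_cancel₀ hs.ne']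
  simp

section

variable {M K ζ e₀ B : ℝ} {f : ℕ → (Fin d → ℤ) → ℝ} {T : ℕ → ℝ} {z : ℕ → Fin d → ℤ}
  {η : Fin d → ℝ} {A : Matrix (Fin d) (Fin d) ℝ}

lemma middle_limit (he : 0 < e₀) (hf : ∀ n, Ker M K ζ (f n))
    (hη : ∀ n, e₀ ≤ enormR (mean (f n))) (hT : Tendsto T atTop atTop)
    (hz : ∀ n, enormR (toR (z n) - T n • mean (f n)) ≤ B)
    (hmean : Tendsto (fun n => mean (f n)) atTop (𝓝 η))
    (hcov : Tendsto (fun n => cov (f n)) atTop (𝓝 A)) {a b : ℕ → ℝ} {c₁ c₂ : ℝ} (hc₁ : 0 < c₁)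
    (ha : ∀ᶠ n in atTop, c₁ * T n ≤ a n) (ha2 : ∀ᶠ n in atTop, a n ≤ 3 / 4 * T n)
    (hb : ∀ᶠ n in atTop, b n ≤ c₂ * T n) (hb2 : ∀ᶠ n in atTop, 3 / 2 * T n ≤ b n) :
    Tendsto (fun n => ((T n ^ (((d : ℝ) - 1) / 2) : ℝ) : ℂ) *
      ∫ t in Set.Ioc (a n) (b n), heat (f n) t (z n)) atTop (𝓝 (∫ s : ℝ, gaussInt A (-(s • η)))) := by
  have hM := (hf 0).M_pos
  have hK := (hf 0).K_pos
  have hζ := (hf 0).zeta_pos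
  have hB : 0 ≤ B := (enormR_nonneg _).trans (hz 0)
  obtain ⟨C, t₁, hC, ht₁, hbd⟩ := exists_heat_diffusive d hM hK hζ
  have hpos : ∀ᶠ n in atTop, 0 < T n := hT.eventually_gt_atTop 0
  have hc₂ : 0 < c₂ := by
    obtain ⟨n, h1, h2, h3⟩ := (hpos.and (hb.and hb2)).exists
    by_contra h
    push Not at h
    nlinarith [mul_nonneg_of_nonpos_of_nonpos h (neg_nonpos.2 h1.le)]
  set e : ℝ := e₀ / √c₂ with hedef
  have hepos : 0 < e := by positivity
  set g : ℕ → ℝ → ℂ := fun n s => ((T n ^ ((d : ℝ) / 2) : ℝ) : ℂ) *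
    (Set.Ioc (a n) (b n)).indicator (fun t => heat (f n) t (z n)) (T n + √(T n) * s) with hg
  have hlim : Tendsto (fun n => ∫ s, g n s) atTop (𝓝 (∫ s : ℝ, gaussInt A (-(s • η)))) := by
    refine tendsto_integral_filter_of_dominated_convergence
      (fun s => C * c₁ ^ (-((d : ℝ) / 2)) * 2 ^ (1 + ζ / 2) * (1 + e * |s - 0|) ^ (-(1 + ζ / 2)))
      ?_ ?_ ((integrable_one_add_mul_abs hepos (by linarith) 0).const_mul _) ?_
    · refine Eventually.of_forall fun n => ?_
      have hc := continuous_heat (hf n).summ (z n)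
      exact (((hc.measurable.indicator measurableSet_Ioc).comp
        (by fun_prop)).const_mul _).aestronglyMeasurable
    · have h3 : ∀ᶠ n in atTop, t₁ / c₁ ≤ T n := hT.eventually_ge_atTop _
      have h4 : ∀ᶠ n in atTop, 4 * B ^ 2 / c₁ ≤ T n := hT.eventually_ge_atTop _
      filter_upwards [hpos, ha, hb, h3, h4] with n hn ha hb h3 h4
      refine Eventually.of_forall fun s => ?_
      simp only [hg, Set.indicator]
      split_ifs with hs
      · set t := T n + √(T n) * s with ht
        have hst : 0 < √(T n) := Real.sqrt_pos.2 hn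
        have ht1 : c₁ * T n ≤ t := ha.trans hs.1.le
        have ht0 : 0 < t := lt_of_lt_of_le (by positivity) ht1
        have ht2 : t ≤ c₂ * T n := hs.2.trans hb
        have hts : 0 < √t := Real.sqrt_pos.2 ht0
        have h5 : t₁ ≤ t := by
          rw [div_le_iff₀ hc₁, mul_comm] at h3; exact h3.trans ht1
        have h6 : B ≤ √t / 2 := by
          have : 2 * B ≤ √t := by
            refine Real.le_sqrt_of_sq_le ?_
            rw [div_le_iff₀ hc₁] at h4
            nlinarith
          linarith
        have h7 : e₀ * (√(T n) * |s|) - B ≤ enormR (toR (z n) - t • mean (f n)) := by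
          have h8 := le_enormR_sub ((√(T n) * s) • mean (f n)) (toR (z n) - T n • mean (f n))
          rw [← enormR_neg ((√(T n) * s) • mean (f n) - (toR (z n) - T n • mean (f n))), enormR_smul,
            abs_mul, abs_of_pos hst] at h8
          have h9 : -((√(T n) * s) • mean (f n) - (toR (z n) - T n • mean (f n))) =
              toR (z n) - t • mean (f n) := by rw [ht, add_smul]; abel
          rw [h9] at h8
          have h10 := mul_le_mul_of_nonneg_left (hη n) (by positivity : 0 ≤ √(T n) * |s|)
          have := hz n
          linarith
        have h8 : 1 / 2 * (1 + e * |s|) ≤ 1 + enormR (toR (z n) - t • mean (f n)) / √t := by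
          have h9 : e * |s| ≤ e₀ * (√(T n) * |s|) / √t := by
            have : √t ≤ √c₂ * √(T n) := by
              rw [← Real.sqrt_mul hc₂.le]; exact Real.sqrt_le_sqrt ht2
            rw [le_div_iff₀ hts, hedef]
            calc e₀ / √c₂ * |s| * √t ≤ e₀ / √c₂ * |s| * (√c₂ * √(T n)) := by gcongr
              _ = _ := by have : 0 < √c₂ := Real.sqrt_pos.2 hc₂
                          field_simp
          have h10 : B / √t ≤ 1 / 2 := by rw [div_le_iff₀ hts]; linarith
          have h11 := div_le_div_of_nonneg_right h7 hts.le
          rw [sub_div] at h11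
          have h12 : 0 ≤ e * |s| := by positivity
          linarith
        have h9 : (1 + enormR (toR (z n) - t • mean (f n)) / √t) ^ (-(1 + ζ / 2)) ≤
            2 ^ (1 + ζ / 2) * (1 + e * |s|) ^ (-(1 + ζ / 2)) := by
          refine (Real.rpow_le_rpow_of_nonpos (by positivity) h8 (by linarith)).trans (le_of_eq ?_)
          rw [Real.mul_rpow (by norm_num) (by positivity), one_div, Real.inv_rpow (by norm_num),
            Real.rpow_neg (by norm_num), inv_inv]
        have h10 : t ^ (-((d : ℝ) / 2)) ≤ c₁ ^ (-((d : ℝ) / 2)) * T n ^ (-((d : ℝ) / 2)) := by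
          rw [← Real.mul_rpow hc₁.le hn.le]
          exact Real.rpow_le_rpow_of_nonpos (by positivity) ht1 (by
            have : (0 : ℝ) ≤ d := by positivity
            linarith)
        have h11 : T n ^ ((d : ℝ) / 2) * T n ^ (-((d : ℝ) / 2)) = 1 := by
          rw [← Real.rpow_add hn]; simp
        rw [norm_mul, Complex.norm_real, Real.norm_eq_abs, abs_of_pos (by positivity), sub_zero]
        have h12 : 0 ≤ 1 + enormR (toR (z n) - t • mean (f n)) / √t := le_trans (by positivity) h8
        calc _ ≤ T n ^ ((d : ℝ) / 2) * (C * (c₁ ^ (-((d : ℝ) / 2)) * T n ^ (-((d : ℝ) / 2))) *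
              (2 ^ (1 + ζ / 2) * (1 + e * |s|) ^ (-(1 + ζ / 2)))) := by
              refine mul_le_mul_of_nonneg_left ((hbd (f n) (hf n) t h5 (z n)).trans ?_) (by positivity)
              refine mul_le_mul (mul_le_mul_of_nonneg_left h10 hC.le) h9 (by positivity) (by positivity)
          _ = (T n ^ ((d : ℝ) / 2) * T n ^ (-((d : ℝ) / 2))) * (C * c₁ ^ (-((d : ℝ) / 2)) *
              2 ^ (1 + ζ / 2) * (1 + e * |s|) ^ (-(1 + ζ / 2))) := by ring
          _ = _ := by rw [h11, one_mul]
      · simp only [mul_zero, norm_zero]; positivity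
    · refine Eventually.of_forall fun s => ?_
      set t : ℕ → ℝ := fun n => T n + √(T n) * s with ht
      have hsT : Tendsto (fun n => √(T n)) atTop atTop := Real.tendsto_sqrt_atTop.comp hT
      have hratio : Tendsto (fun n => t n / T n) atTop (𝓝 1) := by
        have h1 : Tendsto (fun n => 1 + (√(T n))⁻¹ * s) atTop (𝓝 (1 + 0 * s)) :=
          (hsT.inv_tendsto_atTop.mul_const s).const_add 1
        rw [zero_mul, add_zero] at h1
        refine h1.congr' ?_
        filter_upwards [hpos] with n hn
        have hst : 0 < √(T n) := Real.sqrt_pos.2 hn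
        have : T n = √(T n) * √(T n) := (Real.mul_self_sqrt hn.le).symm
        rw [ht]; simp only
        rw [add_div, div_self hn.ne']
        congr 1
        rw [eq_div_iff hn.ne', inv_mul_eq_div, div_mul_eq_mul_div, div_eq_iff hst.ne']
        linear_combination s * this
      have htt : Tendsto t atTop atTop := by
        have : Tendsto (fun n => (t n / T n) * T n) atTop atTop := hratio.pos_mul_atTop one_pos hT
        refine this.congr' ?_
        filter_upwards [hpos] with n hn
        field_simp
      have htpos : ∀ᶠ n in atTop, 0 < t n := htt.eventually_gt_atTop 0
      have hin : ∀ᶠ n in atTop, t n ∈ Set.Ioc (a n) (b n) := by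
        filter_upwards [hpos, ha2, hb2, hratio.eventually (lt_mem_nhds (show (3 / 4 : ℝ) < 1 by norm_num)),
          hratio.eventually (gt_mem_nhds (show (1 : ℝ) < 3 / 2 by norm_num))] with n hn h1 h2 h3 h4
        rw [lt_div_iff₀ hn] at h3
        rw [div_lt_iff₀ hn] at h4
        exact ⟨by linarith, by linarith⟩
      have hv : Tendsto (fun n => (√(t n))⁻¹ • (toR (z n) - t n • mean (f n))) atTop
          (𝓝 (-(s • η))) := by
        have h1 : Tendsto (fun n => (√(t n))⁻¹ • (toR (z n) - T n • mean (f n))) atTop (𝓝 0) := by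
          rw [tendsto_pi_nhds]
          intro i
          have h2 : Tendsto (fun n => (√(t n))⁻¹ * B) atTop (𝓝 0) := by
            simpa using ((Real.tendsto_sqrt_atTop.comp htt).inv_tendsto_atTop).mul_const B
          refine squeeze_zero_norm (fun n => ?_) h2
          rw [Pi.smul_apply, smul_eq_mul, norm_mul, Real.norm_eq_abs, Real.norm_eq_abs,
            abs_of_nonneg (by positivity)]
          exact mul_le_mul_of_nonneg_left ((abs_apply_le_enormR _ i).trans (hz n)) (by positivity)
        have h3 : Tendsto (fun n => √(T n) * (√(t n))⁻¹) atTop (𝓝 1) := by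
          have h4 := (Real.continuous_sqrt.tendsto _).comp (hratio.inv₀ one_ne_zero)
          rw [inv_one, Real.sqrt_one] at h4
          refine h4.congr' ?_
          filter_upwards [hpos, htpos] with n hn hn2
          simp only [Function.comp_apply, inv_div]
          rw [Real.sqrt_div hn.le, div_eq_mul_inv]
        have h5 := h1.sub ((h3.mul_const s).smul hmean)
        rw [one_mul, zero_sub] at h5
        refine h5.congr fun n => ?_
        rw [ht]; simp only
        rw [add_smul, ← sub_sub, smul_sub _ _ ((√(T n) * s) • mean (f n)), smul_smul]
        congr 2; ring
      have h6 := heat_local_clt hf htt hv hcov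
      have h7 : Tendsto (fun n => (((T n / t n) ^ ((d : ℝ) / 2) : ℝ) : ℂ)) atTop (𝓝 1) := by
        have h8 : Tendsto (fun n => (T n / t n) ^ ((d : ℝ) / 2)) atTop (𝓝 1) := by
          have h9 := (hratio.inv₀ one_ne_zero).rpow_const (p := (d : ℝ) / 2) (Or.inl (by norm_num))
          simpa [inv_div] using h9
        have h9 := (Complex.continuous_ofReal.tendsto _).comp h8
        rw [Complex.ofReal_one] at h9
        exact h9
      have h8 := h7.mul h6
      rw [one_mul] at h8
      refine h8.congr' ?_
      filter_upwards [hin, hpos, htpos] with n h1 h2 h3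
      simp only [hg]
      rw [Set.indicator_of_mem h1, ← mul_assoc, ← Complex.ofReal_mul, Real.div_rpow h2.le h3.le,
        div_mul_cancel₀]
      exact (Real.rpow_pos_of_pos h3 _).ne'
  refine hlim.congr' ?_
  filter_upwards [hpos] with n hn
  simp only [hg]
  rw [integral_const_mul, ← integral_indicator measurableSet_Ioc, integral_comp_add_mul hn
    ((Set.Ioc (a n) (b n)).indicator fun t => heat (f n) t (z n)),
    ← mul_assoc, ← Complex.ofReal_mul]
  congr 2
  rw [Real.sqrt_eq_rpow, ← Real.rpow_add hn]
  congr 1; ring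

lemma green_limit (hd : 1 ≤ d) (he : 0 < e₀) (hf : ∀ n, Ker M K ζ (f n))
    (hη : ∀ n, e₀ ≤ enormR (mean (f n))) (hT : Tendsto T atTop atTop)
    (hz : ∀ n, enormR (toR (z n) - T n • mean (f n)) ≤ B)
    (hmean : Tendsto (fun n => mean (f n)) atTop (𝓝 η))
    (hcov : Tendsto (fun n => cov (f n)) atTop (𝓝 A)) :
    Tendsto (fun n => ((T n ^ (((d : ℝ) - 1) / 2) : ℝ) : ℂ) *
      ∫ t in Set.Ioi (0 : ℝ), heat (f n) t (z n)) atTop (𝓝 (∫ s : ℝ, gaussInt A (-(s • η)))) := by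
  have hM := (hf 0).M_pos
  have hK := (hf 0).K_pos
  have hζ := (hf 0).zeta_pos
  have hd1 : (1 : ℝ) ≤ d := by exact_mod_cast hd
  obtain ⟨C₁, R₁, hC₁, hR₁, h₁⟩ := exists_heat_head d hd hM hK hζ
  obtain ⟨C₃, t₁, hC₃, ht₁, h₃⟩ := exists_heat_tail d hd hM hK hζ he
  have hpos : ∀ᶠ n in atTop, 0 < T n := hT.eventually_gt_atTop 0
  have hlow : ∀ n, T n * enormR (mean (f n)) - B ≤ enormZ (z n) := by
    intro n
    have h1 := enormR_sub_le (toR (z n)) (toR (z n) - T n • mean (f n))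
    rw [sub_sub_cancel, enormR_smul, ← enormZ_eq] at h1
    have h2 := mul_le_mul_of_nonneg_right (le_abs_self (T n)) (enormR_nonneg (mean (f n)))
    linarith [hz n]
  have hup : ∀ᶠ n in atTop, enormZ (z n) ≤ M * T n + B := by
    filter_upwards [hpos] with n hn
    have h1 := le_enormR_sub (toR (z n)) (T n • mean (f n))
    rw [enormR_smul, ← enormZ_eq, abs_of_pos hn] at h1
    have h2 := mul_le_mul_of_nonneg_left (hf n).enormR_mean_le hn.le
    linarith [hz n]
  have hlow' : ∀ᶠ n in atTop, e₀ * T n - B ≤ enormZ (z n) := by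
    filter_upwards [hpos] with n hn
    have h2 := mul_le_mul_of_nonneg_left (hη n) hn.le
    linarith [hlow n]
  have hBe : ∀ᶠ n in atTop, 4 * B / e₀ ≤ T n := hT.eventually_ge_atTop _
  have hBM : ∀ᶠ n in atTop, 2 * B / M ≤ T n := hT.eventually_ge_atTop _
  have hlow2 : ∀ᶠ n in atTop, e₀ / 2 * T n ≤ enormZ (z n) := by
    filter_upwards [hlow', hBe] with n h1 h2
    rw [div_le_iff₀ he] at h2
    have hB : 0 ≤ B := (enormR_nonneg _).trans (hz n)
    linarith
  have hmid := middle_limit he hf hη hT hz hmean hcov (a := fun n => enormZ (z n) / (2 * M))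
    (b := fun n => 2 / e₀ * enormZ (z n)) (c₁ := e₀ / (4 * M)) (c₂ := 4 * M / e₀) (by positivity)
    (by
      filter_upwards [hlow2] with n h1
      rw [le_div_iff₀ (by positivity)]
      calc e₀ / (4 * M) * T n * (2 * M) = e₀ / 2 * T n := by field_simp; ring
        _ ≤ _ := h1)
    (by
      filter_upwards [hup, hBM] with n h1 h2
      rw [div_le_iff₀ hM] at h2
      rw [div_le_iff₀ (by positivity)]
      linarith)
    (by
      filter_upwards [hup, hBM] with n h1 h2
      rw [div_le_iff₀ hM] at h2
      have hB : 0 ≤ B := (enormR_nonneg _).trans (hz n)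
      have : enormZ (z n) ≤ 2 * M * T n := by linarith
      calc 2 / e₀ * enormZ (z n) ≤ 2 / e₀ * (2 * M * T n) := by gcongr
        _ = _ := by ring)
    (by
      filter_upwards [hlow', hBe] with n h1 h2
      rw [div_le_iff₀ he] at h2
      rw [div_mul_eq_mul_div 2, le_div_iff₀ he]
      linarith)
  set q := ((d : ℝ) - 1) / 2 with hq
  have hq0 : 0 ≤ q := by rw [hq]; linarith
  have hgain := gain_pos d hζ
  have hzinf : Tendsto (fun n => enormZ (z n)) atTop atTop :=
    tendsto_atTop_mono' _ hlow2 (hT.const_mul_atTop (by positivity))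
  have hhead : Tendsto (fun n => ((T n ^ q : ℝ) : ℂ) *
      ∫ t in Set.Ioc 0 (enormZ (z n) / (2 * M)), heat (f n) t (z n)) atTop (𝓝 0) := by
    refine squeeze_zero_norm' ?_
      (tendsto_const_mul_rpow_neg hT (C₁ * (e₀ / 2) ^ (-(q + gain d ζ))) hgain)
    filter_upwards [hpos, hlow2, hzinf.eventually_ge_atTop R₁] with n hn h1 h2
    rw [norm_mul, Complex.norm_real, Real.norm_eq_abs, abs_of_pos (by positivity)]
    exact rpow_mul_le hq0 hgain.le (by positivity) hn hC₁.le h1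
      ((norm_integral_le_integral_norm _).trans (h₁ (f n) (hf n) (z n) h2))
  have htail : Tendsto (fun n => ((T n ^ q : ℝ) : ℂ) *
      ∫ t in Set.Ioi (2 / e₀ * enormZ (z n)), heat (f n) t (z n)) atTop (𝓝 0) := by
    refine squeeze_zero_norm' ?_ (tendsto_const_mul_rpow_neg hT (C₃ * 1 ^ (-(q + ζ / 4)))
      (a := ζ / 4) (by positivity))
    filter_upwards [hpos, hlow2, (hzinf.const_mul_atTop (show 0 < 2 / e₀ by positivity)).eventually_ge_atTop t₁]
      with n hn h1 h2
    rw [norm_mul, Complex.norm_real, Real.norm_eq_abs, abs_of_pos (by positivity)]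
    refine rpow_mul_le hq0 (by positivity) one_pos hn hC₃.le ?_
      ((norm_integral_le_integral_norm _).trans (h₃ (f n) (hf n) (hη n) (z n) _ h2 le_rfl).2)
    rw [one_mul, div_mul_eq_mul_div, le_div_iff₀ he]
    linarith
  have hsum := (hhead.add hmid).add htail
  rw [zero_add, add_zero] at hsum
  refine hsum.congr' ?_
  filter_upwards [hzinf.eventually_ge_atTop 0,
    (hzinf.const_mul_atTop (show 0 < 2 / e₀ by positivity)).eventually_ge_atTop t₁] with n h0 h2
  have hcont := continuous_heat (hf n).summ (z n)
  have hI := (h₃ (f n) (hf n) (hη n) (z n) _ h2 le_rfl).1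
  have hab : enormZ (z n) / (2 * M) ≤ 2 / e₀ * enormZ (z n) := by
    have h5 : e₀ ≤ M := (hη n).trans (hf n).enormR_mean_le
    have h6 : 1 / (2 * M) ≤ 2 / e₀ := by
      rw [div_le_div_iff₀ (by positivity) he]; linarith
    calc enormZ (z n) / (2 * M) = 1 / (2 * M) * enormZ (z n) := by ring
      _ ≤ _ := by gcongr
  rw [← mul_add, ← mul_add, ← setIntegral_union (Set.Ioc_disjoint_Ioc_of_le le_rfl) measurableSet_Ioc
    hcont.integrableOn_Ioc hcont.integrableOn_Ioc, Set.Ioc_union_Ioc_eq_Ioc (by positivity) hab,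
    ← setIntegral_union (Set.Ioc_disjoint_Ioi le_rfl) measurableSet_Ioi hcont.integrableOn_Ioc hI,
    Set.Ioc_union_Ioi_eq_Ioi (by positivity)]

end

/-! ### The domain of finite tilted susceptibility -/

lemma summable_of_lpNorm_le {f : (Fin d → ℤ) → ℝ} {p M : ℝ} (hp : 0 < p) (hM : 0 ≤ M)
    (h : lpNorm f p ≤ ENNReal.ofReal M) :
    (Summable fun y => |f y| ^ p) ∧ ∑' y, |f y| ^ p ≤ M ^ p := by
  rw [lpNorm, one_div, ENNReal.rpow_inv_le_iff hp, ENNReal.ofReal_rpow_of_nonneg hM hp.le] at h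
  have h0 : ∀ y, 0 ≤ |f y| ^ p := fun y => by positivity
  have hs : Summable fun y => |f y| ^ p := by
    have := ENNReal.summable_toReal (h.trans_lt ENNReal.ofReal_lt_top).ne
    simpa [ENNReal.toReal_ofReal, h0] using this
  refine ⟨hs, ?_⟩
  rw [← ENNReal.ofReal_tsum_of_nonneg h0 hs] at h
  exact (ENNReal.ofReal_le_ofReal_iff (by positivity)).1 h

lemma mem_Omega_iff {S : (Fin d → ℤ) → ℝ} (hS : ∀ x, 0 ≤ S x) {μ : Fin d → ℝ} :
    μ ∈ Omega S ↔ Summable (tilt S μ) := by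
  have h0 : ∀ x, 0 ≤ S x * Real.exp (rdotZ μ x) := fun x => mul_nonneg (hS x) (Real.exp_pos _).le
  constructor
  · intro h
    have := ENNReal.summable_toReal (show chi S μ < ⊤ from h).ne
    simp only [ENNReal.toReal_ofReal (h0 _)] at this
    exact this
  · intro h
    exact (Summable.tsum_ofReal_ne_top h).lt_top

lemma tilt_nonneg {S : (Fin d → ℤ) → ℝ} (hS : ∀ x, 0 ≤ S x) (μ : Fin d → ℝ) (x : Fin d → ℤ) :
    0 ≤ tilt S μ x := mul_nonneg (hS x) (Real.exp_pos _).le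

lemma exp_combo_le (μ ν : Fin d → ℝ) {a b : ℝ} (ha : 0 ≤ a) (hb : 0 ≤ b) (hab : a + b = 1)
    (y : Fin d → ℤ) :
    Real.exp (rdotZ (a • μ + b • ν) y) ≤ a * Real.exp (rdotZ μ y) + b * Real.exp (rdotZ ν y) := by
  rw [rdotZ_add_left, rdotZ_smul_left, rdotZ_smul_left]
  exact convexOn_exp.2 (Set.mem_univ _) (Set.mem_univ _) ha hb hab

lemma convex_Omega {S : (Fin d → ℤ) → ℝ} (hS : ∀ x, 0 ≤ S x) : Convex ℝ (Omega S) := by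
  intro μ hμ ν hν a b ha hb hab
  rw [mem_Omega_iff hS] at *
  refine Summable.of_nonneg_of_le (fun y => tilt_nonneg hS _ y) (fun y => ?_)
    ((hμ.mul_left a).add (hν.mul_left b))
  calc tilt S (a • μ + b • ν) y ≤ S y * (a * Real.exp (rdotZ μ y) + b * Real.exp (rdotZ ν y)) :=
        mul_le_mul_of_nonneg_left (exp_combo_le μ ν ha hb hab y) (hS y)
    _ = _ := by simp only [tilt]; ring

lemma flip_mem_Omega {S : (Fin d → ℤ) → ℝ} (hS : ZdSymmetric S) (ε : Fin d → Bool) {μ : Fin d → ℝ}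
    (hμ : μ ∈ Omega S) : (fun i => if ε i then -(μ i) else μ i) ∈ Omega S := by
  let e : (Fin d → ℤ) ≃ (Fin d → ℤ) :=
    { toFun := fun x i => if ε i then -(x i) else x i
      invFun := fun x i => if ε i then -(x i) else x i
      left_inv := fun x => by ext i; by_cases h : ε i <;> simp [h]
      right_inv := fun x => by ext i; by_cases h : ε i <;> simp [h] }
  have : chi S (fun i => if ε i then -(μ i) else μ i) = chi S μ := by
    rw [chi, chi, ← e.tsum_eq]
    refine tsum_congr fun x => ?_
    rw [show S (e x) = S x from hS.2 ε x]
    congr 3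
    refine Finset.sum_congr rfl fun i _ => ?_
    by_cases h : ε i <;> simp [e, h]
  rw [Omega, Set.mem_ofPred_eq, this]
  exact hμ

lemma perm_mem_Omega {S : (Fin d → ℤ) → ℝ} (hS : ZdSymmetric S) (σ : Equiv.Perm (Fin d))
    {μ : Fin d → ℝ} (hμ : μ ∈ Omega S) : (fun i => μ (σ i)) ∈ Omega S := by
  have : chi S (fun i => μ (σ i)) = chi S μ := by
    rw [chi, chi, ← (Equiv.arrowCongr σ.symm (Equiv.refl ℤ)).tsum_eq]
    refine tsum_congr fun x => ?_
    have h1 : (Equiv.arrowCongr σ.symm (Equiv.refl ℤ)) x = fun i => x (σ i) := by ext i; simp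
    rw [h1, hS.1 σ x]
    congr 3
    exact Equiv.sum_comp σ fun i => μ i * (x i : ℝ)
  rw [Omega, Set.mem_ofPred_eq, this]
  exact hμ

lemma abs_apply_lt_of_mem_Omega {S : (Fin d → ℤ) → ℝ} (h : AssumptionOmega S) {μ₁ : ℝ}
    (hμ₁ : 0 < μ₁) (hnot : e1R d μ₁ ∉ Omega S) {μ : Fin d → ℝ} (hμ : μ ∈ Omega S) (i : Fin d) :
    |μ i| < μ₁ := by
  have hconv := convex_Omega h.nonneg
  have h1 : Pi.single i (μ i) ∈ Omega S := by
    have h2 := hconv hμ (flip_mem_Omega h.symm (fun j => decide (j ≠ i)) hμ)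
      (show (0 : ℝ) ≤ 1 / 2 by norm_num) (show (0 : ℝ) ≤ 1 / 2 by norm_num) (by norm_num)
    convert h2 using 1
    ext j
    by_cases hj : j = i
    · subst hj; simp; ring
    · simp [hj]
  have h2 : Pi.single i |μ i| ∈ Omega S := by
    rcases abs_cases (μ i) with h3 | h3
    · rw [h3.1]; exact h1
    · convert flip_mem_Omega h.symm (fun _ => true) h1 using 1
      ext j
      by_cases hj : j = i
      · subst hj; simp [h3.1]
      · simp [hj]
  have hd : 0 < d := i.pos
  have h3 : e1R d |μ i| ∈ Omega S := by
    convert perm_mem_Omega h.symm (Equiv.swap (⟨0, hd⟩ : Fin d) i) h2 using 1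
    ext j
    rw [e1R, Pi.single_apply]
    have : (Equiv.swap (⟨0, hd⟩ : Fin d) i j = i) ↔ ((j : ℕ) = 0) := by
      rw [Equiv.swap_apply_eq_iff, Equiv.swap_apply_right, Fin.ext_iff]
    simp only [this]
  by_contra hlt
  push Not at hlt
  refine hnot ?_
  have hpos : 0 < |μ i| := hμ₁.trans_le hlt
  have h4 := hconv h3 h.zero_mem (show 0 ≤ μ₁ / |μ i| by positivity)
    (show 0 ≤ 1 - μ₁ / |μ i| by rw [sub_nonneg, div_le_one hpos]; exact hlt) (by ring)
  convert h4 using 1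
  ext j
  simp only [e1R, smul_zero, add_zero, Pi.smul_apply, smul_eq_mul]
  split_ifs
  · field_simp
  · simp

lemma isCompact_closure_Omega {S : (Fin d → ℤ) → ℝ} (h : AssumptionOmega S) :
    IsCompact (closure (Omega S)) := by
  obtain ⟨μ₁, hμ₁, hnot⟩ := h.exists_not_mem
  refine Bornology.IsBounded.isCompact_closure ?_
  refine (Metric.isBounded_closedBall (x := (0 : Fin d → ℝ)) (r := μ₁)).subset fun μ hμ => ?_
  rw [mem_closedBall_zero_iff, pi_norm_le_iff_of_nonneg hμ₁.le]
  exact fun i => (abs_apply_lt_of_mem_Omega h hμ₁ hnot hμ i).le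

lemma mass_pos (hd : 1 ≤ d) {S : (Fin d → ℤ) → ℝ} (h : AssumptionOmega S) : 0 < mass S := by
  obtain ⟨μ₁, hμ₁, hnot⟩ := h.exists_not_mem
  have hcont : Continuous fun t : ℝ => e1R d t := by
    refine continuous_pi fun i => ?_
    by_cases hi : (i : ℕ) = 0
    · simp only [e1R, hi, if_true]; exact continuous_id
    · simp only [e1R, hi, if_false]; exact continuous_const
  have h0 : e1R d 0 = 0 := by ext i; simp [e1R]
  have h1 : ∀ᶠ t in 𝓝 (0 : ℝ), e1R d t ∈ Omega S :=
    hcont.continuousAt.eventually (by simp only [h0]; exact h.open_Omega.mem_nhds h.zero_mem)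
  obtain ⟨r, hr, hball⟩ := Metric.eventually_nhds_iff.1 h1
  refine lt_csSup_of_lt ⟨μ₁, ?_⟩ (a := r / 2) ⟨by positivity, hball ?_⟩ (by positivity)
  · rintro t ⟨_, ht2⟩
    have := abs_apply_lt_of_mem_Omega h hμ₁ hnot (μ := e1R d t) ht2 ⟨0, hd⟩
    simp only [e1R, if_true] at this
    exact (le_abs_self t).trans this.le
  · rw [Real.dist_eq, sub_zero, abs_of_pos (by positivity)]; linarith

lemma mass_mul_normS (hd : 1 ≤ d) {S : (Fin d → ℤ) → ℝ} (h : AssumptionOmega S) {x μ : Fin d → ℝ}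
    (hμ : IsOptTilt S x μ) : mass S * normS S x = rdot μ x := by
  rw [normS, mul_div_cancel₀ _ (mass_pos hd h).ne']
  refine IsGreatest.csSup_eq ⟨⟨μ, frontier_subset_closure hμ.1, rfl⟩, ?_⟩
  rintro _ ⟨ν, hν, rfl⟩
  exact hμ.2 ν hν

lemma Omega_mem_nhds {S : (Fin d → ℤ) → ℝ} (h : AssumptionOmega S) : Omega S ∈ 𝓝 0 :=
  h.open_Omega.mem_nhds h.zero_mem

/-! ### Tilted kernels -/

lemma rpow_le_of_le_rpow {a M p : ℝ} (ha : 0 ≤ a) (hM : 0 ≤ M) (hp : 0 < p) (h : a ^ p ≤ M ^ p) :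
    a ≤ M := (Real.rpow_le_rpow_iff ha hM hp).1 h

lemma MemQ.Q_summable {M K ζ : ℝ} {Q g : (Fin d → ℤ) → ℝ} (hM : 0 ≤ M) (h : MemQ M K ζ Q g) :
    (Summable fun y => |Q y|) ∧ ∑' y, |Q y| ≤ M := by
  simpa using summable_of_lpNorm_le one_pos hM h.Q_l1

lemma MemQ.g_summable {M K ζ : ℝ} {Q g : (Fin d → ℤ) → ℝ} (hM : 0 ≤ M) (h : MemQ M K ζ Q g) :
    (Summable fun y => |g y|) ∧ ∑' y, |g y| ≤ M := by
  simpa using summable_of_lpNorm_le one_pos hM h.g_l1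

lemma MemQ.Q_moment_summable {M K ζ : ℝ} {Q g : (Fin d → ℤ) → ℝ} (hM : 0 ≤ M)
    (h : MemQ M K ζ Q g) : (Summable fun y => enormZ y ^ (2 + ζ) * |Q y|) ∧
      ∑' y, enormZ y ^ (2 + ζ) * |Q y| ≤ M := by
  have := summable_of_lpNorm_le one_pos hM h.Q_moment
  simp only [Real.rpow_one, abs_mul, abs_of_nonneg (Real.rpow_nonneg (enormZ_nonneg _) _)] at this
  exact this

lemma MemQ.g_moment_summable {M K ζ : ℝ} {Q g : (Fin d → ℤ) → ℝ} (hM : 0 ≤ M)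
    (h : MemQ M K ζ Q g) : (Summable fun y => enormZ y ^ ζ * |g y|) ∧
      ∑' y, enormZ y ^ ζ * |g y| ≤ M := by
  have := summable_of_lpNorm_le one_pos hM h.g_zeta
  simp only [Real.rpow_one, abs_mul, abs_of_nonneg (Real.rpow_nonneg (enormZ_nonneg _) _)] at this
  exact this

lemma moment_mono {f : (Fin d → ℤ) → ℝ} {a b M : ℝ} (ha : 0 < a) (hab : a ≤ b)
    (h : (Summable fun y => enormZ y ^ b * |f y|) ∧ ∑' y, enormZ y ^ b * |f y| ≤ M) :
    (Summable fun y => enormZ y ^ a * |f y|) ∧ ∑' y, enormZ y ^ a * |f y| ≤ M := by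
  have hle : ∀ y, enormZ y ^ a * |f y| ≤ enormZ y ^ b * |f y| := fun y =>
    mul_le_mul_of_nonneg_right (enormZ_rpow_le_rpow y ha hab) (abs_nonneg _)
  have hs : Summable fun y => enormZ y ^ a * |f y| :=
    Summable.of_nonneg_of_le (fun y => mul_nonneg (Real.rpow_nonneg (enormZ_nonneg _) _) (abs_nonneg _))
      hle h.1
  exact ⟨hs, (hs.tsum_le_tsum hle h.1).trans h.2⟩

/-- Adding a point mass at the origin to a kernel, so that its total mass becomes one. -/
def normalizeKer (Q : (Fin d → ℤ) → ℝ) : (Fin d → ℤ) → ℝ :=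
  fun y => Q y + if y = 0 then 1 - ∑' x, Q x else 0

lemma tsum_ite_zero (c : ℝ) : ∑' y : Fin d → ℤ, (if y = 0 then c else 0) = c := by
  rw [tsum_eq_single 0 (fun y hy => by simp [hy])]; simp

lemma summable_ite_zero (c : ℝ) : Summable fun y : Fin d → ℤ => if y = 0 then c else 0 :=
  summable_of_ne_finset_zero (s := {0}) fun y hy => by simp_all

lemma MemQ.ker {M K ζ : ℝ} {Q g : (Fin d → ℤ) → ℝ} (hM : 0 < M) (hK : 0 < K) (hζ : 0 < ζ)
    (h : MemQ M K ζ Q g) : Ker (2 * M + 1) K (min ζ 1) (normalizeKer Q) := by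
  obtain ⟨hs, hl⟩ := h.Q_summable hM.le
  have hζ' : 0 < min ζ 1 := lt_min hζ one_pos
  obtain ⟨hs2, hl2⟩ := moment_mono (by positivity) (show 2 + min ζ 1 ≤ 2 + ζ by
    have := min_le_left ζ 1; linarith) (h.Q_moment_summable hM.le)
  set c := 1 - ∑' x, Q x with hc
  have hcabs : |c| ≤ 1 + M := by
    have h1 := norm_tsum_le_tsum_norm (f := Q) hs
    have h2 : |∑' x, Q x| ≤ M := le_trans h1 hl
    calc |c| ≤ |1| + |∑' x, Q x| := abs_sub _ _
      _ ≤ _ := by rw [abs_one]; linarith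
  have hab : ∀ y, |normalizeKer Q y| ≤ |Q y| + if y = 0 then |c| else 0 := fun y => by
    rw [normalizeKer]
    refine (abs_add_le _ _).trans (add_le_add_right (le_of_eq ?_) _)
    split_ifs <;> simp [hc]
  have hsum : Summable fun y => |normalizeKer Q y| :=
    Summable.of_nonneg_of_le (fun _ => abs_nonneg _) hab (hs.add (summable_ite_zero _))
  have hmeq : ∀ a : ℝ, 0 < a → ∀ y, enormZ y ^ a * |normalizeKer Q y| = enormZ y ^ a * |Q y| := by
    intro a ha y
    by_cases hy : y = 0
    · simp [hy, enormZ_zero, Real.zero_rpow ha.ne']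
    · simp [normalizeKer, hy]
  have hone : ∑' y, normalizeKer Q y = 1 := by
    simp only [normalizeKer]
    rw [hs.of_abs.tsum_add (summable_ite_zero _), tsum_ite_zero]; ring
  refine ⟨hK, hζ', min_le_right _ _, hsum, ?_, ?_, ?_, hone, ?_, ?_⟩
  · refine (hsum.tsum_le_tsum hab (hs.add (summable_ite_zero _))).trans ?_
    rw [hs.tsum_add (summable_ite_zero _), tsum_ite_zero]
    linarith
  · simpa only [hmeq _ (show 0 < 2 + min ζ 1 by positivity)] using hs2
  · simp only [hmeq _ (show 0 < 2 + min ζ 1 by positivity)]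
    linarith
  · intro k hk
    have h1 := h.infrared k fun i => abs_le.2 (hk i (Set.mem_univ i))
    have hcos : Summable fun y => Q y * Real.cos (rdotZ k y) := by
      refine Summable.of_norm_bounded hs fun y => ?_
      rw [norm_mul]
      exact mul_le_of_le_one_right (norm_nonneg _) (Real.abs_cos_le_one _)
    have h2 : (fourierZ (normalizeKer Q) k).re = (fourierZ Q k).re + c := by
      rw [fourierZ_re hsum, fourierZ_re hs]
      have : ∀ y, normalizeKer Q y * Real.cos (rdotZ k y) =
          Q y * Real.cos (rdotZ k y) + if y = 0 then c else 0 := by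
        intro y
        by_cases hy : y = 0
        · simp [normalizeKer, hy, rdotZ_zero_right, hc]
        · simp [normalizeKer, hy]
      simp only [this]
      rw [hcos.tsum_add (summable_ite_zero _), tsum_ite_zero]
    rw [h2, hc]
    rw [Complex.sub_re, fourierZ_zero, Complex.ofReal_re] at h1
    linarith
  · intro hd y
    have hd' : (4 : ℝ) ≤ d := by exact_mod_cast hd
    have hp : 0 < min ((d : ℝ) / 3) 2 := lt_min (by positivity) two_pos
    obtain ⟨h1, h2⟩ := summable_of_lpNorm_le hp hM.le (h.Q_dm1 hd)
    rw [hmeq _ (by linarith)]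
    have h3 := (h1.le_tsum y fun _ _ => by positivity).trans h2
    have h4 := rpow_le_of_le_rpow (abs_nonneg _) hM.le hp h3
    rw [abs_mul, abs_of_nonneg (Real.rpow_nonneg (enormZ_nonneg _) _)] at h4
    linarith

lemma normalizeKer_eq {Q : (Fin d → ℤ) → ℝ} (h : ∑' y, Q y = 1) : normalizeKer Q = Q := by
  ext y; simp [normalizeKer, h]

/-! ### Continuity of tilted moments -/

lemma continuousOn_tiltSum {c : (Fin d → ℤ) → ℝ} {D : Set (Fin d → ℝ)} {a M : ℝ} (ha : 0 < a)
    (h : ∀ μ ∈ D, (Summable fun y => enormZ y ^ a * |tilt c μ y|) ∧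
      ∑' y, enormZ y ^ a * |tilt c μ y| ≤ M) : ContinuousOn (tiltSum c) D := by
  have hsum : ∀ μ ∈ D, Summable fun y => tilt c μ y := by
    intro μ hμ
    refine Summable.of_norm_bounded_eventually (h μ hμ).1 ?_
    refine (Set.finite_singleton (0 : Fin d → ℤ)).subset fun y hy => ?_
    by_contra h0
    refine hy (show ‖tilt c μ y‖ ≤ enormZ y ^ a * |tilt c μ y| from ?_)
    rw [Real.norm_eq_abs]
    exact le_mul_of_one_le_left (abs_nonneg _) (Real.one_le_rpow (one_le_enormZ h0) ha.le)
  let F : ℕ → (Fin d → ℝ) → ℝ := fun n μ =>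
    ∑ y ∈ (finite_enormZ_le (d := d) n).toFinset, tilt c μ y
  have hbound : ∀ n : ℕ, 1 ≤ n → ∀ μ ∈ D, |tiltSum c μ - F n μ| ≤ M * (n : ℝ) ^ (-a) := by
    intro n hn μ hμ
    have hnpos : (0 : ℝ) < n := by exact_mod_cast hn
    have h1 := (hsum μ hμ).sum_add_tsum_subtype_compl (finite_enormZ_le (d := d) n).toFinset
    have h2 : tiltSum c μ - F n μ =
        ∑' y : {y // y ∉ (finite_enormZ_le (d := d) n).toFinset}, tilt c μ y := by
      rw [sub_eq_iff_eq_add', tiltSum]; exact h1.symm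
    rw [h2, ← Real.norm_eq_abs]
    have h3 := ((h μ hμ).1.mul_right ((n : ℝ) ^ (-a)))
    have h4 := h3.subtype {y | y ∉ (finite_enormZ_le (d := d) n).toFinset}
    refine (tsum_of_norm_bounded h4.hasSum ?_).trans ?_
    · rintro ⟨y, hy⟩
      simp only [Set.Finite.mem_toFinset, Set.mem_ofPred_eq, not_le] at hy
      simp only [Function.comp_apply, Real.norm_eq_abs]
      have h5 : 1 ≤ enormZ y ^ a * (n : ℝ) ^ (-a) := by
        rw [Real.rpow_neg hnpos.le, ← div_eq_mul_inv, one_le_div (by positivity)]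
        exact Real.rpow_le_rpow hnpos.le hy.le ha.le
      calc |tilt c μ y| ≤ enormZ y ^ a * (n : ℝ) ^ (-a) * |tilt c μ y| :=
            le_mul_of_one_le_left (abs_nonneg _) h5
        _ = _ := by ring
    · refine (Summable.tsum_subtype_le _ _ (fun y => ?_) h3).trans ?_
      · have := enormZ_nonneg y; positivity
      · rw [tsum_mul_right]
        exact mul_le_mul_of_nonneg_right (h μ hμ).2 (by positivity)
  refine TendstoUniformlyOn.continuousOn (F := F) (p := atTop) ?_ (Frequently.of_forall fun n => ?_)
  · rw [Metric.tendstoUniformlyOn_iff]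
    intro ε hε
    have h1 : Tendsto (fun n : ℕ => M * (n : ℝ) ^ (-a)) atTop (𝓝 0) :=
      tendsto_const_mul_rpow_neg tendsto_natCast_atTop_atTop M ha
    filter_upwards [h1.eventually (gt_mem_nhds hε), eventually_ge_atTop 1] with n h2 h3 μ hμ
    exact (hbound n h3 μ hμ).trans_lt h2
  · refine (continuous_finsetSum _ fun y _ => ?_).continuousOn
    unfold tilt
    have := continuous_rdotZ (d := d) y
    fun_prop

/-! ### The critical surface -/

lemma etaOf_eq (J : (Fin d → ℤ) → ℝ) (μ : Fin d → ℝ) : etaOf J μ = mean (tilt J μ) := by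
  ext j; simp only [etaOf, mean, tilt, mul_assoc]

lemma LambdaOf_eq (J : (Fin d → ℤ) → ℝ) (μ : Fin d → ℝ) : LambdaOf J μ = cov (tilt J μ) := by
  ext j l; simp only [LambdaOf, cov, tilt, mul_assoc, Matrix.of_apply]

lemma mean_normalizeKer (Q : (Fin d → ℤ) → ℝ) : mean (normalizeKer Q) = mean Q := by
  ext j
  refine tsum_congr fun y => ?_
  by_cases hy : y = 0 <;> simp [normalizeKer, hy]

lemma tiltSum_zero (f : (Fin d → ℤ) → ℝ) : tiltSum f 0 = ∑' y, f y := by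
  simp [tiltSum, rdotZ_zero_left]

section

variable {S J h : (Fin d → ℤ) → ℝ} {M K ζ : ℝ}

lemma AssumptionJ.ker (hJ : AssumptionJ S J h M K ζ) {μ : Fin d → ℝ} (hμ : μ ∈ closure (Omega S)) :
    Ker (2 * M + 1) K (min ζ 1) (normalizeKer (tilt J μ)) :=
  (hJ.memQ μ hμ).ker hJ.M_pos hJ.K_pos hJ.zeta_pos

lemma tiltSum_mul_one_sub (hJ : AssumptionJ S J h M K ζ) (hS : ∀ x, 0 ≤ S x) {μ : Fin d → ℝ}
    (hμ : μ ∈ Omega S) : tiltSum S μ * (1 - tiltSum J μ) = tiltSum h μ := by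
  have hq := hJ.memQ μ (subset_closure hμ)
  have hJs : Summable (tilt J μ) := (hq.Q_summable hJ.M_pos.le).1.of_abs
  have hhs : Summable (tilt h μ) := (hq.g_summable hJ.M_pos.le).1.of_abs
  have hSs := (mem_Omega_iff hS).1 hμ
  have hnorm : ∀ {f : (Fin d → ℤ) → ℝ}, Summable (tilt f μ) →
      Summable fun y => ‖(f y : ℂ) * (Real.exp (rdotZ μ y) : ℂ)‖ := fun {f} hf => by
    refine hf.abs.congr fun y => ?_
    rw [← Complex.ofReal_mul, Complex.norm_real]
    rfl
  have h1 := tsum_conv_mul (f := J) (g := S) (e := fun y => (Real.exp (rdotZ μ y) : ℂ))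
    (fun x y => by
      rw [← Complex.ofReal_mul, ← Real.exp_add]
      congr 2
      simp [rdotZ, mul_add, Finset.sum_add_distrib]) (hnorm hJs) (hnorm hSs)
  simp only [← Complex.ofReal_mul, ← Complex.ofReal_tsum] at h1
  have h2 : ∑' y, conv J S y * Real.exp (rdotZ μ y) = tiltSum J μ * tiltSum S μ := by
    exact_mod_cast h1
  have h3 : ∀ y, conv J S y * Real.exp (rdotZ μ y) = tilt S μ y - tilt h μ y := fun y => by
    simp only [tilt]; rw [hJ.OZ_eq y]; ring
  simp only [h3] at h2
  rw [hSs.tsum_sub hhs] at h2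
  have h4 : ∑' y, tilt S μ y = tiltSum S μ := rfl
  have h5 : ∑' y, tilt h μ y = tiltSum h μ := rfl
  rw [h4, h5] at h2
  linarith

lemma tiltSum_lt_one (hJ : AssumptionJ S J h M K ζ) (hS : ∀ x, 0 ≤ S x) {μ : Fin d → ℝ}
    (hμ : μ ∈ Omega S) : tiltSum J μ < 1 := by
  have h1 := tiltSum_mul_one_sub hJ hS hμ
  have h2 := hJ.hhat_pos μ (subset_closure hμ)
  have h3 : 0 ≤ tiltSum S μ := tsum_nonneg fun y => tilt_nonneg hS μ y
  by_contra hlt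
  push Not at hlt
  nlinarith

lemma continuousOn_tiltSum_J (hJ : AssumptionJ S J h M K ζ) :
    ContinuousOn (tiltSum J) (closure (Omega S)) :=
  continuousOn_tiltSum (by have := hJ.zeta_pos; positivity) fun μ hμ =>
    (hJ.memQ μ hμ).Q_moment_summable hJ.M_pos.le

lemma continuousOn_tiltSum_h (hJ : AssumptionJ S J h M K ζ) :
    ContinuousOn (tiltSum h) (closure (Omega S)) :=
  continuousOn_tiltSum hJ.zeta_pos fun μ hμ => (hJ.memQ μ hμ).g_moment_summable hJ.M_pos.le

lemma weighted_moment {f : (Fin d → ℤ) → ℝ} {w : (Fin d → ℤ) → ℝ} {a ζ M : ℝ}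
    (hw : ∀ y, enormZ y ^ ζ * |w y| ≤ enormZ y ^ a)
    (h : (Summable fun y => enormZ y ^ a * |f y|) ∧ ∑' y, enormZ y ^ a * |f y| ≤ M) :
    (Summable fun y => enormZ y ^ ζ * |w y * f y|) ∧ ∑' y, enormZ y ^ ζ * |w y * f y| ≤ M := by
  have hle : ∀ y, enormZ y ^ ζ * |w y * f y| ≤ enormZ y ^ a * |f y| := fun y => by
    rw [abs_mul, ← mul_assoc]
    exact mul_le_mul_of_nonneg_right (hw y) (abs_nonneg _)
  have hs : Summable fun y => enormZ y ^ ζ * |w y * f y| :=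
    Summable.of_nonneg_of_le (fun y => mul_nonneg (Real.rpow_nonneg (enormZ_nonneg _) _) (abs_nonneg _))
      hle h.1
  exact ⟨hs, (hs.tsum_le_tsum hle h.1).trans h.2⟩

lemma continuousOn_etaOf (hJ : AssumptionJ S J h M K ζ) :
    ContinuousOn (etaOf J) (closure (Omega S)) := by
  have hζ := hJ.zeta_pos
  refine continuousOn_pi.2 fun j => ?_
  refine continuousOn_tiltSum (c := fun y => (y j : ℝ) * J y) (M := M) hζ fun μ hμ => ?_
  have h1 := weighted_moment (w := fun y : Fin d → ℤ => (y j : ℝ)) (ζ := ζ) (fun y => ?_)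
    ((hJ.memQ μ hμ).Q_moment_summable hJ.M_pos.le)
  · simpa only [tilt, mul_assoc] using h1
  · have hy := enormZ_nonneg y
    calc enormZ y ^ ζ * |(y j : ℝ)| ≤ enormZ y ^ ζ * enormZ y ^ (1 : ℝ) := by
          rw [Real.rpow_one]; gcongr; exact abs_apply_le_enormZ y j
      _ = enormZ y ^ (1 + ζ) := by
          rw [← Real.rpow_add_of_nonneg hy hζ.le zero_le_one, add_comm]
      _ ≤ _ := enormZ_rpow_le_rpow y (by positivity) (by linarith)

lemma continuousOn_LambdaOf (hJ : AssumptionJ S J h M K ζ) :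
    ContinuousOn (LambdaOf J) (closure (Omega S)) := by
  have hζ := hJ.zeta_pos
  refine continuousOn_pi.2 fun j => continuousOn_pi.2 fun l => ?_
  refine continuousOn_tiltSum (c := fun y => (y j : ℝ) * (y l : ℝ) * J y) (M := M) hζ fun μ hμ => ?_
  have h1 := weighted_moment (w := fun y : Fin d → ℤ => (y j : ℝ) * (y l : ℝ)) (ζ := ζ) (fun y => ?_)
    ((hJ.memQ μ hμ).Q_moment_summable hJ.M_pos.le)
  · simpa only [tilt, mul_assoc] using h1
  · have hy := enormZ_nonneg y
    calc enormZ y ^ ζ * |(y j : ℝ) * (y l : ℝ)| ≤ enormZ y ^ ζ * enormZ y ^ (2 : ℝ) := by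
          rw [abs_mul, show (2 : ℝ) = ((2 : ℕ) : ℝ) by norm_num, Real.rpow_natCast, sq]
          gcongr
          · exact abs_apply_le_enormZ y j
          · exact abs_apply_le_enormZ y l
      _ = enormZ y ^ (2 + ζ) := by
          rw [← Real.rpow_add_of_nonneg hy hζ.le zero_le_two, add_comm]

lemma frontier_eq_diff (hS : AssumptionOmega S) {μ : Fin d → ℝ} (hμ : μ ∈ frontier (Omega S)) :
    μ ∈ closure (Omega S) ∧ μ ∉ Omega S := by
  rw [hS.open_Omega.frontier_eq] at hμ
  exact hμ

lemma smul_mem_Omega (hS : AssumptionOmega S) {μ : Fin d → ℝ} (hμ : μ ∈ closure (Omega S)) {t : ℝ}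
    (ht0 : 0 ≤ t) (ht : t < 1) : t • μ ∈ Omega S := by
  have hconv := convex_Omega hS.nonneg
  have hn := Omega_mem_nhds hS
  have h1 := (gauge_le_one_iff_mem_closure hconv hn).2 hμ
  rw [← hS.open_Omega.interior_eq, ← gauge_lt_one_iff_mem_interior hconv hn,
    gauge_smul_of_nonneg ht0, smul_eq_mul]
  have := gauge_nonneg (s := Omega S) μ
  nlinarith

lemma tiltSum_eq_one (hS : AssumptionOmega S) (hJ : AssumptionJ S J h M K ζ) {μ : Fin d → ℝ}
    (hμ : μ ∈ frontier (Omega S)) : tiltSum J μ = 1 := by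
  obtain ⟨hcl, hnot⟩ := frontier_eq_diff hS hμ
  refine le_antisymm ?_ ?_
  · exact le_on_closure (fun ν hν => (tiltSum_lt_one hJ hS.nonneg hν).le)
      (continuousOn_tiltSum_J hJ) continuousOn_const hcl
  by_contra hlt
  push Not at hlt
  refine hnot ((mem_Omega_iff hS.nonneg).2 ?_)
  have ht : Tendsto (fun t : ℝ => t • μ) (𝓝[<] 1) (𝓝 μ) := by
    have : Tendsto (fun t : ℝ => t • μ) (𝓝 1) (𝓝 ((1 : ℝ) • μ)) := tendsto_id.smul_const μ
    rw [one_smul] at this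
    exact this.mono_left nhdsWithin_le_nhds
  have hmem : ∀ᶠ t : ℝ in 𝓝[<] 1, t • μ ∈ Omega S := by
    filter_upwards [self_mem_nhdsWithin, mem_nhdsWithin_of_mem_nhds (Ioi_mem_nhds zero_lt_one)]
      with t h1 h2
    exact smul_mem_Omega hS hcl (le_of_lt h2) h1
  have hφ : Tendsto (fun t : ℝ => tiltSum J (t • μ)) (𝓝[<] 1) (𝓝 (tiltSum J μ)) :=
    (continuousOn_tiltSum_J hJ μ hcl).tendsto.comp
      (tendsto_nhdsWithin_iff.2 ⟨ht, hmem.mono fun t h => subset_closure h⟩)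
  set δ := (1 - tiltSum J μ) / 2 with hδ
  have hδpos : 0 < δ := by rw [hδ]; linarith
  have hbd : ∀ᶠ t : ℝ in 𝓝[<] 1, ∀ s : Finset (Fin d → ℤ), ∑ y ∈ s, tilt S (t • μ) y ≤ M / δ := by
    filter_upwards [hmem, hφ.eventually (gt_mem_nhds (show tiltSum J μ < 1 - δ by rw [hδ]; linarith))]
      with t h1 h2 s
    have h3 := tiltSum_mul_one_sub hJ hS.nonneg h1
    have hq := (hJ.memQ _ (subset_closure h1)).g_summable hJ.M_pos.le
    have h4 : tiltSum h (t • μ) ≤ M :=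
      (hq.1.of_abs.tsum_le_tsum (fun y => le_abs_self _) hq.1).trans hq.2
    have h5 : ∑ y ∈ s, tilt S (t • μ) y ≤ tiltSum S (t • μ) :=
      ((mem_Omega_iff hS.nonneg).1 h1).sum_le_tsum s fun y _ => tilt_nonneg hS.nonneg _ y
    have h6 : 0 ≤ tiltSum S (t • μ) := tsum_nonneg fun y => tilt_nonneg hS.nonneg _ y
    rw [le_div_iff₀ hδpos]
    nlinarith
  refine summable_of_sum_le (c := M / δ) (fun y => tilt_nonneg hS.nonneg μ y) fun s => ?_
  have hlim : Tendsto (fun t : ℝ => ∑ y ∈ s, tilt S (t • μ) y) (𝓝[<] 1) (𝓝 (∑ y ∈ s, tilt S μ y)) := by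
    refine tendsto_finsetSum _ fun y _ => ?_
    have hc : Continuous fun ν : Fin d → ℝ => tilt S ν y := by
      unfold tilt
      have := continuous_rdotZ (d := d) y
      fun_prop
    exact (hc.tendsto μ).comp ht
  exact le_of_tendsto hlim (hbd.mono fun t h => h s)

lemma integral_taylor_exp (a b : ℝ) :
    ∫ s in Set.Ioc (0 : ℝ) 1, (1 - s) * (b ^ 2 * Real.exp (a + s * b)) =
      Real.exp (a + b) - Real.exp a - b * Real.exp a := by
  rw [← intervalIntegral.integral_of_le zero_le_one]
  have hd : ∀ s ∈ Set.uIcc (0 : ℝ) 1, HasDerivAt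
      (fun s : ℝ => (1 - s) * (b * Real.exp (a + s * b)) + Real.exp (a + s * b))
      ((1 - s) * (b ^ 2 * Real.exp (a + s * b))) s := by
    intro s _
    have h1 : HasDerivAt (fun s : ℝ => Real.exp (a + s * b)) (Real.exp (a + s * b) * b) s := by
      have := (((hasDerivAt_id s).mul_const b).const_add a).exp
      simpa using this
    have h2 := (((hasDerivAt_id s).const_sub 1).mul (h1.const_mul b)).add h1
    refine HasDerivAt.congr_deriv h2 ?_
    simp only [id]
    ring
  rw [intervalIntegral.integral_eq_sub_of_hasDerivAt hd
    (by apply Continuous.intervalIntegrable; fun_prop)]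
  simp; ring

lemma tiltSum_convex (hS : AssumptionOmega S) (hJ : AssumptionJ S J h M K ζ) {μ ν : Fin d → ℝ}
    (hμ : μ ∈ closure (Omega S)) (hν : ν ∈ closure (Omega S)) :
    tiltSum J μ + rdot (ν - μ) (etaOf J μ) ≤ tiltSum J ν := by
  have hconv := (convex_Omega hS.nonneg).closure
  set w := ν - μ with hw
  have hseg : ∀ s ∈ Set.Ioc (0 : ℝ) 1, μ + s • w ∈ closure (Omega S) := fun s hs => by
    have := hconv hμ hν (show 0 ≤ 1 - s by linarith [hs.2]) hs.1.le (by ring)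
    convert this using 1
    rw [hw, smul_sub, sub_smul, one_smul]; abel
  set F : (Fin d → ℤ) → ℝ → ℝ := fun y s =>
    J y * ((1 - s) * (rdotZ w y ^ 2 * Real.exp (rdotZ μ y + s * rdotZ w y))) with hF
  have hFcont : ∀ y, Continuous (F y) := fun y => by simp only [hF]; fun_prop
  have hFint : ∀ y, IntegrableOn (F y) (Set.Ioc 0 1) := fun y =>
    (hFcont y).integrableOn_Ioc (μ := volume)
  have hker : ∀ {κ : Fin d → ℝ}, κ ∈ closure (Omega S) →
      Summable fun y => |rdotZ w y ^ 2 * tilt J κ y| := fun {κ} hκ => by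
    have h1 := (hJ.ker hκ).weight_summable ((hJ.ker hκ).rdotZ_sq_weight w)
    refine h1.congr fun y => ?_
    by_cases hy : y = 0
    · simp [hy, rdotZ_zero_right]
    · simp [normalizeKer, hy]
  have hsum : Summable fun y => ∫ s in Set.Ioc (0 : ℝ) 1, ‖F y s‖ := by
    refine Summable.of_nonneg_of_le (fun y => integral_nonneg fun _ => norm_nonneg _) (fun y => ?_)
      ((hker hμ).add (hker hν))
    have h2 : ∀ s ∈ Set.Ioc (0 : ℝ) 1, ‖F y s‖ ≤
        |rdotZ w y ^ 2 * tilt J μ y| + |rdotZ w y ^ 2 * tilt J ν y| := by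
      intro s hs
      have h3 := exp_combo_le μ ν (show 0 ≤ 1 - s by linarith [hs.2]) hs.1.le (by ring) y
      have h4 : rdotZ ((1 - s) • μ + s • ν) y = rdotZ μ y + s * rdotZ w y := by
        rw [hw, rdotZ_add_left, rdotZ_smul_left, rdotZ_smul_left, rdotZ_sub_left]; ring
      rw [h4] at h3
      have h5 : Real.exp (rdotZ μ y + s * rdotZ w y) ≤
          Real.exp (rdotZ μ y) + Real.exp (rdotZ ν y) := by
        have := Real.exp_pos (rdotZ μ y)
        have := Real.exp_pos (rdotZ ν y)
        nlinarith [hs.1, hs.2]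
      simp only [hF, tilt, Real.norm_eq_abs, abs_mul, Real.abs_exp, abs_pow]
      rw [abs_of_nonneg (show 0 ≤ 1 - s by linarith [hs.2])]
      calc |J y| * ((1 - s) * (|rdotZ w y| ^ 2 * Real.exp (rdotZ μ y + s * rdotZ w y)))
          ≤ |J y| * (1 * (|rdotZ w y| ^ 2 * (Real.exp (rdotZ μ y) + Real.exp (rdotZ ν y)))) := by
            gcongr
            linarith [hs.1]
        _ = _ := by ring
    have h6 := setIntegral_mono_on (μ := volume) (hFint y).norm
      ((continuous_const (y := |rdotZ w y ^ 2 * tilt J μ y| +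
        |rdotZ w y ^ 2 * tilt J ν y|)).integrableOn_Ioc (μ := volume)) measurableSet_Ioc h2
    simpa using h6
  have hswap := (hasSum_integral_of_summable_integral_norm
    (μ := volume.restrict (Set.Ioc (0 : ℝ) 1)) hFint hsum).tsum_eq
  have hpos : 0 ≤ ∫ s in Set.Ioc (0 : ℝ) 1, ∑' y, F y s := by
    refine setIntegral_nonneg measurableSet_Ioc fun s hs => ?_
    have h1 := (hJ.ker (hseg s hs)).cov_lower w
    rw [(hJ.ker (hseg s hs)).rdot_cov] at h1
    have h2 : ∑' y, F y s =
        (1 - s) * ∑' y, rdotZ w y ^ 2 * normalizeKer (tilt J (μ + s • w)) y := by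
      rw [← tsum_mul_left]
      refine tsum_congr fun y => ?_
      by_cases hy : y = 0
      · simp [hF, hy, rdotZ_zero_right]
      · simp only [hF, normalizeKer, hy, if_false, tilt, rdotZ_add_left, rdotZ_smul_left]
        ring
    rw [h2]
    have hK := hJ.K_pos
    exact mul_nonneg (by linarith [hs.2]) (le_trans (by positivity) h1)
  have hterm : ∀ y, ∫ s in Set.Ioc (0 : ℝ) 1, F y s =
      tilt J ν y - tilt J μ y - rdotZ w y * tilt J μ y := fun y => by
    simp only [hF]
    rw [integral_const_mul, integral_taylor_exp]
    have : rdotZ μ y + rdotZ w y = rdotZ ν y := by rw [hw, rdotZ_sub_left]; ring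
    rw [this]; simp only [tilt]; ring
  have hJμ : Summable (tilt J μ) := ((hJ.memQ μ hμ).Q_summable hJ.M_pos.le).1.of_abs
  have hJν : Summable (tilt J ν) := ((hJ.memQ ν hν).Q_summable hJ.M_pos.le).1.of_abs
  have hlin : ∀ y, rdotZ w y * normalizeKer (tilt J μ) y = rdotZ w y * tilt J μ y := fun y => by
    by_cases hy : y = 0
    · simp [hy, rdotZ_zero_right]
    · simp [normalizeKer, hy]
  have h1 := ((hJ.ker hμ).weight_summable ((hJ.ker hμ).rdotZ_weight w)).of_abs
  have h2 := (hJ.ker hμ).rdot_mean w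
  simp only [hlin] at h1 h2
  rw [mean_normalizeKer, ← etaOf_eq] at h2
  simp only [hterm] at hswap
  rw [(hJν.sub hJμ).tsum_sub h1, hJν.tsum_sub hJμ, ← h2] at hswap
  rw [← hswap] at hpos
  have h4 : ∑' y, tilt J μ y = tiltSum J μ := rfl
  have h5 : ∑' y, tilt J ν y = tiltSum J ν := rfl
  rw [h4, h5] at hpos
  linarith

lemma le_rdot_etaOf (hS : AssumptionOmega S) (hJ : AssumptionJ S J h M K ζ) {μ : Fin d → ℝ}
    (hμ : μ ∈ frontier (Omega S)) : 1 - tiltSum J 0 ≤ rdot μ (etaOf J μ) := by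
  have h1 := tiltSum_convex hS hJ (frontier_subset_closure hμ) (subset_closure hS.zero_mem)
  rw [tiltSum_eq_one hS hJ hμ, zero_sub] at h1
  have : rdot (-μ) (etaOf J μ) = -rdot μ (etaOf J μ) := by simp [rdot]
  linarith

lemma exists_le_enormR_etaOf (hS : AssumptionOmega S) (hJ : AssumptionJ S J h M K ζ) :
    ∃ e₀, 0 < e₀ ∧ ∀ μ ∈ frontier (Omega S), e₀ ≤ enormR (etaOf J μ) := by
  obtain ⟨C, hC⟩ := (isCompact_closure_Omega hS).exists_bound_of_continuousOn
    (continuous_enormR (d := d)).continuousOn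
  have hδ : 0 < 1 - tiltSum J 0 := sub_pos.2 (tiltSum_lt_one hJ hS.nonneg hS.zero_mem)
  have hC0 : 0 < |C| + 1 := by positivity
  refine ⟨(1 - tiltSum J 0) / (|C| + 1), by positivity, fun μ hμ => ?_⟩
  rw [div_le_iff₀ hC0]
  have h1 := hC μ (frontier_subset_closure hμ)
  rw [Real.norm_eq_abs, abs_of_nonneg (enormR_nonneg _)] at h1
  have h2 := (le_abs_self _).trans (abs_rdot_le μ (etaOf J μ))
  have h3 := le_rdot_etaOf hS hJ hμ
  have h4 := enormR_nonneg (etaOf J μ)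
  nlinarith [le_abs_self C]

/-- A direction pointing strictly inwards for the normal `η` is feasible for an optimization
problem over the closure of `Ω`. -/
lemma exists_add_smul_mem_closure (hS : AssumptionOmega S) (hJ : AssumptionJ S J h M K ζ)
    {μ w : Fin d → ℝ} (hμ : μ ∈ frontier (Omega S)) (hw : rdot w (etaOf J μ) < 0) :
    ∃ s : ℝ, 0 < s ∧ μ + s • w ∈ closure (Omega S) := by
  have hconv := convex_Omega hS.nonneg
  have hn := Omega_mem_nhds hS
  have hg := continuous_gauge hconv hn
  have hcl := frontier_subset_closure hμ
  by_contra hcon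
  push Not at hcon
  set G : ℝ → ℝ := fun s => gauge (Omega S) (μ + s • w) with hG
  have hline : Continuous fun s : ℝ => μ + s • w := by fun_prop
  have hG1 : ∀ s, 0 < s → 1 < G s := fun s hs => by
    have := hcon s hs
    rw [← gauge_le_one_iff_mem_closure hconv hn] at this
    exact not_le.1 this
  have hG0 : G 0 = 1 := by
    simp only [hG, zero_smul, add_zero]
    exact (gauge_eq_one_iff_mem_frontier hconv hn).2 hμ
  have hGlim : Tendsto G (𝓝[>] 0) (𝓝 1) := by
    have := (hg.comp hline).tendsto 0
    rw [show (gauge (Omega S) ∘ fun s : ℝ => μ + s • w) = G from rfl, hG0] at this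
    exact this.mono_left nhdsWithin_le_nhds
  set p : ℝ → Fin d → ℝ := fun s => (G s)⁻¹ • (μ + s • w) with hp
  have hplim : Tendsto p (𝓝[>] 0) (𝓝 μ) := by
    have h1 : Tendsto (fun s : ℝ => μ + s • w) (𝓝[>] 0) (𝓝 μ) := by
      have := hline.tendsto 0
      rw [zero_smul, add_zero] at this
      exact this.mono_left nhdsWithin_le_nhds
    have := (hGlim.inv₀ one_ne_zero).smul h1
    rwa [inv_one, one_smul] at this
  have hpf : ∀ s, 0 < s → p s ∈ frontier (Omega S) := fun s hs => by
    have h1 := hG1 s hs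
    rw [← gauge_eq_one_iff_mem_frontier hconv hn, hp]
    simp only
    rw [gauge_smul_of_nonneg (by positivity), smul_eq_mul]
    exact inv_mul_cancel₀ (by linarith)
  have hηlim : Tendsto (fun s => etaOf J (p s)) (𝓝[>] 0) (𝓝 (etaOf J μ)) :=
    (continuousOn_etaOf hJ μ hcl).tendsto.comp (tendsto_nhdsWithin_iff.2 ⟨hplim, by
      filter_upwards [self_mem_nhdsWithin] with s hs
      exact frontier_subset_closure (hpf s hs)⟩)
  have hrd : ∀ v : Fin d → ℝ, Tendsto (fun s => rdot v (etaOf J (p s))) (𝓝[>] 0)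
      (𝓝 (rdot v (etaOf J μ))) := fun v => by
    have hc : Continuous fun u : Fin d → ℝ => rdot v u := by unfold rdot; fun_prop
    exact (hc.tendsto _).comp hηlim
  have hpos : 0 < rdot μ (etaOf J μ) :=
    (sub_pos.2 (tiltSum_lt_one hJ hS.nonneg hS.zero_mem)).trans_le (le_rdot_etaOf hS hJ hμ)
  obtain ⟨s, h1, h2, hs⟩ := (((hrd w).eventually (gt_mem_nhds hw)).and
    (((hrd μ).eventually (lt_mem_nhds hpos)).and self_mem_nhdsWithin)).exists
  have hs' : 0 < s := hs
  have h3 := tiltSum_convex hS hJ (frontier_subset_closure (hpf s hs')) hcl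
  rw [tiltSum_eq_one hS hJ (hpf s hs'), tiltSum_eq_one hS hJ hμ] at h3
  have hGs := hG1 s hs'
  have hGpos : 0 < G s := by linarith
  have h4 : μ - p s = (1 - (G s)⁻¹) • μ - ((G s)⁻¹ * s) • w := by
    simp only [hp]
    rw [smul_add, smul_smul, sub_smul, one_smul]; abel
  rw [h4, rdot_sub_left, rdot_smul_left, rdot_smul_left] at h3
  have h5 : 0 ≤ 1 - (G s)⁻¹ := sub_nonneg.2 (inv_le_one_of_one_le₀ hGs.le)
  have h6 : 0 < (G s)⁻¹ * s := by positivity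
  have h7 := mul_nonneg h5 h2.le
  have h8 := mul_neg_of_pos_of_neg h6 h1
  linarith

lemma exists_eq_smul_etaOf (hS : AssumptionOmega S) (hJ : AssumptionJ S J h M K ζ)
    {x μ : Fin d → ℝ} (hx : x ≠ 0) (hμ : IsOptTilt S x μ) :
    ∃ c : ℝ, 0 < c ∧ x = c • etaOf J μ := by
  obtain ⟨e₀, he₀, hη⟩ := exists_le_enormR_etaOf hS hJ
  set η := etaOf J μ with hηdef
  have hηpos : 0 < enormR η := he₀.trans_le (hη μ hμ.1)
  have hkey : ∀ w : Fin d → ℝ, rdot w η < 0 → rdot w x ≤ 0 := fun w hw => by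
    obtain ⟨s, hs, hmem⟩ := exists_add_smul_mem_closure hS hJ hμ.1 hw
    have := hμ.2 _ hmem
    rw [rdot_add_left, rdot_smul_left] at this
    nlinarith
  set c := rdot x η / enormR η ^ 2 with hc
  set u := x - c • η with hu
  have huη : rdot u η = 0 := by
    rw [hu, rdot_sub_left, rdot_smul_left, rdot_self, hc]; field_simp; ring
  have hux : rdot u x = enormR u ^ 2 := by
    have : x = u + c • η := by rw [hu]; abel
    rw [← rdot_self]
    nth_rewrite 1 [this]
    rw [rdot_comm u (u + c • η), rdot_add_left, rdot_smul_left, rdot_comm η u, huη]; ring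
  have hle : ∀ ε : ℝ, 0 < ε → enormR u ^ 2 ≤ ε * rdot η x := fun ε hε => by
    have := hkey (u - ε • η) (by
      rw [rdot_sub_left, rdot_smul_left, huη, rdot_self]
      have : 0 < ε * enormR η ^ 2 := by positivity
      linarith)
    rw [rdot_sub_left, rdot_smul_left, hux] at this
    linarith
  have hu0 : enormR u ^ 2 ≤ 0 := by
    have hlim : Tendsto (fun ε : ℝ => ε * rdot η x) (𝓝[>] 0) (𝓝 (0 * rdot η x)) :=
      (tendsto_id.mul_const _).mono_left nhdsWithin_le_nhds
    rw [zero_mul] at hlim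
    exact ge_of_tendsto hlim (eventually_nhdsWithin_of_forall fun ε hε => hle ε hε)
  have hu00 : u = 0 := enormR_eq_zero.1 (by
    have := enormR_nonneg u
    nlinarith)
  have hxc : x = c • η := by
    have : x = u + c • η := by rw [hu]; abel
    rw [this, hu00, zero_add]
  have hc0 : 0 ≤ c := by
    have := hkey (-η) (by
      have : rdot (-η) η = -rdot η η := by simp [rdot]
      rw [this, rdot_self]
      have : 0 < enormR η ^ 2 := by positivity
      linarith)
    have h2 : rdot (-η) x = -rdot x η := by rw [rdot_comm x η]; simp [rdot]
    rw [hc]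
    exact div_nonneg (by linarith) (by positivity)
  refine ⟨c, lt_of_le_of_ne hc0 fun h0 => hx ?_, hxc⟩
  rw [hxc, ← h0, zero_smul]

end

/-! ### Convolution with the numerator -/

lemma summable_sq_of_lpNorm_le {u : (Fin d → ℤ) → ℝ} {p M : ℝ} (hp : 0 < p) (hp2 : p ≤ 2) (hM : 0 ≤ M)
    (h : lpNorm u p ≤ ENNReal.ofReal M) :
    (Summable fun y => u y ^ 2) ∧ ∑' y, u y ^ 2 ≤ M ^ 2 := by
  obtain ⟨hs, hl⟩ := summable_of_lpNorm_le hp hM h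
  have hpt : ∀ y, |u y| ≤ M := fun y =>
    rpow_le_of_le_rpow (abs_nonneg _) hM hp
      ((hs.le_tsum y fun z _ => Real.rpow_nonneg (abs_nonneg _) _).trans hl)
  have hle : ∀ y, u y ^ 2 ≤ M ^ (2 - p) * |u y| ^ p := fun y => by
    have h1 : u y ^ 2 = |u y| ^ (2 - p) * |u y| ^ p := by
      rw [← Real.rpow_add_of_nonneg (abs_nonneg _) (by linarith) hp.le, sub_add_cancel, ← sq_abs]
      norm_cast
    rw [h1]
    gcongr
    exact hpt y
  have hs2 : Summable fun y => u y ^ 2 :=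
    Summable.of_nonneg_of_le (fun y => sq_nonneg _) hle (hs.mul_left _)
  refine ⟨hs2, (hs2.tsum_le_tsum hle (hs.mul_left _)).trans ?_⟩
  rw [tsum_mul_left]
  refine (mul_le_mul_of_nonneg_left hl (Real.rpow_nonneg hM _)).trans_eq ?_
  rw [← Real.rpow_add_of_nonneg hM (by linarith) hp.le, sub_add_cancel]
  exact Real.rpow_natCast M 2

lemma MemQ.g_sq_summable (hd : 1 ≤ d) {M K ζ : ℝ} {Q g : (Fin d → ℤ) → ℝ} (hM : 0 ≤ M) (hζ : 0 < ζ)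
    (h : MemQ M K ζ Q g) :
    (Summable fun y => (enormZ y ^ max 2 ((d : ℝ) - 1) * g y) ^ 2) ∧
      ∑' y, (enormZ y ^ max 2 ((d : ℝ) - 1) * g y) ^ 2 ≤ M ^ 2 := by
  rcases le_or_gt d 3 with h3 | h3
  · have hp : 0 < pExp d ζ := by
      have : 0 < min ζ 2 := lt_min hζ two_pos
      interval_cases d <;> simp [pExp] <;> linarith
    have h3' : (d : ℝ) ≤ 3 := by exact_mod_cast h3
    rw [max_eq_left (by linarith)]
    exact summable_sq_of_lpNorm_le (lt_min hp two_pos) (min_le_right _ _) hM h.g_two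
  · have h3' : (4 : ℝ) ≤ d := by exact_mod_cast h3
    rw [max_eq_right (by linarith)]
    exact summable_sq_of_lpNorm_le two_pos le_rfl hM (h.g_dm1 h3)

lemma summable_one_add_enormZ_rpow {r : ℝ} (hr : (d : ℝ) < r) :
    Summable fun z : Fin d → ℤ => (1 + enormZ z) ^ (-r) := by
  set L := Submodule.span ℤ (Set.range (Pi.basisFun ℝ (Fin d))) with hL
  have hrank : Module.finrank ℤ L = d := by
    rw [ZLattice.rank ℝ L]; simp
  have h1 := ZLattice.summable_norm_rpow L (-r) (by rw [hrank]; linarith)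
  have hmem : ∀ z : Fin d → ℤ, toR z ∈ L := fun z => by
    have : toR z = ∑ i, z i • Pi.basisFun ℝ (Fin d) i := by
      ext j; simp [toR, Pi.single_apply, Finset.sum_apply]
    rw [this]
    exact Submodule.sum_mem _ fun i _ => Submodule.smul_mem _ _ (Submodule.subset_span ⟨i, rfl⟩)
  have hinj : Function.Injective fun z : Fin d → ℤ => (⟨toR z, hmem z⟩ : L) := fun a b hab => by
    have h2 := congrArg Subtype.val hab
    ext i
    have h3 := congrFun h2 i
    simpa [toR] using h3
  refine Summable.of_norm_bounded_eventually (h1.comp_injective hinj) ?_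
  refine (Set.finite_singleton (0 : Fin d → ℤ)).subset fun y hy => ?_
  by_contra h0
  have h0' : y ≠ 0 := h0
  refine hy ?_
  have hn : ‖toR y‖ ≤ enormZ y := by
    rw [pi_norm_le_iff_of_nonneg (enormZ_nonneg y)]
    exact fun i => abs_apply_le_enormZ y i
  have hp : 0 < ‖toR y‖ := by
    rw [norm_pos_iff]
    intro h2
    exact h0' (by ext i; simpa [toR] using congrFun h2 i)
  have he := enormZ_nonneg y
  change ‖(1 + enormZ y) ^ (-r)‖ ≤ ‖toR y‖ ^ (-r)
  rw [Real.norm_of_nonneg (by positivity)]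
  exact Real.rpow_le_rpow_of_nonpos hp (by linarith) (by
    have : (0 : ℝ) ≤ d := by positivity
    linarith)

lemma green_weight_le {a q : ℝ} (ha : 0 ≤ a) (hq : a + 1 ≤ q) (g : ℝ) {x y : Fin d → ℤ}
    (hx : 1 ≤ enormZ x) :
    enormZ x ^ a * (|g| * (1 + enormZ (x - y)) ^ (-a)) ≤
      2 ^ a * |g| + 2 ^ (q + 1) * enormZ x ^ (-(1 / 4) : ℝ) *
        ((enormZ y ^ q * g) ^ 2 + (1 + enormZ (x - y)) ^ (-(2 * a + 3 / 2))) := by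
  have htri : enormZ x - enormZ (x - y) ≤ enormZ y := by
    have := le_enormZ_sub x (x - y)
    rwa [sub_sub_cancel] at this
  set X := enormZ x
  set Z := enormZ (x - y)
  set Y := enormZ y
  have hX0 : 0 < X := one_pos.trans_le hx
  have hZ0 : 0 ≤ Z := enormZ_nonneg _
  have hY0 : 0 ≤ Y := enormZ_nonneg _
  rcases le_or_gt (X / 2) Z with hc | hc
  · have h1 : X ^ a * (|g| * (1 + Z) ^ (-a)) ≤ 2 ^ a * |g| := by
      have h2 : (1 + Z) ^ (-a) ≤ (X / 2) ^ (-a) :=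
        Real.rpow_le_rpow_of_nonpos (by positivity) (by linarith) (by linarith)
      have h3 : X ^ a * (X / 2) ^ (-a) = 2 ^ a := by
        rw [Real.rpow_neg (by positivity), Real.div_rpow hX0.le two_pos.le, inv_div,
          mul_div_cancel₀ _ (by positivity)]
      calc X ^ a * (|g| * (1 + Z) ^ (-a)) ≤ X ^ a * (|g| * (X / 2) ^ (-a)) := by gcongr
        _ = X ^ a * (X / 2) ^ (-a) * |g| := by ring
        _ = 2 ^ a * |g| := by rw [h3]
    have h4 : 0 ≤ 2 ^ (q + 1) * X ^ (-(1 / 4) : ℝ) *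
        ((Y ^ q * g) ^ 2 + (1 + Z) ^ (-(2 * a + 3 / 2))) := by positivity
    linarith
  · set w := (1 + Z) ^ (-(a + 3 / 4)) with hw
    have hw0 : 0 ≤ w := by positivity
    have hw2 : (1 + Z) ^ (-(2 * a + 3 / 2)) = w ^ 2 := by
      rw [hw, ← Real.rpow_natCast, ← Real.rpow_mul (by positivity)]
      congr 1; push_cast; ring
    have h1 : (1 + Z) ^ (-a) ≤ w * (2 * X ^ (3 / 4 : ℝ)) := by
      have h2 : (1 + Z) ^ (-a) = w * (1 + Z) ^ (3 / 4 : ℝ) := by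
        rw [hw, ← Real.rpow_add (by positivity)]; congr 1; ring
      have h3 : (1 + Z) ^ (3 / 4 : ℝ) ≤ (2 * X) ^ (3 / 4 : ℝ) :=
        Real.rpow_le_rpow (by positivity) (by linarith) (by norm_num)
      have h4 : (2 : ℝ) ^ (3 / 4 : ℝ) ≤ 2 :=
        Real.rpow_le_self_of_one_le one_le_two (by norm_num)
      rw [Real.mul_rpow two_pos.le hX0.le] at h3
      rw [h2]
      exact mul_le_mul_of_nonneg_left (h3.trans (mul_le_mul_of_nonneg_right h4 (by positivity))) hw0
    set u := Y ^ q * |g| with hu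
    have hu0 : 0 ≤ u := by positivity
    have hu2 : (Y ^ q * g) ^ 2 = u ^ 2 := by rw [hu, mul_pow, mul_pow, sq_abs]
    have h5 : |g| ≤ 2 ^ q * X ^ (-q) * u := by
      have h6 : (X / 2) ^ q ≤ Y ^ q :=
        Real.rpow_le_rpow (by positivity) (by linarith) (by linarith)
      have h7 : 2 ^ q * X ^ (-q) * (X / 2) ^ q = 1 := by
        rw [Real.rpow_neg hX0.le, Real.div_rpow hX0.le two_pos.le]
        have : X ^ q ≠ 0 := by positivity
        have : (2 : ℝ) ^ q ≠ 0 := by positivity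
        field_simp
      calc |g| = 2 ^ q * X ^ (-q) * ((X / 2) ^ q * |g|) := by rw [← mul_assoc, h7, one_mul]
        _ ≤ _ := by rw [hu]; gcongr
    have h8 : X ^ a * X ^ (-q) * X ^ (3 / 4 : ℝ) ≤ X ^ (-(1 / 4) : ℝ) := by
      rw [← Real.rpow_add hX0, ← Real.rpow_add hX0]
      exact Real.rpow_le_rpow_of_exponent_le hx (by linarith)
    rw [hw2, hu2, Real.rpow_add two_pos, Real.rpow_one]
    have h9 : u * w ≤ u ^ 2 + w ^ 2 := by nlinarith [sq_nonneg (u - w), sq_nonneg (u + w)]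
    calc X ^ a * (|g| * (1 + Z) ^ (-a))
        ≤ X ^ a * (2 ^ q * X ^ (-q) * u * (w * (2 * X ^ (3 / 4 : ℝ)))) := by gcongr
      _ = 2 ^ q * 2 * (X ^ a * X ^ (-q) * X ^ (3 / 4 : ℝ)) * (u * w) := by ring
      _ ≤ 2 ^ q * 2 * X ^ (-(1 / 4) : ℝ) * (u ^ 2 + w ^ 2) := by gcongr
      _ ≤ _ := le_add_of_nonneg_left (by positivity)

/-- Convolution of integrable numerators with functions having a pointwise limit under polynomial
rescaling. -/
lemma conv_limit {a q ζ M C : ℝ} (ha : (d : ℝ) < 2 * a + 3 / 2) (ha0 : 0 ≤ a) (hq : a + 1 ≤ q)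
    (hζ : 0 < ζ) (hC : 0 ≤ C)
    {g : ℕ → (Fin d → ℤ) → ℝ} {G : ℕ → (Fin d → ℤ) → ℂ} {x : ℕ → Fin d → ℤ} {L : ℂ}
    (hx : Tendsto (fun n => enormZ (x n)) atTop atTop)
    (hg1 : ∀ n, (Summable fun y => |g n y|) ∧ ∑' y, |g n y| ≤ M)
    (hgζ : ∀ n, (Summable fun y => enormZ y ^ ζ * |g n y|) ∧ ∑' y, enormZ y ^ ζ * |g n y| ≤ M)
    (hg2 : ∀ n, (Summable fun y => (enormZ y ^ q * g n y) ^ 2) ∧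
      ∑' y, (enormZ y ^ q * g n y) ^ 2 ≤ M ^ 2)
    (hG : ∀ n z, ‖G n z‖ ≤ C * (1 + enormZ z) ^ (-a))
    (hlim : ∀ y, Tendsto (fun n => ((enormZ (x n) ^ a : ℝ) : ℂ) * G n (x n - y)) atTop (𝓝 L)) :
    Tendsto (fun n => ((enormZ (x n) ^ a : ℝ) : ℂ) * ∑' y, (g n y : ℂ) * G n (x n - y) -
      ((∑' y, g n y : ℝ) : ℂ) * L) atTop (𝓝 0) := by
  have hWs := summable_one_add_enormZ_rpow ha
  set W := ∑' z : Fin d → ℤ, (1 + enormZ z) ^ (-(2 * a + 3 / 2)) with hW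
  set D : ℕ → (Fin d → ℤ) → ℂ := fun n y => ((enormZ (x n) ^ a : ℝ) : ℂ) * G n (x n - y) - L with hD
  have hD0 : ∀ y, Tendsto (fun n => ‖D n y‖) atTop (𝓝 0) := fun y => by
    have := ((hlim y).sub_const L).norm
    rwa [sub_self, norm_zero] at this
  have hrw : ∀ n, ((enormZ (x n) ^ a : ℝ) : ℂ) * ∑' y, (g n y : ℂ) * G n (x n - y) -
      ((∑' y, g n y : ℝ) : ℂ) * L = ∑' y, (g n y : ℂ) * D n y := fun n => by
    have hs1 : Summable fun y => (g n y : ℂ) := by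
      refine Summable.of_norm ?_
      simpa using (hg1 n).1
    have hs2 : Summable fun y => (g n y : ℂ) * G n (x n - y) := by
      refine Summable.of_norm_bounded ((hg1 n).1.mul_right C) fun y => ?_
      rw [norm_mul, Complex.norm_real, Real.norm_eq_abs]
      refine mul_le_mul_of_nonneg_left ((hG n _).trans (mul_le_of_le_one_right hC ?_)) (abs_nonneg _)
      exact Real.rpow_le_one_of_one_le_of_nonpos (by linarith [enormZ_nonneg (x n - y)]) (by linarith)
    rw [Complex.ofReal_tsum, ← tsum_mul_left, ← tsum_mul_right,
      ← (hs2.mul_left _).tsum_sub (hs1.mul_right L)]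
    refine tsum_congr fun y => ?_
    simp only [hD]; ring
  have hgle : ∀ n y, |g n y| ≤ M := fun n y =>
    ((hg1 n).1.le_tsum y fun z _ => abs_nonneg _).trans (hg1 n).2
  have key : ∀ R : ℝ, 0 < R → ∀ᶠ n in atTop,
      ‖∑' y, (g n y : ℂ) * D n y‖ ≤ (∑ y ∈ (finite_enormZ_le (d := d) R).toFinset, M * ‖D n y‖ +
        C * (2 ^ (q + 1) * enormZ (x n) ^ (-(1 / 4) : ℝ) * (M ^ 2 + W))) +
        (C * 2 ^ a + ‖L‖) * R ^ (-ζ) * M := by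
    intro R hR
    set F := (finite_enormZ_le (d := d) R).toFinset with hF
    filter_upwards [hx.eventually_ge_atTop 1] with n hn
    have hsh : HasSum (fun y => (1 + enormZ (x n - y)) ^ (-(2 * a + 3 / 2))) W :=
      ((Equiv.subLeft (x n)).hasSum_iff).2 hWs.hasSum
    have hsF : HasSum (fun y => if y ∈ F then M * ‖D n y‖ else 0) (∑ y ∈ F, M * ‖D n y‖) := by
      have : HasSum (fun y => if y ∈ F then M * ‖D n y‖ else 0)
          (∑ y ∈ F, if y ∈ F then M * ‖D n y‖ else 0) :=
        hasSum_sum_of_ne_finset_zero fun b hb => by simp [hb]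
      rwa [Finset.sum_congr rfl (fun y hy => if_pos hy)] at this
    have hmaj := (hsF.add ((((hg2 n).1.hasSum.add hsh).mul_left
      (2 ^ (q + 1) * enormZ (x n) ^ (-(1 / 4) : ℝ))).mul_left C)).add
      ((hgζ n).1.hasSum.mul_left ((C * 2 ^ a + ‖L‖) * R ^ (-ζ)))
    refine (tsum_of_norm_bounded hmaj fun y => ?_).trans ?_
    · have hX : 0 ≤ enormZ (x n) := enormZ_nonneg _
      have hY : 0 ≤ enormZ y := enormZ_nonneg _
      have hZ : 0 ≤ enormZ (x n - y) := enormZ_nonneg _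
      rw [norm_mul, Complex.norm_real, Real.norm_eq_abs]
      by_cases hy : y ∈ F
      · rw [if_pos hy]
        have h1 : |g n y| * ‖D n y‖ ≤ M * ‖D n y‖ :=
          mul_le_mul_of_nonneg_right (hgle n y) (norm_nonneg _)
        have h2 : 0 ≤ C * (2 ^ (q + 1) * enormZ (x n) ^ (-(1 / 4) : ℝ) *
            ((enormZ y ^ q * g n y) ^ 2 + (1 + enormZ (x n - y)) ^ (-(2 * a + 3 / 2)))) := by
          positivity
        have h3 : 0 ≤ (C * 2 ^ a + ‖L‖) * R ^ (-ζ) * (enormZ y ^ ζ * |g n y|) := by positivity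
        linarith
      · rw [if_neg hy, zero_add]
        have hyR : R < enormZ y := by
          rw [hF, Set.Finite.mem_toFinset] at hy
          exact not_le.1 hy
        have h1 : ‖D n y‖ ≤ enormZ (x n) ^ a * (C * (1 + enormZ (x n - y)) ^ (-a)) + ‖L‖ := by
          refine (norm_sub_le _ _).trans (add_le_add_left ?_ _)
          rw [norm_mul, Complex.norm_real, Real.norm_of_nonneg (by positivity)]
          exact mul_le_mul_of_nonneg_left (hG n _) (by positivity)
        have h2 := mul_le_mul_of_nonneg_left (green_weight_le ha0 hq (g n y) (y := y) hn) hC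
        have h3 : |g n y| ≤ R ^ (-ζ) * (enormZ y ^ ζ * |g n y|) := by
          rw [← mul_assoc]
          refine le_mul_of_one_le_left (abs_nonneg _) ?_
          rw [Real.rpow_neg hR.le, inv_mul_eq_div, one_le_div (by positivity)]
          exact Real.rpow_le_rpow hR.le hyR.le hζ.le
        have h4 := mul_le_mul_of_nonneg_left h3 (show 0 ≤ C * 2 ^ a + ‖L‖ by positivity)
        have h5 := mul_le_mul_of_nonneg_left h1 (abs_nonneg (g n y))
        nlinarith
    · gcongr
      · exact (hg2 n).2
      · exact (hgζ n).2
  rw [Metric.tendsto_atTop']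
  simp only [hrw]
  rw [← Metric.tendsto_atTop']
  rw [tendsto_zero_iff_norm_tendsto_zero, Metric.tendsto_nhds]
  intro ε hε
  have hR1 : Tendsto (fun R : ℝ => (C * 2 ^ a + ‖L‖) * R ^ (-ζ) * M) atTop (𝓝 0) := by
    simpa using ((tendsto_rpow_neg_atTop hζ).const_mul (C * 2 ^ a + ‖L‖)).mul_const M
  obtain ⟨R, hR, hR0⟩ := ((hR1.eventually (gt_mem_nhds (half_pos hε))).and
    (eventually_gt_atTop 0)).exists
  have hlim2 : Tendsto (fun n => ∑ y ∈ (finite_enormZ_le (d := d) R).toFinset, M * ‖D n y‖ +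
        C * (2 ^ (q + 1) * enormZ (x n) ^ (-(1 / 4) : ℝ) * (M ^ 2 + W))) atTop (𝓝 0) := by
    have h1 : Tendsto (fun n => ∑ y ∈ (finite_enormZ_le (d := d) R).toFinset, M * ‖D n y‖) atTop
        (𝓝 (∑ y ∈ (finite_enormZ_le (d := d) R).toFinset, M * 0)) :=
      tendsto_finsetSum _ fun y _ => (hD0 y).const_mul M
    have h2 := ((((tendsto_rpow_neg_atTop (show (0 : ℝ) < 1 / 4 by norm_num)).comp hx).const_mul
      ((2 : ℝ) ^ (q + 1))).mul_const (M ^ 2 + W)).const_mul C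
    simpa using h1.add h2
  filter_upwards [key R hR0, hlim2.eventually (gt_mem_nhds (half_pos hε))] with n h1 h2
  rw [dist_zero_right, norm_norm]
  linarith

/-! ### Asymptotics along sequences -/

section

variable {S J h : (Fin d → ℤ) → ℝ} {M K ζ : ℝ}

lemma tilt_zero (f : (Fin d → ℤ) → ℝ) : tilt f 0 = f := by
  ext y; simp [tilt, rdotZ_zero_left]

lemma tilted_representation (hS : AssumptionOmega S) (hJ : AssumptionJ S J h M K ζ)
    {μ : Fin d → ℝ} (hμ : μ ∈ closure (Omega S)) (x : Fin d → ℤ) :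
    (2 * π) ^ d * ((S x * Real.exp (rdotZ μ x) : ℝ) : ℂ) =
      ∑' y, (tilt h μ y : ℂ) * ∫ t in Set.Ioi (0 : ℝ), heat (tilt J μ) t (x - y) := by
  have hlt := tiltSum_lt_one hJ hS.nonneg hS.zero_mem
  have hSs : Summable fun y => |S y| := by
    have := (mem_Omega_iff hS.nonneg).1 hS.zero_mem
    rw [tilt_zero] at this
    exact this.abs
  have hre : ∀ k ∈ torus d, 1 - tiltSum J 0 ≤ (1 - fourierZ J k).re := fun k hk => by
    have h1 := (hJ.memQ 0 (subset_closure hS.zero_mem)).infrared k fun i => by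
      have := hk i (Set.mem_univ i)
      exact abs_le.2 this
    rw [tilt_zero, fourierZ_zero, Complex.sub_re, Complex.ofReal_re, ← tiltSum_zero] at h1
    rw [Complex.sub_re, Complex.one_re]
    have : 0 ≤ K * enormR k ^ 2 := mul_nonneg hJ.K_pos.le (sq_nonneg _)
    linarith
  have hrep := green_representation hJ.J_summable hJ.h_summable hSs hJ.OZ_eq (sub_pos.2 hlt) hre x
  have hν := ((hJ.memQ μ hμ).Q_summable hJ.M_pos.le).1
  rw [Complex.ofReal_mul, ← mul_assoc, hrep, ← tsum_mul_right]
  refine tsum_congr fun y => ?_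
  simp only [heat_tilt hJ.J_summable hν]
  rw [integral_const_mul, tilt, ← mul_assoc, ← Complex.ofReal_mul, mul_assoc (h y),
    ← Real.exp_add, rdotZ_sub, add_sub_cancel, Complex.ofReal_mul]
  ring

/-- The prefactor in the Ornstein–Zernike asymptotics. -/
def ozFactor (d : ℕ) (η : Fin d → ℝ) (A : Matrix (Fin d) (Fin d) ℝ) : ℝ :=
  (2 * π) ^ (((d : ℝ) - 1) / 2 - d) * Real.sqrt A.det *
    (Real.sqrt (rdot η (A⁻¹ *ᵥ η)) / enormR η) * enormR η ^ (-(((d : ℝ) - 3) / 2))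

lemma ozFactor_mul_eq_one {η : Fin d → ℝ} {A : Matrix (Fin d) (Fin d) ℝ} (hη : 0 < enormR η)
    (hA : A.PosDef) :
    enormR η ^ (((d : ℝ) - 1) / 2) * ((2 * π) ^ ((d : ℝ) / 2) / Real.sqrt A.det *
      Real.sqrt (2 * π / rdot η (A⁻¹ *ᵥ η))) * ozFactor d η A = 1 := by
  have hdet := Real.sqrt_pos.2 hA.det_pos
  have hq : 0 < rdot η (A⁻¹ *ᵥ η) := by
    have hη0 : η ≠ 0 := by
      rintro rfl
      simp [enormR] at hη
    have := hA.inv.dotProduct_mulVec_pos hη0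
    simpa [rdot, dotProduct] using this
  have hqs := Real.sqrt_pos.2 hq
  have hpi : (0 : ℝ) < 2 * π := by positivity
  rw [ozFactor, Real.sqrt_div hpi.le, Real.sqrt_eq_rpow (2 * π)]
  have h1 : (2 * π) ^ ((d : ℝ) / 2) * (2 * π) ^ (1 / 2 : ℝ) * (2 * π) ^ (((d : ℝ) - 1) / 2 - d) = 1 := by
    rw [← Real.rpow_add hpi, ← Real.rpow_add hpi]
    convert Real.rpow_zero _ using 2
    ring
  have h2 : enormR η ^ (((d : ℝ) - 1) / 2) * enormR η ^ (-(((d : ℝ) - 3) / 2)) = enormR η := by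
    rw [← Real.rpow_add hη]
    convert Real.rpow_one _ using 2
    ring
  calc _ = ((2 * π) ^ ((d : ℝ) / 2) * (2 * π) ^ (1 / 2 : ℝ) * (2 * π) ^ (((d : ℝ) - 1) / 2 - d)) *
        (enormR η ^ (((d : ℝ) - 1) / 2) * enormR η ^ (-(((d : ℝ) - 3) / 2))) / enormR η *
        (Real.sqrt A.det / Real.sqrt A.det) *
        (Real.sqrt (rdot η (A⁻¹ *ᵥ η)) / Real.sqrt (rdot η (A⁻¹ *ᵥ η))) := by ring
    _ = 1 := by rw [h1, h2, div_self hdet.ne', div_self hqs.ne', one_mul, div_self hη.ne']; ring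

lemma tendsto_ozFactor {η : ℕ → Fin d → ℝ} {A : ℕ → Matrix (Fin d) (Fin d) ℝ} {η' : Fin d → ℝ}
    {A' : Matrix (Fin d) (Fin d) ℝ} (hη : Tendsto η atTop (𝓝 η')) (hA : Tendsto A atTop (𝓝 A'))
    (hpos : 0 < enormR η') (hdet : A'.det ≠ 0) :
    Tendsto (fun n => ozFactor d (η n) (A n)) atTop (𝓝 (ozFactor d η' A')) := by
  have h1 : Tendsto (fun n => (A n).det) atTop (𝓝 A'.det) :=
    ((continuous_id.matrix_det).tendsto A').comp hA
  have h2 : Tendsto (fun n => enormR (η n)) atTop (𝓝 (enormR η')) :=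
    ((continuous_enormR (d := d)).tendsto η').comp hη
  have h3 : Tendsto (fun n => (A n)⁻¹) atTop (𝓝 A'⁻¹) := by
    simp only [Matrix.inv_def, Ring.inverse_eq_inv']
    exact (h1.inv₀ hdet).smul (((continuous_id.matrix_adjugate).tendsto A').comp hA)
  have h4 : Tendsto (fun n => rdot (η n) ((A n)⁻¹ *ᵥ η n)) atTop (𝓝 (rdot η' (A'⁻¹ *ᵥ η'))) := by
    have hc : Continuous fun p : (Fin d → ℝ) × Matrix (Fin d) (Fin d) ℝ => rdot p.1 (p.2 *ᵥ p.1) := by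
      unfold rdot Matrix.mulVec dotProduct
      fun_prop
    exact (hc.tendsto (η', A'⁻¹)).comp (hη.prodMk_nhds h3)
  exact ((tendsto_const_nhds.mul h1.sqrt).mul (h4.sqrt.div h2 hpos.ne')).mul
    (h2.rpow_const (Or.inl hpos.ne'))

/-- Ornstein–Zernike asymptotics along sequences whose optimal tilts converge. -/
lemma oz_sequence_limit (hd : 1 ≤ d) (hS : AssumptionOmega S) (hJ : AssumptionJ S J h M K ζ)
    {x : ℕ → Fin d → ℤ} {μ : ℕ → Fin d → ℝ} {μ' : Fin d → ℝ}
    (hx : Tendsto (fun n => enormZ (x n)) atTop atTop) (hx0 : ∀ n, x n ≠ 0)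
    (hopt : ∀ n, IsOptTilt S (toR (x n)) (μ n)) (hμ : Tendsto μ atTop (𝓝 μ'))
    (hμ' : μ' ∈ frontier (Omega S)) :
    Tendsto (fun n => (2 * π) ^ d * (S (x n) * Real.exp (rdotZ (μ n) (x n))) *
      enormZ (x n) ^ (((d : ℝ) - 1) / 2) * ozFactor d (etaOf J (μ n)) (LambdaOf J (μ n)) -
      tiltSum h (μ n)) atTop (𝓝 0) := by
  have hd1 : (1 : ℝ) ≤ d := by exact_mod_cast hd
  have hM := hJ.M_pos
  have hcl : ∀ n, μ n ∈ closure (Omega S) := fun n => frontier_subset_closure (hopt n).1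
  have hcl' := frontier_subset_closure hμ'
  obtain ⟨e₀, he₀, he⟩ := exists_le_enormR_etaOf hS hJ
  have hμw : Tendsto μ atTop (𝓝[closure (Omega S)] μ') :=
    tendsto_nhdsWithin_iff.2 ⟨hμ, Eventually.of_forall hcl⟩
  have hker : ∀ ν ∈ frontier (Omega S), Ker (2 * M + 1) K (min ζ 1) (tilt J ν) := fun ν hν => by
    have h1 := hJ.ker (frontier_subset_closure hν)
    rwa [normalizeKer_eq (Q := tilt J ν) (tiltSum_eq_one hS hJ hν)] at h1
  have hηlim : Tendsto (fun n => etaOf J (μ n)) atTop (𝓝 (etaOf J μ')) :=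
    (continuousOn_etaOf hJ μ' hcl').tendsto.comp hμw
  have hΛlim : Tendsto (fun n => LambdaOf J (μ n)) atTop (𝓝 (LambdaOf J μ')) :=
    (continuousOn_LambdaOf hJ μ' hcl').tendsto.comp hμw
  have hApos : (LambdaOf J μ').PosDef := by
    rw [LambdaOf_eq]
    exact (hker μ' hμ').cov_posDef
  have hηpos : ∀ ν ∈ frontier (Omega S), 0 < enormR (etaOf J ν) := fun ν hν => he₀.trans_le (he ν hν)
  have hdir : ∀ n, toR (x n) = (enormZ (x n) / enormR (etaOf J (μ n))) • etaOf J (μ n) := fun n => by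
    have hne : toR (x n) ≠ 0 := fun h0 => hx0 n (by ext i; simpa [toR] using congrFun h0 i)
    obtain ⟨c, hc, hxc⟩ := exists_eq_smul_etaOf hS hJ hne (hopt n)
    have h1 : enormZ (x n) = c * enormR (etaOf J (μ n)) := by
      rw [enormZ_eq, hxc, enormR_smul, abs_of_pos hc]
    rw [h1, mul_div_cancel_right₀ _ (hηpos _ (hopt n).1).ne']
    exact hxc
  set a := ((d : ℝ) - 1) / 2 with ha
  set T := fun n => enormZ (x n) / enormR (etaOf J (μ n)) with hTdef
  have hnorm : Tendsto (fun n => enormR (etaOf J (μ n))) atTop (𝓝 (enormR (etaOf J μ'))) :=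
    ((continuous_enormR (d := d)).tendsto _).comp hηlim
  have hT : Tendsto T atTop atTop := by
    simp only [hTdef, div_eq_mul_inv]
    exact hx.atTop_mul_pos (inv_pos.2 (hηpos μ' hμ')) (hnorm.inv₀ (hηpos μ' hμ').ne')
  have hmin : 0 < min ζ 1 := lt_min hJ.zeta_pos one_pos
  obtain ⟨C, hC, hgb⟩ := exists_green_bound d hd (show 0 < 2 * M + 1 by linarith) hJ.K_pos hmin he₀
  set L : ℝ := enormR (etaOf J μ') ^ a * ((2 * π) ^ ((d : ℝ) / 2) / Real.sqrt (LambdaOf J μ').det *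
    Real.sqrt (2 * π / rdot (etaOf J μ') ((LambdaOf J μ')⁻¹ *ᵥ etaOf J μ'))) with hL
  have hlim : ∀ y, Tendsto (fun n => ((enormZ (x n) ^ a : ℝ) : ℂ) *
      ∫ t in Set.Ioi (0 : ℝ), heat (tilt J (μ n)) t (x n - y)) atTop (𝓝 (L : ℂ)) := fun y => by
    have h1 := green_limit (T := T) (f := fun n => tilt J (μ n)) (z := fun n => x n - y)
      (B := enormZ y) (η := etaOf J μ') (A := LambdaOf J μ') hd he₀ (fun n => hker _ (hopt n).1)
      (fun n => by rw [← etaOf_eq]; exact he _ (hopt n).1) hT (fun n => ?_)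
      (by simpa only [← etaOf_eq] using hηlim) (by simpa only [← LambdaOf_eq] using hΛlim)
    · rw [integral_gaussInt_line hApos] at h1
      have h2 := (Complex.continuous_ofReal.tendsto _).comp
        (hnorm.rpow_const (p := a) (Or.inl (hηpos μ' hμ').ne'))
      have h3 := h2.mul h1
      rw [hL, Complex.ofReal_mul]
      refine h3.congr fun n => ?_
      have hp := hηpos _ (hopt n).1
      rw [Function.comp_apply, ← mul_assoc, ← Complex.ofReal_mul, hTdef,
        Real.div_rpow (enormZ_nonneg _) hp.le, mul_div_cancel₀ _ (by positivity)]
    · rw [toR_sub, hdir n, ← etaOf_eq, sub_right_comm, sub_self, zero_sub, enormR_neg]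
      exact le_rfl
  have hconv := conv_limit (a := a) (q := max 2 ((d : ℝ) - 1)) (ζ := ζ) (M := M) (C := C)
    (g := fun n => tilt h (μ n))
    (G := fun n z => ∫ t in Set.Ioi (0 : ℝ), heat (tilt J (μ n)) t z) (x := x) (L := (L : ℂ))
    (by rw [ha]; linarith) (by rw [ha]; linarith)
    (by
      rw [ha]
      rcases le_total ((d : ℝ) - 1) 2 with h2 | h2
      · rw [max_eq_left h2]; linarith
      · rw [max_eq_right h2]; linarith) hJ.zeta_pos hC.le hx
    (fun n => (hJ.memQ _ (hcl n)).g_summable hM.le)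
    (fun n => (hJ.memQ _ (hcl n)).g_moment_summable hM.le)
    (fun n => (hJ.memQ _ (hcl n)).g_sq_summable hd hM.le hJ.zeta_pos)
    (fun n z => hgb _ (hker _ (hopt n).1) (by rw [← etaOf_eq]; exact he _ (hopt n).1) z) hlim
  have hreal : Tendsto (fun n => (2 * π) ^ d * (S (x n) * Real.exp (rdotZ (μ n) (x n))) *
      enormZ (x n) ^ a - tiltSum h (μ n) * L) atTop (𝓝 0) := by
    have h1 := (Complex.continuous_re.tendsto 0).comp hconv
    rw [Complex.zero_re] at h1
    refine h1.congr fun n => ?_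
    rw [Function.comp_apply, ← tilted_representation hS hJ (hcl n)]
    have h2 : ((enormZ (x n) ^ a : ℝ) : ℂ) *
        ((2 * π) ^ d * ((S (x n) * Real.exp (rdotZ (μ n) (x n)) : ℝ) : ℂ)) -
        ((∑' y, tilt h (μ n) y : ℝ) : ℂ) * L =
        (((2 * π) ^ d * (S (x n) * Real.exp (rdotZ (μ n) (x n))) *
          enormZ (x n) ^ a - tiltSum h (μ n) * L : ℝ) : ℂ) := by
      have : tiltSum h (μ n) = ∑' y, tilt h (μ n) y := rfl
      rw [this]
      push_cast; ring
    rw [h2, Complex.ofReal_re]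
  have hfac := tendsto_ozFactor hηlim hΛlim (hηpos μ' hμ') hApos.det_pos.ne'
  have hone : L * ozFactor d (etaOf J μ') (LambdaOf J μ') = 1 :=
    ozFactor_mul_eq_one (hηpos μ' hμ') hApos
  have hh : Tendsto (fun n => tiltSum h (μ n)) atTop (𝓝 (tiltSum h μ')) :=
    (continuousOn_tiltSum_h hJ μ' hcl').tendsto.comp hμw
  have hfin := (hreal.mul hfac).add (hh.mul ((hfac.const_mul L).sub_const 1))
  rw [hone, sub_self, mul_zero, zero_mul, add_zero] at hfin
  exact hfin.congr fun n => by ring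

end

theorem statement6 (d : ℕ) (hd : 1 ≤ d) (S J h : (Fin d → ℤ) → ℝ) (M K ζ : ℝ)
    (hS : AssumptionOmega S) (hJ : AssumptionJ S J h M K ζ) :
    ∀ ε' : ℝ, 0 < ε' → ∃ R : ℝ, 0 < R ∧
      ∀ x : Fin d → ℤ, R ≤ enormZ x →
      ∀ μx : Fin d → ℝ, IsOptTilt S (toR x) μx →
        |S x * Real.exp (mass S * normS S (toR x)) * (2 * π) ^ (((d : ℝ) - 1) / 2) *
            Real.sqrt (LambdaOf J μx).det *
            Real.sqrt (rdot (fun j => toR x j / enormZ x)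
              ((LambdaOf J μx)⁻¹ *ᵥ fun j => toR x j / enormZ x)) *
            enormZ x ^ (((d : ℝ) - 1) / 2) *
            enormR (etaOf J μx) ^ (-(((d : ℝ) - 3) / 2)) - tiltSum h μx| ≤ ε' := by
  intro ε' hε'
  by_contra! hcon
  choose x hxR μ hopt hlt using fun n : ℕ => hcon (n + 1) (by positivity)
  have hx0 : ∀ n, x n ≠ 0 := fun n h0 => by
    have h1 := hxR n
    rw [h0, enormZ_zero] at h1
    linarith [n.cast_nonneg (α := ℝ)]
  have hxlim : Tendsto (fun n => enormZ (x n)) atTop atTop :=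
    tendsto_atTop_mono (fun n => (le_add_of_nonneg_right zero_le_one).trans (hxR n))
      tendsto_natCast_atTop_atTop
  have hcomp : IsCompact (frontier (Omega S)) :=
    (isCompact_closure_Omega hS).of_isClosed_subset isClosed_frontier frontier_subset_closure
  obtain ⟨μ', hμ', φ, hφ, hφlim⟩ := hcomp.tendsto_subseq fun n => (hopt n).1
  have hlim := oz_sequence_limit hd hS hJ (x := x ∘ φ) (μ := μ ∘ φ)
    (hxlim.comp hφ.tendsto_atTop) (fun n => hx0 _) (fun n => hopt _) hφlim hμ'
  obtain ⟨n, hn⟩ := (hlim.abs.eventually (gt_mem_nhds (show |(0 : ℝ)| < ε' by simpa))).exists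
  refine (hlt (φ n)).not_ge (le_of_eq_of_le ?_ hn.le)
  have hX : 0 < enormZ (x (φ n)) := one_pos.trans_le (one_le_enormZ (hx0 _))
  have hne : toR (x (φ n)) ≠ 0 := fun h0 => hx0 (φ n) (by ext i; simpa [toR] using congrFun h0 i)
  obtain ⟨c, hc, hxc⟩ := exists_eq_smul_etaOf hS hJ hne (hopt (φ n))
  obtain ⟨e₀, he₀, he⟩ := exists_le_enormR_etaOf hS hJ
  have hη : 0 < enormR (etaOf J (μ (φ n))) := he₀.trans_le (he _ (hopt _).1)
  have hdir : (fun j => toR (x (φ n)) j / enormZ (x (φ n))) =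
      (enormR (etaOf J (μ (φ n))))⁻¹ • etaOf J (μ (φ n)) := by
    have h1 : enormZ (x (φ n)) = c * enormR (etaOf J (μ (φ n))) := by
      rw [enormZ_eq, hxc, enormR_smul, abs_of_pos hc]
    ext j
    rw [h1, hxc, Pi.smul_apply, Pi.smul_apply, smul_eq_mul, smul_eq_mul]
    field_simp
  have hsqrt : Real.sqrt (rdot (fun j => toR (x (φ n)) j / enormZ (x (φ n)))
      ((LambdaOf J (μ (φ n)))⁻¹ *ᵥ fun j => toR (x (φ n)) j / enormZ (x (φ n)))) =
      Real.sqrt (rdot (etaOf J (μ (φ n))) ((LambdaOf J (μ (φ n)))⁻¹ *ᵥ etaOf J (μ (φ n)))) /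
        enormR (etaOf J (μ (φ n))) := by
    rw [hdir, Matrix.mulVec_smul, rdot_smul_left, rdot_smul_right, ← mul_assoc, ← sq,
      Real.sqrt_mul (sq_nonneg _), Real.sqrt_sq (inv_nonneg.2 hη.le), inv_mul_eq_div]
  have hpi : (2 * π) ^ (((d : ℝ) - 1) / 2) =
      (2 * π) ^ d * (2 * π) ^ (((d : ℝ) - 1) / 2 - d) := by
    rw [← Real.rpow_natCast, ← Real.rpow_add (by positivity)]
    congr 1; ring
  rw [hsqrt, mass_mul_normS hd hS (hopt (φ n)), hpi]
  congr 1
  simp only [Function.comp_apply, ozFactor, rdotZ_eq]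
  ring

end OZpaper
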